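/- Let η > 0, α ∈ (0,2], and let {W(x)}_{x∈ℝ^d} be a centred Gaussian random field with stationary increments, W(0) = 0 almost surely, and Var(W(x)) = η‖x‖^α. Let {Z(x)}_{x∈ℝ^d} be a strictly stationary, sample-continuous, jointly measurable random field whose finite-dimensional distributions are those of the Brown–Resnick field associated with the variogram γ(x) = η‖x‖^α: for all x₁,…,x_n ∈ ℝ^d and z₁,…,z_n > 0, P(Z(x_i) ≤ z_i, i = 1,…,n) = exp(−E[max_{1≤i≤n} Y(x_i)/z_i]), where Y(x) = exp(W(x) − η‖x‖^α/2). Let δ > 0 and F : (0,∞) → ℝ be Borel measurable with E[|F(Z(0))|^{2+δ}] < ∞ and σ² := ∫_{ℝ^d} Cov(F(Z(0)), F(Z(x))) λ(dx) > 0. Then X = {F(Z(x))}_{x∈ℝ^d} satisfies the CLT: ∫_{ℝ^d} |Cov(X(0), X(x))| λ(dx) < ∞, and for every Van Hove sequence (V_n) in ℝ^d, λ(V_n)^{−1/2} ∫_{V_n} (X(x) − E[X(x)]) λ(dx) converges in distribution to N(0, σ²) as n → ∞. -/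

import Mathlib

open MeasureTheory ProbabilityTheory Filter Topology
open scoped ENNReal NNReal

noncomputable section

/-- Covariance of two real random variables. -/
def cov {Ω : Type*} [MeasurableSpace Ω] (P : Measure Ω) (X Y : Ω → ℝ) : ℝ :=
  ∫ ω, X ω * Y ω ∂P - (∫ ω, X ω ∂P) * (∫ ω, Y ω ∂P)

/-- A Van Hove sequence in `ℝ^d`. -/
def IsVanHove {d : ℕ} (V : ℕ → Set (EuclideanSpace ℝ (Fin d))) : Prop :=
  (∀ n, Bornology.IsBounded (V n)) ∧ (∀ n, MeasurableSet (V n)) ∧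
  (∀ n, V n ⊆ V (n + 1)) ∧ (⋃ n, V n) = Set.univ ∧
  Tendsto (fun n => (volume (V n)).toReal) atTop atTop ∧
  (∀ r > 0,
    Tendsto
      (fun n => (volume {x | Metric.infDist x (frontier (V n)) ≤ r}).toReal
        / (volume (V n)).toReal) atTop (𝓝 0))

/-- Convergence in distribution of a sequence of real random variables to a limit law,
tested against bounded continuous functions. -/
def TendstoInDistribution {Ω : Type*} [MeasurableSpace Ω] (P : Measure Ω)
    (S : ℕ → Ω → ℝ) (μ : Measure ℝ) : Prop :=
  ∀ f : BoundedContinuousFunction ℝ ℝ,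
    Tendsto (fun n => ∫ ω, f (S n ω) ∂P) atTop (𝓝 (∫ x, f x ∂μ))

namespace BrownResnick

section PiCovariance

variable {K X : Type*}

/-- Exchange the two components of `p k` for `k ∈ s`. -/
def swapOn [DecidableEq K] (s : Finset K) (p : K → X × X) : K → X × X :=
  fun k => if k ∈ s then (p k).swap else p k

/-- The first components of a family of pairs. -/
def fstFam (p : K → X × X) : K → X := fun k => (p k).1

/-- Change of variables along a measure preserving map. -/
lemma integral_comp_measurePreserving {α β G : Type*} [MeasurableSpace α] [MeasurableSpace β]
    [NormedAddCommGroup G] [NormedSpace ℝ G] {μ : Measure α} {ν : Measure β} {f : α → β}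
    (hf : MeasurePreserving f μ ν) {g : β → G} (hg : AEStronglyMeasurable g ν) :
    ∫ x, g (f x) ∂μ = ∫ y, g y ∂ν := by
  rw [← hf.map_eq, integral_map hf.measurable.aemeasurable (by rwa [hf.map_eq])]

variable [DecidableEq K]

lemma swapOn_empty (p : K → X × X) : swapOn ∅ p = p := by
  funext k; simp [swapOn]

lemma swapOn_insert {s : Finset K} {k : K} (hk : k ∉ s) (p : K → X × X) :
    swapOn (insert k s) p = swapOn {k} (swapOn s p) := by
  funext l
  by_cases h : l = k
  · subst h; simp [swapOn, hk]
  · simp [swapOn, h]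

lemma swapOn_comm (s t : Finset K) (p : K → X × X) :
    swapOn s (swapOn t p) = swapOn t (swapOn s p) := by
  funext l
  by_cases h : l ∈ s <;> by_cases h' : l ∈ t <;> simp [swapOn, h, h']

lemma swapOn_swapOn (s : Finset K) (p : K → X × X) : swapOn s (swapOn s p) = p := by
  funext l
  by_cases h : l ∈ s <;> simp [swapOn, h]

variable [Fintype K] [MeasurableSpace X] (μ : Measure X) [IsProbabilityMeasure μ]

lemma measurePreserving_swapOn (s : Finset K) :
    MeasurePreserving (swapOn (X := X) s)
      (Measure.pi fun _ : K => μ.prod μ) (Measure.pi fun _ : K => μ.prod μ) := by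
  have := measurePreserving_pi (fun _ : K => μ.prod μ) (fun _ : K => μ.prod μ)
    (f := fun k p => if k ∈ s then p.swap else p) (fun k => by
      by_cases h : k ∈ s
      · simpa [h] using Measure.measurePreserving_swap (μ := μ) (ν := μ)
      · simpa [h] using! MeasurePreserving.id (μ.prod μ))
  exact this

omit [DecidableEq K] in
lemma measurePreserving_fstFam :
    MeasurePreserving (fstFam (K := K) (X := X))
      (Measure.pi fun _ : K => μ.prod μ) (Measure.pi fun _ : K => μ) := by
  exact measurePreserving_pi (fun _ : K => μ.prod μ) (fun _ : K => μ)
    (f := fun _ p => p.1) (fun k => measurePreserving_fst)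

lemma integral_fstFam_mul_swap (f g : (K → X) → ℂ) :
    ∫ p, f (fstFam p) * g (fstFam (swapOn Finset.univ p)) ∂(Measure.pi fun _ : K => μ.prod μ)
      = (∫ e, f e ∂(Measure.pi fun _ : K => μ)) * ∫ e, g e ∂(Measure.pi fun _ : K => μ) := by
  have h := measurePreserving_arrowProdEquivProdArrow X X K (fun _ => μ) (fun _ => μ)
  rw [← integral_prod_mul, ← h.integral_comp (MeasurableEquiv.measurableEmbedding _)]
  refine integral_congr_ae (ae_of_all _ fun p => ?_)
  have : fstFam (swapOn Finset.univ p) = fun k => (p k).2 := by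
    funext k; simp [fstFam, swapOn]
  simp only [this]
  rfl

lemma norm_cov_pi_le {f g : (K → X) → ℂ} (hf : Measurable f) (hg : Measurable g)
    {C : ℝ} (hfC : ∀ e, ‖f e‖ ≤ C) (hgC : ∀ e, ‖g e‖ ≤ C) {b : K → ℝ}
    (hb : ∀ (s : Finset K) (k : K), k ∉ s →
      ∫ p, ‖f (fstFam p) - f (fstFam (swapOn {k} p))‖ *
        ‖g (fstFam (swapOn s p)) - g (fstFam (swapOn {k} (swapOn s p)))‖
        ∂(Measure.pi fun _ : K => μ.prod μ) ≤ b k) :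
    ‖∫ e, f e * g e ∂(Measure.pi fun _ : K => μ)
      - (∫ e, f e ∂(Measure.pi fun _ : K => μ)) * ∫ e, g e ∂(Measure.pi fun _ : K => μ)‖
      ≤ 2⁻¹ * ∑ k, b k := by
  set Q := Measure.pi fun _ : K => μ.prod μ with hQ
  have hsm : ∀ s : Finset K, Measurable (swapOn (X := X) s) :=
    fun s => (measurePreserving_swapOn μ s).measurable
  have hfm : Measurable (fstFam (K := K) (X := X)) := (measurePreserving_fstFam μ).measurable
  have hint : ∀ s t : Finset K,
      Integrable (fun p => f (fstFam (swapOn s p)) * g (fstFam (swapOn t p))) Q := by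
    intro s t
    refine Integrable.of_bound (C := C * C) ?_ (ae_of_all _ fun p => ?_)
    · exact ((hf.comp (hfm.comp (hsm s))).mul (hg.comp (hfm.comp (hsm t)))).aestronglyMeasurable
    · rw [norm_mul]
      exact mul_le_mul (hfC _) (hgC _) (norm_nonneg _) ((norm_nonneg _).trans (hfC (fstFam p)))
  have hint' : ∀ t : Finset K,
      Integrable (fun p => f (fstFam p) * g (fstFam (swapOn t p))) Q := by
    intro t; simpa [swapOn_empty] using hint ∅ t
  have hstep : ∀ (s : Finset K) (k : K), k ∉ s →
      ‖∫ p, f (fstFam p) * g (fstFam (swapOn s p)) ∂Q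
        - ∫ p, f (fstFam p) * g (fstFam (swapOn (insert k s) p)) ∂Q‖ ≤ 2⁻¹ * b k := by
    intro s k hk
    have e1 : ∫ p, f (fstFam p) * g (fstFam (swapOn s p)) ∂Q
        = ∫ p, f (fstFam (swapOn {k} p)) * g (fstFam (swapOn (insert k s) p)) ∂Q := by
      rw [← integral_comp_measurePreserving (measurePreserving_swapOn μ {k})
        (hint' s).aestronglyMeasurable]
      simp_rw [swapOn_insert hk, ← swapOn_comm s {k}, hQ]
    have e2 : ∫ p, f (fstFam p) * g (fstFam (swapOn (insert k s) p)) ∂Q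
        = ∫ p, f (fstFam (swapOn {k} p)) * g (fstFam (swapOn s p)) ∂Q := by
      rw [← integral_comp_measurePreserving (measurePreserving_swapOn μ {k})
        (hint' _).aestronglyMeasurable]
      simp_rw [swapOn_insert hk, ← swapOn_comm s {k}, swapOn_swapOn, hQ]
    have e3 : ∫ p, f (fstFam p) * g (fstFam (swapOn s p)) ∂Q
        - ∫ p, f (fstFam p) * g (fstFam (swapOn (insert k s) p)) ∂Q
        = 2⁻¹ * ∫ p, (f (fstFam p) - f (fstFam (swapOn {k} p))) *
          (g (fstFam (swapOn s p)) - g (fstFam (swapOn {k} (swapOn s p)))) ∂Q := by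
      have : ∀ p, (f (fstFam p) - f (fstFam (swapOn {k} p))) *
          (g (fstFam (swapOn s p)) - g (fstFam (swapOn {k} (swapOn s p))))
          = (f (fstFam p) * g (fstFam (swapOn s p))
            - f (fstFam p) * g (fstFam (swapOn (insert k s) p)))
            - (f (fstFam (swapOn {k} p)) * g (fstFam (swapOn s p))
            - f (fstFam (swapOn {k} p)) * g (fstFam (swapOn (insert k s) p))) := by
        intro p; rw [swapOn_insert hk]; ring
      simp_rw [this]
      rw [integral_sub (f := fun p => f (fstFam p) * g (fstFam (swapOn s p))
            - f (fstFam p) * g (fstFam (swapOn (insert k s) p)))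
          (g := fun p => f (fstFam (swapOn {k} p)) * g (fstFam (swapOn s p))
            - f (fstFam (swapOn {k} p)) * g (fstFam (swapOn (insert k s) p)))
          ((hint' s).sub (hint' _)) ((hint _ _).sub (hint _ _)),
        integral_sub (hint' s) (hint' _), integral_sub (hint _ _) (hint _ _), ← e1, ← e2]
      ring
    rw [e3, norm_mul]
    have : ‖(2⁻¹ : ℂ)‖ = 2⁻¹ := by simp
    rw [this]
    gcongr
    refine (norm_integral_le_integral_norm _).trans ?_
    simp_rw [norm_mul]
    exact hb s k hk
  have hind : ∀ s : Finset K, ‖∫ p, f (fstFam p) * g (fstFam p) ∂Q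
        - ∫ p, f (fstFam p) * g (fstFam (swapOn s p)) ∂Q‖ ≤ ∑ k ∈ s, 2⁻¹ * b k := by
    intro s
    induction s using Finset.induction_on with
    | empty => simp [swapOn_empty]
    | insert k s hk ih =>
      rw [Finset.sum_insert hk]
      calc _ = ‖(∫ p, f (fstFam p) * g (fstFam (swapOn s p)) ∂Q
              - ∫ p, f (fstFam p) * g (fstFam (swapOn (insert k s) p)) ∂Q)
              + (∫ p, f (fstFam p) * g (fstFam p) ∂Q
              - ∫ p, f (fstFam p) * g (fstFam (swapOn s p)) ∂Q)‖ := by congr 1; ring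
        _ ≤ _ := (norm_add_le _ _).trans (add_le_add (hstep s k hk) ih)
  have h1 := hind Finset.univ
  rw [integral_fstFam_mul_swap μ f g] at h1
  have e4 : ∫ p, f (fstFam p) * g (fstFam p) ∂Q
      = ∫ e, f e * g e ∂(Measure.pi fun _ : K => μ) := by
    exact integral_comp_measurePreserving (measurePreserving_fstFam (K := K) μ)
      (hf.mul hg).aestronglyMeasurable
  rw [e4] at h1
  rw [Finset.mul_sum]
  exact h1

lemma norm_cov_pi_le_sum_min {J : Type*} [Fintype J] {f g : (K → X) → ℂ}
    (hf : Measurable f) (hg : Measurable g)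
    {C : ℝ} (hfC : ∀ e, ‖f e‖ ≤ C) (hgC : ∀ e, ‖g e‖ ≤ C)
    {E : J → K → Set (K → X × X)} (hE : ∀ j k, MeasurableSet (E j k)) {q : J → K → ℝ}
    (hq : ∀ j k, (Measure.pi fun _ : K => μ.prod μ).real (E j k) ≤ q j k)
    {c c' : J → ℝ} (hc : ∀ j, 0 ≤ c j) (hc' : ∀ j, 0 ≤ c' j)
    (hfE : ∀ k p, ‖f (fstFam p) - f (fstFam (swapOn {k} p))‖
      ≤ ∑ j, c j * (E j k).indicator (fun _ => (1 : ℝ)) p)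
    (hgE : ∀ k p, ‖g (fstFam p) - g (fstFam (swapOn {k} p))‖
      ≤ ∑ j, c' j * (E j k).indicator (fun _ => (1 : ℝ)) p) :
    ‖∫ e, f e * g e ∂(Measure.pi fun _ : K => μ)
      - (∫ e, f e ∂(Measure.pi fun _ : K => μ)) * ∫ e, g e ∂(Measure.pi fun _ : K => μ)‖
      ≤ 2⁻¹ * ∑ k, ∑ i, ∑ j, c i * c' j * min (q i k) (q j k) := by
  refine norm_cov_pi_le μ hf hg hfC hgC fun s k _ => ?_
  set Q := Measure.pi fun _ : K => μ.prod μ with hQ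
  have hsm : Measurable (swapOn (X := X) s) := (measurePreserving_swapOn μ s).measurable
  have hle : ∀ p, ‖f (fstFam p) - f (fstFam (swapOn {k} p))‖ *
        ‖g (fstFam (swapOn s p)) - g (fstFam (swapOn {k} (swapOn s p)))‖
      ≤ ∑ i, ∑ j, c i * c' j * (E i k ∩ swapOn s ⁻¹' E j k).indicator (fun _ => (1 : ℝ)) p := by
    intro p
    refine (mul_le_mul (hfE k p) (hgE k (swapOn s p)) (norm_nonneg _)
      ((norm_nonneg _).trans (hfE k p))).trans (le_of_eq ?_)
    rw [Finset.sum_mul_sum]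
    refine Finset.sum_congr rfl fun i _ => Finset.sum_congr rfl fun j _ => ?_
    by_cases h1 : p ∈ E i k <;> by_cases h2 : swapOn s p ∈ E j k <;> simp [h1, h2]
  have hmeas : ∀ i j, MeasurableSet (E i k ∩ swapOn s ⁻¹' E j k) :=
    fun i j => (hE i k).inter (hsm (hE j k))
  have hi : ∀ i j, Integrable
      (fun p => c i * c' j * (E i k ∩ swapOn s ⁻¹' E j k).indicator (fun _ => (1 : ℝ)) p) Q :=
    fun i j => ((integrable_const (1 : ℝ)).indicator (hmeas i j)).const_mul _
  have hbi : Integrable (fun p => ∑ i, ∑ j,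
      c i * c' j * (E i k ∩ swapOn s ⁻¹' E j k).indicator (fun _ => (1 : ℝ)) p) Q :=
    integrable_finsetSum _ fun i _ => integrable_finsetSum _ fun j _ => hi i j
  refine (integral_mono_of_nonneg (ae_of_all _ fun p => by positivity) hbi
    (ae_of_all _ hle)).trans ?_
  rw [integral_finsetSum _ fun i _ => integrable_finsetSum _ fun j _ => hi i j]
  refine Finset.sum_le_sum fun i _ => ?_
  rw [integral_finsetSum _ fun j _ => hi i j]
  refine Finset.sum_le_sum fun j _ => ?_
  rw [integral_const_mul, integral_indicator_const _ (hmeas i j), smul_eq_mul, mul_one]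
  refine mul_le_mul_of_nonneg_left (le_min ?_ ?_) (mul_nonneg (hc i) (hc' j))
  · exact (measureReal_mono Set.inter_subset_left).trans (hq i k)
  · refine (measureReal_mono Set.inter_subset_right).trans (le_trans (le_of_eq ?_) (hq j k))
    exact (measurePreserving_swapOn μ s).measureReal_preimage (hE j k).nullMeasurableSet

end PiCovariance

section MaxLinear

local instance : IsProbabilityMeasure (expMeasure 1) := isProbabilityMeasure_expMeasure one_pos

lemma expMeasure_Ici {w : ℝ} (hw : 0 ≤ w) :
    expMeasure 1 (Set.Ici w) = ENNReal.ofReal (Real.exp (-w)) := by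
  have hna : expMeasure 1 {w} = 0 := by
    simp only [expMeasure, gammaMeasure]
    exact withDensity_absolutelyContinuous _ _ (measure_singleton w)
  have h1 : expMeasure 1 (Set.Iic w) = ENNReal.ofReal (1 - Real.exp (-w)) := by
    have := ofReal_cdf (expMeasure 1) w
    rw [← this, cdf_expMeasure_eq one_pos, if_pos hw, one_mul]
  have h2 : Set.Ici w = (Set.Iic w)ᶜ ∪ {w} := by
    ext x; simp [le_iff_lt_or_eq, eq_comm (a := w)]
  have h3 : expMeasure 1 (Set.Ici w) = expMeasure 1 (Set.Iic w)ᶜ := by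
    refine le_antisymm ?_ (measure_mono fun x hx => (not_le.1 (show ¬ x ≤ w from hx)).le)
    rw [h2]; exact (measure_union_le _ _).trans (by rw [hna, add_zero])
  rw [h3, prob_compl_eq_one_sub measurableSet_Iic, h1, ← ENNReal.ofReal_one,
    ← ENNReal.ofReal_sub]
  · congr 1; ring
  · have := Real.exp_le_one_iff.2 (neg_nonpos.2 hw); linarith

lemma expMeasure_Iic_zero : expMeasure 1 (Set.Iic 0) = 0 := by
  rw [← ofReal_cdf (expMeasure 1) 0, cdf_expMeasure_eq one_pos]; simp

lemma expMeasure_ae_pos : ∀ᵐ x ∂(expMeasure 1), 0 < x := by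
  rw [ae_iff]; simpa [not_lt] using! expMeasure_Iic_zero

variable {K J : Type*} [Fintype K]

/-- The law of a finite family of independent standard exponential variables. -/
abbrev expPi (K : Type*) [Fintype K] : Measure (K → ℝ) := Measure.pi fun _ : K => expMeasure 1

lemma expPi_ae_pos : ∀ᵐ e ∂(expPi K), ∀ k, 0 < e k := by
  rw [ae_all_iff]
  intro k
  exact (measurePreserving_eval (fun _ : K => expMeasure 1) k).quasiMeasurePreserving.ae
    expMeasure_ae_pos

lemma measurePreserving_update [DecidableEq K] {X : Type*} [MeasurableSpace X] (μ : Measure X)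
    [IsProbabilityMeasure μ] (k : K) :
    MeasurePreserving (fun p : (K → X) × X => Function.update p.1 k p.2)
      ((Measure.pi fun _ : K => μ).prod μ) (Measure.pi fun _ : K => μ) := by
  have hm : Measurable (fun p : (K → X) × X => Function.update p.1 k p.2) := by
    rw [measurable_pi_iff]
    intro l
    by_cases h : l = k
    · subst h; simpa using measurable_snd
    · simpa [h] using! (measurable_pi_apply l).comp measurable_fst
  refine ⟨hm, (Measure.pi_eq fun s hs => ?_).symm⟩
  rw [Measure.map_apply hm (MeasurableSet.univ_pi hs)]
  have : (fun p : (K → X) × X => Function.update p.1 k p.2) ⁻¹' Set.univ.pi s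
      = (Set.univ.pi fun l => if l = k then Set.univ else s l) ×ˢ s k := by
    ext p
    simp only [Set.mem_preimage, Set.mem_univ_pi, Set.mem_prod]
    constructor
    · intro h
      refine ⟨fun l => ?_, by simpa using h k⟩
      by_cases hl : l = k
      · simp [hl]
      · simpa [hl] using h l
    · rintro ⟨h, h'⟩ l
      by_cases hl : l = k
      · subst hl; simpa using h'
      · simpa [hl] using h l
  rw [this, Measure.prod_prod, Measure.pi_pi, ← Finset.mul_prod_erase _ _ (Finset.mem_univ k),
    ← Finset.mul_prod_erase _ (fun i => μ (s i)) (Finset.mem_univ k)]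
  simp only [if_true, measure_univ, one_mul]
  rw [mul_comm]
  congr 1
  refine Finset.prod_congr rfl fun l hl => ?_
  rw [if_neg (Finset.ne_of_mem_erase hl)]

/-- The configurations at which the `k`-th term is extremal. -/
def extremal (a : K → ℝ) (k : K) : Set (K → ℝ) := {e | ∀ l, a l / e l ≤ a k / e k}

lemma measurableSet_extremal (a : K → ℝ) (k : K) : MeasurableSet (extremal a k) := by
  simp only [extremal, Set.ofPred_forall]
  exact MeasurableSet.iInter fun l => measurableSet_le
    (measurable_const.div (measurable_pi_apply l)) (measurable_const.div (measurable_pi_apply k))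

lemma lintegral_exp_neg_mul_expMeasure {c : ℝ} (hc : 0 ≤ c) :
    ∫⁻ x, ENNReal.ofReal (Real.exp (-(c * x))) ∂(expMeasure 1) = ENNReal.ofReal (1 + c)⁻¹ := by
  have hm : Measurable (exponentialPDF 1) := (measurable_exponentialPDFReal 1).ennreal_ofReal
  have h0 : expMeasure 1 = volume.withDensity (exponentialPDF 1) := rfl
  rw [h0, lintegral_withDensity_eq_lintegral_mul _ hm (by fun_prop)]
  have h1 : ∀ x, (exponentialPDF 1 * fun x => ENNReal.ofReal (Real.exp (-(c * x)))) x
      = (Set.Ici (0 : ℝ)).indicator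
        (fun x => ENNReal.ofReal (Real.exp (-(1 + c) * x))) x := by
    intro x
    by_cases hx : 0 ≤ x
    · simp only [Pi.mul_apply, exponentialPDF_eq, hx, if_true, Set.mem_Ici, Set.indicator_of_mem]
      rw [← ENNReal.ofReal_mul (by positivity), one_mul, one_mul, ← Real.exp_add]
      congr 2; ring
    · simp [exponentialPDF_eq, hx]
  simp_rw [h1]
  rw [lintegral_indicator measurableSet_Ici, setLIntegral_congr Ioi_ae_eq_Ici.symm,
    ← ofReal_integral_eq_lintegral_ofReal]
  · rw [integral_exp_mul_Ioi (by linarith) 0]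
    congr 1
    rw [mul_zero, Real.exp_zero, neg_div_neg_eq, one_div]
  · exact integrableOn_exp_mul_Ioi (by linarith) 0
  · exact ae_of_all _ fun x => (Real.exp_pos _).le

lemma expPi_extremal_le [DecidableEq K] {a : K → ℝ} (ha : ∀ l, 0 ≤ a l) (hs : 0 < ∑ l, a l)
    (k : K) : (expPi K).real (extremal a k) ≤ a k / ∑ l, a l := by
  rcases (ha k).eq_or_lt with hk | hk
  · obtain ⟨l, -, hl⟩ := Finset.exists_lt_of_sum_lt
      (show ∑ l : K, (0 : ℝ) < ∑ l, a l by simpa using hs)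
    have : (expPi K) (extremal a k) = 0 := by
      refine measure_mono_null (t := {e | ¬ ∀ k, 0 < e k}) ?_ expPi_ae_pos
      intro e he hpos
      have := he l
      rw [← hk, zero_div] at this
      exact absurd this (not_le.2 (div_pos hl (hpos l)))
    rw [measureReal_def, this, ← hk]; simp
  · refine ENNReal.toReal_le_of_le_ofReal (by positivity) ?_
    rw [← (measurePreserving_update (expMeasure 1) k).measure_preimage
      (measurableSet_extremal a k).nullMeasurableSet, Measure.prod_apply_symm
      ((measurePreserving_update (expMeasure 1) k).measurable (measurableSet_extremal a k))]
    have hbound : ∀ᵐ x ∂(expMeasure 1), (expPi K) ((fun e => (e, x)) ⁻¹'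
        ((fun p : (K → ℝ) × ℝ => Function.update p.1 k p.2) ⁻¹' extremal a k))
        ≤ ENNReal.ofReal (Real.exp (-((∑ l ∈ Finset.univ.erase k, a l / a k) * x))) := by
      filter_upwards [expMeasure_ae_pos] with x hx
      calc _ ≤ (expPi K) (Set.univ.pi fun l => if l = k then Set.univ
                else Set.Ici (a l * x / a k)) := by
              refine measure_mono_ae ?_
              filter_upwards [expPi_ae_pos] with e he hmem
              intro l _
              by_cases hl : l = k
              · simp [hl]
              · have := (hmem : ∀ l, _) l
                simp only [Function.update_self, Function.update_of_ne hl] at this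
                simp only [hl, if_false, Set.mem_Ici]
                rw [div_le_div_iff₀ (he l) hx] at this
                rw [div_le_iff₀ hk]; linarith
        _ = ∏ l ∈ Finset.univ.erase k, expMeasure 1 (Set.Ici (a l * x / a k)) := by
              rw [Measure.pi_pi, ← Finset.mul_prod_erase _ _ (Finset.mem_univ k)]
              simp only [if_true, measure_univ, one_mul]
              exact Finset.prod_congr rfl fun l hl => by
                rw [if_neg (Finset.ne_of_mem_erase hl)]
        _ = _ := by
              rw [Finset.prod_congr rfl fun l _ => expMeasure_Ici
                (div_nonneg (mul_nonneg (ha l) hx.le) hk.le),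
                ← ENNReal.ofReal_prod_of_nonneg fun _ _ => (Real.exp_pos _).le, ← Real.exp_sum]
              congr 2
              rw [Finset.sum_neg_distrib, Finset.sum_mul]
              congr 1
              exact Finset.sum_congr rfl fun l _ => by ring
    refine (lintegral_mono_ae hbound).trans (le_of_eq ?_)
    rw [lintegral_exp_neg_mul_expMeasure (Finset.sum_nonneg fun l _ => div_nonneg (ha l) hk.le)]
    congr 1
    rw [← Finset.add_sum_erase _ _ (Finset.mem_univ k), ← Finset.sum_div, inv_eq_one_div,
      div_eq_div_iff]
    · field_simp
    · have : 0 ≤ (∑ l ∈ Finset.univ.erase k, a l) / a k :=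
        div_nonneg (Finset.sum_nonneg fun l _ => ha l) hk.le
      positivity
    · have : 0 ≤ (∑ l ∈ Finset.univ.erase k, a l) := Finset.sum_nonneg fun l _ => ha l
      positivity

/-- The max-linear model with coefficients `a` driven by the unit Fréchet variables `1 / e k`. -/
def maxLin (a : J → K → ℝ) (e : K → ℝ) : J → ℝ := fun j => ⨆ k, a j k / e k

lemma measurable_maxLin (a : J → K → ℝ) : Measurable (maxLin a) := by
  rw [measurable_pi_iff]
  intro j
  exact Measurable.iSup fun k => measurable_const.div (measurable_pi_apply k)

lemma maxLin_le_of_notMem_extremal [DecidableEq K] {a : J → K → ℝ} {e : K → ℝ} {k : K} {x : ℝ}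
    {j : J} (h : e ∉ extremal (a j) k) : maxLin a e j ≤ maxLin a (Function.update e k x) j := by
  simp only [extremal, Set.mem_ofPred_eq, not_forall, not_le] at h
  obtain ⟨l, hl⟩ := h
  have hlk : l ≠ k := by rintro rfl; exact lt_irrefl _ hl
  have : Nonempty K := ⟨k⟩
  refine ciSup_le fun m => ?_
  have hle : ∀ m, m ≠ k → a j m / e m ≤ maxLin a (Function.update e k x) j := by
    intro m hm
    have := le_ciSup (f := fun m => a j m / Function.update e k x m)
      (Set.finite_range _).bddAbove m
    simpa [hm] using! this
  by_cases hm : m = k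
  · subst hm; exact hl.le.trans (hle l hlk)
  · exact hle m hm

lemma maxLin_update_eq [DecidableEq K] {a : J → K → ℝ} {e : K → ℝ} {k : K} {x : ℝ}
    {j : J} (h : e ∉ extremal (a j) k) (h' : Function.update e k x ∉ extremal (a j) k) :
    maxLin a e j = maxLin a (Function.update e k x) j := by
  refine le_antisymm (maxLin_le_of_notMem_extremal h) ?_
  have := maxLin_le_of_notMem_extremal (a := a) (x := e k) h'
  simpa using this

lemma expPi_maxLin_le [Fintype J] {a : J → K → ℝ} (ha : ∀ j k, 0 ≤ a j k) {z : J → ℝ}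
    (hz : ∀ j, 0 < z j) :
    (expPi K) {e | ∀ j, maxLin a e j ≤ z j}
      = ENNReal.ofReal (Real.exp (-∑ k, ⨆ j, a j k / z j)) := by
  have hn : ∀ k, 0 ≤ ⨆ j, a j k / z j := fun k =>
    Real.iSup_nonneg fun j => div_nonneg (ha j k) (hz j).le
  have h1 : (expPi K) {e | ∀ j, maxLin a e j ≤ z j}
      = (expPi K) (Set.univ.pi fun k => Set.Ici (⨆ j, a j k / z j)) := by
    refine measure_congr ?_
    filter_upwards [expPi_ae_pos] with e he
    refine propext ?_
    change (∀ j, maxLin a e j ≤ z j) ↔ e ∈ Set.univ.pi fun k => Set.Ici (⨆ j, a j k / z j)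
    simp only [Set.mem_univ_pi, Set.mem_Ici]
    constructor
    · intro h k
      refine Real.iSup_le (fun j => ?_) (he k).le
      have := (le_ciSup (f := fun k => a j k / e k) (Set.finite_range _).bddAbove k).trans (h j)
      rw [div_le_iff₀ (he k)] at this
      rw [div_le_iff₀ (hz j)]; linarith
    · intro h j
      refine Real.iSup_le (fun k => ?_) (hz j).le
      have := (le_ciSup (f := fun j => a j k / z j) (Set.finite_range _).bddAbove j).trans (h k)
      rw [div_le_iff₀ (hz j)] at this
      rw [div_le_iff₀ (he k)]; linarith
  rw [h1, Measure.pi_pi, Finset.prod_congr rfl fun k _ => expMeasure_Ici (hn k),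
    ← ENNReal.ofReal_prod_of_nonneg fun _ _ => (Real.exp_pos _).le, ← Real.exp_sum,
    Finset.sum_neg_distrib]

lemma expPi_maxLin_nonpos {a : J → K → ℝ} {j : J}
    (hs : 0 < ∑ k, a j k) : (expPi K) {e | maxLin a e j ≤ 0} = 0 := by
  obtain ⟨l, -, hl⟩ := Finset.exists_lt_of_sum_lt
    (show ∑ l : K, (0 : ℝ) < ∑ l, a j l by simpa using hs)
  refine measure_mono_null (t := {e | ¬ ∀ k, 0 < e k}) ?_ expPi_ae_pos
  intro e he hpos
  have := (le_ciSup (f := fun k => a j k / e k) (Set.finite_range _).bddAbove l).trans he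
  exact absurd this (not_le.2 (div_pos hl (hpos l)))

lemma norm_cov_maxLin_le [DecidableEq K] [Fintype J] {a : J → K → ℝ} (ha : ∀ j k, 0 ≤ a j k)
    (hs : ∀ j, 0 < ∑ k, a j k) {f g : (J → ℝ) → ℂ} (hf : Measurable f) (hg : Measurable g)
    {C : ℝ} (hfC : ∀ z, ‖f z‖ ≤ C) (hgC : ∀ z, ‖g z‖ ≤ C)
    {c c' : J → ℝ} (hc : ∀ j, 0 ≤ c j) (hc' : ∀ j, 0 ≤ c' j)
    (hfc : ∀ z z', ‖f z - f z'‖ ≤ ∑ j, c j * {w : ℝ × ℝ | w.1 ≠ w.2}.indicator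
      (fun _ => (1 : ℝ)) (z j, z' j))
    (hgc : ∀ z z', ‖g z - g z'‖ ≤ ∑ j, c' j * {w : ℝ × ℝ | w.1 ≠ w.2}.indicator
      (fun _ => (1 : ℝ)) (z j, z' j)) :
    ‖∫ e, f (maxLin a e) * g (maxLin a e) ∂(expPi K)
      - (∫ e, f (maxLin a e) ∂(expPi K)) * ∫ e, g (maxLin a e) ∂(expPi K)‖
      ≤ ∑ i, ∑ j, c i * c' j * ∑ k, min (a i k / ∑ l, a i l) (a j k / ∑ l, a j l) := by
  have hupd : ∀ (k : K) (p : K → ℝ × ℝ),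
      fstFam (swapOn {k} p) = Function.update (fstFam p) k (p k).2 := by
    intro k p; funext l
    by_cases h : l = k
    · subst h; simp [fstFam, swapOn]
    · simp [fstFam, swapOn, h]
  have hmf := measurePreserving_fstFam (K := K) (expMeasure 1)
  have hms : ∀ k : K, _ := fun k => measurePreserving_swapOn (expMeasure 1) {k}
  have hind : ∀ (k : K) (p : K → ℝ × ℝ) (j : J),
      {w : ℝ × ℝ | w.1 ≠ w.2}.indicator (fun _ => (1 : ℝ))
        (maxLin a (fstFam p) j, maxLin a (fstFam (swapOn {k} p)) j)
      ≤ (fstFam ⁻¹' extremal (a j) k ∪ (swapOn {k}) ⁻¹' (fstFam ⁻¹' extremal (a j) k)).indicator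
        (fun _ => (1 : ℝ)) p := by
    intro k p j
    by_cases h : p ∈ fstFam ⁻¹' extremal (a j) k ∪
        (swapOn {k}) ⁻¹' (fstFam ⁻¹' extremal (a j) k)
    · rw [Set.indicator_of_mem h]
      exact Set.indicator_le_self' (fun _ _ => zero_le_one) _ |>.trans le_rfl
    · rw [Set.indicator_of_notMem h, Set.indicator_of_notMem]
      simp only [Set.mem_union, Set.mem_preimage, not_or, hupd] at h
      simp only [Set.mem_ofPred_eq, not_not, hupd]
      exact maxLin_update_eq h.1 h.2
  have key := norm_cov_pi_le_sum_min (expMeasure 1) (f := fun e => f (maxLin a e))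
    (g := fun e => g (maxLin a e)) (hf.comp (measurable_maxLin a)) (hg.comp (measurable_maxLin a))
    (fun e => hfC _) (fun e => hgC _)
    (E := fun j k => fstFam ⁻¹' extremal (a j) k ∪
      (swapOn {k}) ⁻¹' (fstFam ⁻¹' extremal (a j) k))
    (fun j k => (hmf.measurable (measurableSet_extremal _ _)).union
      ((hms k).measurable (hmf.measurable (measurableSet_extremal _ _))))
    (q := fun j k => 2 * (a j k / ∑ l, a j l))
    (fun j k => by
      have h1 := hmf.measureReal_preimage (measurableSet_extremal (a j) k).nullMeasurableSet
      have h2 := (hms k).measureReal_preimage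
        (hmf.measurable (measurableSet_extremal (a j) k)).nullMeasurableSet
      refine (measureReal_union_le _ _).trans ?_
      rw [h2, h1, ← two_mul]
      exact mul_le_mul_of_nonneg_left (expPi_extremal_le (ha j) (hs j) k) zero_le_two)
    hc hc'
    (fun k p => (hfc _ _).trans (Finset.sum_le_sum fun j _ =>
      mul_le_mul_of_nonneg_left (hind k p j) (hc j)))
    (fun k p => (hgc _ _).trans (Finset.sum_le_sum fun j _ =>
      mul_le_mul_of_nonneg_left (hind k p j) (hc' j)))
  refine key.trans (le_of_eq ?_)
  simp_rw [← mul_min_of_nonneg _ _ (zero_le_two (α := ℝ))]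
  rw [Finset.sum_comm, Finset.mul_sum]
  refine Finset.sum_congr rfl fun i _ => ?_
  rw [Finset.sum_comm, Finset.mul_sum]
  refine Finset.sum_congr rfl fun j _ => ?_
  rw [Finset.mul_sum, Finset.mul_sum]
  exact Finset.sum_congr rfl fun k _ => by ring

end MaxLinear

section WeakConvergence

variable {J : Type*} [Fintype J]

lemma tendsto_probabilityMeasure_of_Iic {μ : ℕ → ProbabilityMeasure (J → ℝ)}
    {ν : ProbabilityMeasure (J → ℝ)}
    (h : ∀ u : J → ℝ, Tendsto (fun n => (μ n : Measure (J → ℝ)).real (Set.Iic u)) atTop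
      (𝓝 ((ν : Measure (J → ℝ)).real (Set.Iic u)))) :
    Tendsto μ atTop (𝓝 ν) := by
  classical
  have hmI : ∀ u : J → ℝ, MeasurableSet (Set.Iic u) := fun u => by
    rw [← Set.pi_univ_Iic]
    exact MeasurableSet.univ_pi fun _ => measurableSet_Iic
  have hbox : ∀ a b : J → ℝ, (Set.univ.pi fun j => Set.Ioc (a j) (b j))
      = Set.Iic b \ ⋃ s ∈ Finset.univ.image
        (fun j => Set.Iic (Function.update b j (min (a j) (b j)))), s := by
    intro a b
    ext z
    simp only [Set.mem_univ_pi, Set.mem_Ioc, Set.mem_sdiff, Set.mem_Iic, Finset.mem_image,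
      Finset.mem_univ, true_and, Set.mem_iUnion, exists_prop, not_exists, not_and]
    constructor
    · refine fun hz => ⟨fun j => (hz j).2, ?_⟩
      rintro _ ⟨j, rfl⟩ hj
      have := hj j
      rw [Function.update_self] at this
      exact absurd (this.trans (min_le_left _ _)) (not_le.2 (hz j).1)
    · rintro ⟨hb, h⟩ j
      refine ⟨not_le.1 fun hle => h _ ⟨j, rfl⟩ fun i => ?_, hb j⟩
      by_cases hi : i = j
      · subst hi; simpa using ⟨hle, hb i⟩
      · simpa [hi] using hb i
  refine IsPiSystem.tendsto_probabilityMeasure_of_tendsto_of_mem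
    (S := {s | ∃ a b : J → ℝ, s = Set.univ.pi fun j => Set.Ioc (a j) (b j)}) ?_ ?_ ?_ ?_
  · rintro _ ⟨a, b, rfl⟩ _ ⟨a', b', rfl⟩ -
    refine ⟨a ⊔ a', b ⊓ b', ?_⟩
    rw [← Set.pi_inter_distrib]
    simp [Set.Ioc_inter_Ioc]
  · rintro _ ⟨a, b, rfl⟩
    exact MeasurableSet.univ_pi fun _ => measurableSet_Ioc
  · intro u hu x hx
    obtain ⟨ε, hε, hb⟩ := Metric.isOpen_iff.1 hu x hx
    refine ⟨_, ⟨fun j => x j - ε / 2, fun j => x j + ε / 2, rfl⟩, ?_, ?_⟩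
    · exact set_pi_mem_nhds Set.finite_univ fun j _ => Ioc_mem_nhds (by linarith) (by linarith)
    · refine subset_trans (fun z hz => ?_) hb
      rw [Metric.mem_ball]
      refine lt_of_le_of_lt ((dist_pi_le_iff (by linarith)).2 fun j => ?_) (half_lt_self hε)
      have := hz j trivial
      rw [Real.dist_eq, abs_le]
      exact ⟨by linarith [this.1], by linarith [this.2]⟩
  · rintro _ ⟨a, b, rfl⟩
    have hpi : IsPiSystem (Set.range (Set.Iic : (J → ℝ) → Set (J → ℝ))) := by
      rintro _ ⟨u, rfl⟩ _ ⟨v, rfl⟩ -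
      exact ⟨u ⊓ v, Set.Iic_inter_Iic.symm⟩
    have hmt : ∀ s ∈ Finset.univ.image (fun j => Set.Iic (Function.update b j (min (a j) (b j)))),
        s ∈ Set.range (Set.Iic : (J → ℝ) → Set (J → ℝ)) := by
      intro s hs
      obtain ⟨j, -, rfl⟩ := Finset.mem_image.1 hs
      exact ⟨_, rfl⟩
    have hU := hpi.tendsto_measureReal_biUnion (μ := fun n => (μ n : Measure (J → ℝ)))
      (ν := (ν : Measure (J → ℝ))) (l := atTop) hmt
      (by rintro _ ⟨u, rfl⟩; exact hmI u) (by rintro _ ⟨u, rfl⟩; exact h u)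
    have hsub : (⋃ s ∈ Finset.univ.image
        (fun j => Set.Iic (Function.update b j (min (a j) (b j)))), s) ⊆ Set.Iic b := by
      refine Set.iUnion₂_subset fun s hs => ?_
      obtain ⟨j, -, rfl⟩ := Finset.mem_image.1 hs
      refine Set.Iic_subset_Iic.2 fun i => ?_
      by_cases hi : i = j
      · subst hi; simp
      · simp [hi]
    have hmU : MeasurableSet (⋃ s ∈ Finset.univ.image
        (fun j => Set.Iic (Function.update b j (min (a j) (b j)))), s) :=
      Finset.measurableSet_biUnion _ fun s hs => by
        obtain ⟨j, -, rfl⟩ := Finset.mem_image.1 hs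
        exact hmI _
    have key := (h b).sub hU
    have hr : ∀ m : ProbabilityMeasure (J → ℝ),
        ((m (Set.univ.pi fun j => Set.Ioc (a j) (b j)) : ℝ≥0) : ℝ)
        = (m : Measure (J → ℝ)).real (Set.Iic b) - (m : Measure (J → ℝ)).real (⋃ s ∈ Finset.univ.image
          (fun j => Set.Iic (Function.update b j (min (a j) (b j)))), s) := by
      intro m
      rw [hbox, ← measureReal_sdiff hsub hmU]
      rfl
    rw [← NNReal.tendsto_coe]
    simp_rw [hr]
    exact key

end WeakConvergence

section Transfer

lemma abs_min_sub_min_le_max' (a b c d : ℝ) {r : ℝ} (h : |a - c| ≤ r) (h' : |b - d| ≤ r) :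
    |min a b - min c d| ≤ r :=
  (abs_min_sub_min_le_max a b c d).trans (max_le h h')

lemma abs_iSup_div_sub_le {J : Type*} [Fintype J] {z : J → ℝ} (hz : ∀ j, 0 < z j) (y y' : J → ℝ) :
    |(⨆ j, y j / z j) - ⨆ j, y' j / z j| ≤ (∑ j, (z j)⁻¹) * ‖y - y'‖ := by
  have key : ∀ y y' : J → ℝ, (⨆ j, y j / z j) ≤ (⨆ j, y' j / z j) + (∑ j, (z j)⁻¹) * ‖y - y'‖ := by
    intro y y'
    rcases isEmpty_or_nonempty J with hJ | hJ
    · simp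
    refine ciSup_le fun j => ?_
    have h1 := le_ciSup (f := fun j => y' j / z j) (Set.finite_range _).bddAbove j
    have h2 : y j - y' j ≤ ‖y - y'‖ := (le_abs_self _).trans (norm_le_pi_norm (y - y') j)
    have h3 : (z j)⁻¹ ≤ ∑ j, (z j)⁻¹ :=
      Finset.single_le_sum (f := fun j => (z j)⁻¹) (fun i _ => (inv_pos.2 (hz i)).le)
        (Finset.mem_univ j)
    have h4 : (z j)⁻¹ * (y j - y' j) ≤ (∑ j, (z j)⁻¹) * ‖y - y'‖ :=
      (mul_le_mul_of_nonneg_left h2 (inv_pos.2 (hz j)).le).trans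
        (mul_le_mul_of_nonneg_right h3 (norm_nonneg _))
    have h5 : y j / z j = y' j / z j + (z j)⁻¹ * (y j - y' j) := by field_simp; ring
    rw [h5]; exact add_le_add h1 h4
  rw [abs_sub_le_iff]
  have h := key y' y
  rw [norm_sub_rev] at h
  exact ⟨by linarith [key y y'], by linarith⟩

variable {Ω : Type*} [MeasurableSpace Ω] {P : Measure Ω} [IsProbabilityMeasure P]
  {J : Type*} [Fintype J]

lemma tendsto_integral_of_lipschitz {Y : Ω → J → ℝ} (hY : Integrable Y P)
    {G : ℕ → SimpleFunc Ω (J → ℝ)}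
    (hG : Tendsto (fun n => ∫⁻ ω, ‖G n ω - Y ω‖ₑ ∂P) atTop (𝓝 0))
    {φ : (J → ℝ) → ℝ} {C : ℝ} (hφ : ∀ y y', |φ y - φ y'| ≤ C * ‖y - y'‖) :
    Tendsto (fun n => ∫ ω, φ (G n ω) ∂P) atTop (𝓝 (∫ ω, φ (Y ω) ∂P)) ∧
      Integrable (fun ω => φ (Y ω)) P := by
  have hLip : LipschitzWith (Real.toNNReal C) φ := LipschitzWith.of_dist_le_mul fun y y' => by
    rw [Real.dist_eq, dist_eq_norm]
    exact (hφ y y').trans (mul_le_mul_of_nonneg_right (Real.le_coe_toNNReal C) (norm_nonneg _))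
  have hint : Integrable (fun ω => φ (Y ω)) P := by
    refine Integrable.mono' ((hY.norm.const_mul C).add (integrable_const |φ 0|))
      (hLip.continuous.comp_aestronglyMeasurable hY.1) (ae_of_all _ fun ω => ?_)
    have := hφ (Y ω) 0
    rw [sub_zero] at this
    simp only [Pi.add_apply, Real.norm_eq_abs]
    have h2 := abs_sub_abs_le_abs_sub (φ (Y ω)) (φ 0)
    linarith
  refine ⟨tendsto_integral_of_L1 _ hint.1 (Eventually.of_forall fun n => ?_) ?_, hint⟩
  · exact ((G n).map φ).integrable_of_isFiniteMeasure
  · refine tendsto_of_tendsto_of_tendsto_of_le_of_le tendsto_const_nhds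
      (h := fun n => ENNReal.ofReal C * ∫⁻ ω, ‖G n ω - Y ω‖ₑ ∂P) ?_ (fun _ => zero_le) (fun n => ?_)
    · simpa using ENNReal.Tendsto.const_mul hG (Or.inr ENNReal.ofReal_ne_top)
    · simp only
      rw [← lintegral_const_mul' _ _ ENNReal.ofReal_ne_top]
      refine lintegral_mono fun ω => ?_
      rw [← ofReal_norm, ← ofReal_norm, ← ENNReal.ofReal_mul' (norm_nonneg _)]
      exact ENNReal.ofReal_le_ofReal (hφ _ _)

lemma simpleFunc_sum_eq_integral {X β : Type*} [MeasurableSpace X] {μ : Measure X}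
    [IsFiniteMeasure μ] (G : SimpleFunc X β) (φ : β → ℝ) :
    ∑ k : G.range, μ.real (G ⁻¹' {(k : β)}) * φ k = ∫ x, φ (G x) ∂μ := by
  classical
  have h : ∀ x, φ (G x) = ∑ k : G.range, (G ⁻¹' {(k : β)}).indicator (fun _ => φ k) x := by
    intro x
    rw [Finset.sum_eq_single (⟨G x, G.mem_range_self x⟩ : G.range)]
    · simp
    · intro k _ hk
      refine Set.indicator_of_notMem (fun hx => hk (Subtype.ext ?_)) _
      exact (hx : G x = k).symm
    · simp
  simp only [h]
  rw [integral_finsetSum _ fun k _ => (integrable_const _).indicator (G.measurableSet_fiber _)]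
  refine Finset.sum_congr rfl fun k _ => ?_
  rw [integral_indicator (G.measurableSet_fiber _), setIntegral_const, smul_eq_mul]

lemma norm_cov_le_of_fdd {Y : Ω → J → ℝ} (hYm : Measurable Y) (hYi : Integrable Y P)
    (hY0 : ∀ ω j, 0 ≤ Y ω j) (hY1 : ∀ j, ∫ ω, Y ω j ∂P = 1)
    {Z : Ω → J → ℝ} (hZm : Measurable Z)
    (hfdd : ∀ z : J → ℝ, (∀ j, 0 < z j) →
      P {ω | ∀ j, Z ω j ≤ z j} = ENNReal.ofReal (Real.exp (-(∫ ω, ⨆ j, Y ω j / z j ∂P))))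
    {f g : (J → ℝ) → ℂ} (hf : Continuous f) (hg : Continuous g)
    {C : ℝ} (hfC : ∀ z, ‖f z‖ ≤ C) (hgC : ∀ z, ‖g z‖ ≤ C)
    {c c' : J → ℝ} (hc : ∀ j, 0 ≤ c j) (hc' : ∀ j, 0 ≤ c' j)
    (hfc : ∀ z z', ‖f z - f z'‖ ≤ ∑ j, c j * {w : ℝ × ℝ | w.1 ≠ w.2}.indicator
      (fun _ => (1 : ℝ)) (z j, z' j))
    (hgc : ∀ z z', ‖g z - g z'‖ ≤ ∑ j, c' j * {w : ℝ × ℝ | w.1 ≠ w.2}.indicator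
      (fun _ => (1 : ℝ)) (z j, z' j)) :
    ‖∫ ω, f (Z ω) * g (Z ω) ∂P - (∫ ω, f (Z ω) ∂P) * ∫ ω, g (Z ω) ∂P‖
      ≤ ∑ i, ∑ j, c i * c' j * ∫ ω, min (Y ω i) (Y ω j) ∂P := by
  classical
  have h0 : (0 : J → ℝ) ∈ Set.Ici (0 : J → ℝ) := Set.mem_Ici.2 le_rfl
  set G : ℕ → SimpleFunc Ω (J → ℝ) := fun n => SimpleFunc.approxOn Y hYm (Set.Ici 0) 0 h0 n with hGdef
  have hG : Tendsto (fun n => ∫⁻ ω, ‖G n ω - Y ω‖ₑ ∂P) atTop (𝓝 0) :=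
    SimpleFunc.tendsto_approxOn_L1_enorm hYm h0
      (ae_of_all _ fun ω => subset_closure (Set.mem_Ici.2 fun j => hY0 ω j)) (by simpa using hYi.2)
  have hGnn : ∀ n ω j, 0 ≤ G n ω j := fun n ω j =>
    Set.mem_Ici.1 (SimpleFunc.approxOn_mem hYm h0 n ω) j
  have hk : ∀ n (k : (G n).range) j, 0 ≤ (k : J → ℝ) j := by
    intro n k j
    obtain ⟨ω, hω⟩ := SimpleFunc.mem_range.1 k.2
    rw [← hω]; exact hGnn n ω j
  let p : ∀ n, (G n).range → ℝ := fun n k => P.real (G n ⁻¹' {(k : J → ℝ)})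
  have hp : ∀ n k, 0 ≤ p n k := fun n k => measureReal_nonneg
  let a : ∀ n, J → (G n).range → ℝ := fun n j k => p n k * (k : J → ℝ) j
  have ha : ∀ n j k, 0 ≤ a n j k := fun n j k => mul_nonneg (hp n k) (hk n k j)
  have hcoord : ∀ j, Tendsto (fun n => ∑ k, a n j k) atTop (𝓝 1) := by
    intro j
    have := (tendsto_integral_of_lipschitz hYi hG (φ := fun y => y j) (C := 1) fun y y' => by
      rw [one_mul]; exact norm_le_pi_norm (y - y') j).1
    rw [hY1] at this
    exact this.congr fun n => (simpleFunc_sum_eq_integral (G n) fun y => y j).symm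
  have hmin : ∀ i j, Tendsto (fun n => ∑ k, min (a n i k) (a n j k)) atTop
      (𝓝 (∫ ω, min (Y ω i) (Y ω j) ∂P)) := by
    intro i j
    have := (tendsto_integral_of_lipschitz hYi hG (φ := fun y => min (y i) (y j)) (C := 1)
      fun y y' => by
        rw [one_mul]
        exact abs_min_sub_min_le_max' _ _ _ _ (norm_le_pi_norm (y - y') i)
          (norm_le_pi_norm (y - y') j)).1
    refine this.congr fun n => ?_
    rw [← simpleFunc_sum_eq_integral (G n) fun y => min (y i) (y j)]
    exact Finset.sum_congr rfl fun k _ => mul_min_of_nonneg _ _ (hp n k)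
  have hpos : ∀ j, ∀ᶠ n in atTop, 0 < ∑ k, a n j k := fun j =>
    (hcoord j).eventually (lt_mem_nhds one_pos)
  have hposall : ∀ᶠ n in atTop, ∀ j, 0 < ∑ k, a n j k := eventually_all.2 hpos
  have : ∀ n, IsProbabilityMeasure (expPi (G n).range) := fun n => by
    have := isProbabilityMeasure_expMeasure one_pos
    infer_instance
  let μ : ℕ → ProbabilityMeasure (J → ℝ) := fun n =>
    ⟨(expPi (G n).range).map (maxLin (a n)),
      Measure.isProbabilityMeasure_map (measurable_maxLin (a n)).aemeasurable⟩
  let ν : ProbabilityMeasure (J → ℝ) := ⟨P.map Z, Measure.isProbabilityMeasure_map hZm.aemeasurable⟩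
  have hmI : ∀ u : J → ℝ, MeasurableSet (Set.Iic u) := fun u => by
    rw [← Set.pi_univ_Iic]
    exact MeasurableSet.univ_pi fun _ => measurableSet_Iic
  have hμI : ∀ n u, (μ n : Measure (J → ℝ)).real (Set.Iic u)
      = (expPi (G n).range).real {e | ∀ j, maxLin (a n) e j ≤ u j} := fun n u =>
    map_measureReal_apply (measurable_maxLin (a n)) (hmI u)
  have hνI : ∀ u, (ν : Measure (J → ℝ)).real (Set.Iic u) = P.real {ω | ∀ j, Z ω j ≤ u j} :=
    fun u => map_measureReal_apply hZm (hmI u)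
  have hfddr : ∀ z : J → ℝ, (∀ j, 0 < z j) →
      P.real {ω | ∀ j, Z ω j ≤ z j} = Real.exp (-(∫ ω, ⨆ j, Y ω j / z j ∂P)) := fun z hz => by
    rw [measureReal_def, hfdd z hz, ENNReal.toReal_ofReal (Real.exp_pos _).le]
  have hconv : Tendsto μ atTop (𝓝 ν) := by
    refine tendsto_probabilityMeasure_of_Iic fun u => ?_
    simp only [hμI, hνI]
    by_cases hu : ∀ j, 0 < u j
    · rw [hfddr u hu]
      have h1 : ∀ n, (expPi (G n).range).real {e | ∀ j, maxLin (a n) e j ≤ u j}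
          = Real.exp (-(∫ ω, ⨆ j, G n ω j / u j ∂P)) := by
        intro n
        rw [measureReal_def, expPi_maxLin_le (ha n) hu, ENNReal.toReal_ofReal (Real.exp_pos _).le,
          ← simpleFunc_sum_eq_integral (G n) fun y => ⨆ j, y j / u j]
        congr 2
        refine Finset.sum_congr rfl fun k _ => ?_
        rw [Real.mul_iSup_of_nonneg (hp n k)]
        simp only [a, p, mul_div_assoc]
      simp only [h1]
      exact (Real.continuous_exp.tendsto _).comp
        (tendsto_integral_of_lipschitz hYi hG (abs_iSup_div_sub_le hu)).1.neg
    · push Not at hu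
      obtain ⟨j, hj⟩ := hu
      have hν0 : P.real {ω | ∀ j, Z ω j ≤ u j} = 0 := by
        refine le_antisymm ?_ measureReal_nonneg
        have hle : ∀ ε > (0 : ℝ), P.real {ω | ∀ j, Z ω j ≤ u j} ≤ Real.exp (-ε⁻¹) := by
          intro ε hε
          have hv : ∀ i, 0 < max (u i) ε := fun i => lt_max_of_lt_right hε
          calc _ ≤ P.real {ω | ∀ j, Z ω j ≤ max (u j) ε} :=
                measureReal_mono fun ω hω i => (hω i).trans (le_max_left _ _)
            _ = _ := hfddr _ hv
            _ ≤ Real.exp (-(∫ ω, Y ω j / ε ∂P)) := by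
                refine Real.exp_le_exp.2 (neg_le_neg ?_)
                refine integral_mono (((integrable_pi_iff.1 hYi) j).div_const _)
                  (tendsto_integral_of_lipschitz hYi hG (abs_iSup_div_sub_le hv)).2 fun ω => ?_
                have := le_ciSup (f := fun i => Y ω i / max (u i) ε) (Set.finite_range _).bddAbove j
                simpa [max_eq_right (hj.trans hε.le)] using this
            _ = _ := by rw [integral_div, hY1, one_div]
        refine ge_of_tendsto (f := fun ε : ℝ => Real.exp (-ε⁻¹)) (x := 𝓝[>] 0) ?_
          (eventually_mem_nhdsWithin.mono hle)
        exact Real.tendsto_exp_neg_atTop_nhds_zero.comp tendsto_inv_nhdsGT_zero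
      rw [hν0]
      refine tendsto_const_nhds.congr' ?_
      filter_upwards [hpos j] with n hn
      refine (measureReal_mono_null (fun e he => ?_) (s₂ := {e | maxLin (a n) e j ≤ 0}) ?_).symm
      · exact (he j).trans hj
      · rw [measureReal_def, expPi_maxLin_nonpos hn, ENNReal.toReal_zero]
  have hlim : ∀ h : (J → ℝ) → ℂ, Continuous h → ∀ B : ℝ, (∀ z, ‖h z‖ ≤ B) →
      Tendsto (fun n => ∫ e, h (maxLin (a n) e) ∂(expPi (G n).range)) atTop
        (𝓝 (∫ ω, h (Z ω) ∂P)) := by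
    intro h hh B hB
    have := (ProbabilityMeasure.tendsto_iff_forall_integral_rclike_tendsto ℂ).1 hconv
      (BoundedContinuousFunction.ofNormedAddCommGroup h hh B hB)
    simp only [BoundedContinuousFunction.coe_ofNormedAddCommGroup] at this
    have h1 : ∀ n, ∫ z, h z ∂(μ n : Measure (J → ℝ)) = ∫ e, h (maxLin (a n) e) ∂(expPi (G n).range) :=
      fun n => integral_map (measurable_maxLin (a n)).aemeasurable hh.aestronglyMeasurable
    have h2 : ∫ z, h z ∂(ν : Measure (J → ℝ)) = ∫ ω, h (Z ω) ∂P :=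
      integral_map hZm.aemeasurable hh.aestronglyMeasurable
    simpa only [h1, h2] using this
  have hC : 0 ≤ C := (norm_nonneg _).trans (hfC 0)
  have hL := ((hlim (fun z => f z * g z) (hf.mul hg) (C * C) fun z => by
    rw [norm_mul]; exact mul_le_mul (hfC z) (hgC z) (norm_nonneg _) hC).sub
      ((hlim f hf C hfC).mul (hlim g hg C hgC))).norm
  have hR : Tendsto (fun n => ∑ i, ∑ j, c i * c' j * (max (∑ k, a n i k)⁻¹ (∑ k, a n j k)⁻¹ *
      ∑ k, min (a n i k) (a n j k))) atTop
      (𝓝 (∑ i, ∑ j, c i * c' j * ∫ ω, min (Y ω i) (Y ω j) ∂P)) := by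
    refine tendsto_finsetSum _ fun i _ => tendsto_finsetSum _ fun j _ => ?_
    have := ((((hcoord i).inv₀ one_ne_zero).max ((hcoord j).inv₀ one_ne_zero)).mul
      (hmin i j)).const_mul (c i * c' j)
    simpa using this
  refine le_of_tendsto_of_tendsto hL hR ?_
  filter_upwards [hposall] with n hn
  refine (norm_cov_maxLin_le (ha n) hn hf.measurable hg.measurable hfC hgC hc hc' hfc hgc).trans ?_
  refine Finset.sum_le_sum fun i _ => Finset.sum_le_sum fun j _ =>
    mul_le_mul_of_nonneg_left ?_ (mul_nonneg (hc i) (hc' j))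
  rw [Finset.mul_sum]
  refine Finset.sum_le_sum fun k _ => ?_
  rw [mul_min_of_nonneg _ _ (le_max_of_le_left (inv_pos.2 (hn i)).le)]
  refine min_le_min ?_ ?_
  · rw [div_eq_inv_mul]; exact mul_le_mul_of_nonneg_right (le_max_left _ _) (ha n i k)
  · rw [div_eq_inv_mul]; exact mul_le_mul_of_nonneg_right (le_max_right _ _) (ha n j k)

end Transfer

section Gaussian

variable {Ω : Type*} [MeasurableSpace Ω] {P : Measure Ω}

lemma map_gaussianReal_facts {X : Ω → ℝ} (hX : Measurable X) {v : ℝ≥0}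
    (h : P.map X = gaussianReal 0 v) :
    MemLp X 2 P ∧ ∫ ω, X ω ^ 2 ∂P = v ∧ Integrable (fun ω => Real.exp (X ω)) P ∧
      ∫ ω, Real.exp (X ω) ∂P = Real.exp (v / 2) := by
  have h1 : MemLp X 2 P := by
    have : MemLp id 2 (P.map X) := by rw [h]; exact memLp_id_gaussianReal 2
    exact (memLp_map_measure_iff (by fun_prop) hX.aemeasurable).1 this
  have h2 : ∫ ω, X ω ^ 2 ∂P = v := by
    have h3 : ∫ z, z ^ 2 ∂(P.map X) = ∫ ω, X ω ^ 2 ∂P :=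
      integral_map hX.aemeasurable (by fun_prop)
    have h4 : Var[id; gaussianReal 0 v] = ∫ z, z ^ 2 ∂(gaussianReal 0 v) := by
      rw [variance_of_integral_eq_zero aemeasurable_id (by simp)]; rfl
    rw [← h3, h, ← h4, variance_id_gaussianReal]
  have h5 : mgf X P 1 = Real.exp (v / 2) := by
    rw [mgf_gaussianReal h]; simp
  simp only [mgf, one_mul] at h5
  refine ⟨h1, h2, ?_, h5⟩
  by_contra hn
  rw [integral_undef hn] at h5
  exact absurd h5.symm (Real.exp_pos _).ne'

variable {E : Type*} [NormedAddCommGroup E] {η α : ℝ}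
    {W : E → Ω → ℝ} (hWmeas : ∀ x, Measurable (W x))
    (hgauss : ∀ (n : ℕ) (x : Fin n → E) (c : Fin n → ℝ),
      ∃ v : ℝ≥0, Measure.map (fun ω => ∑ i, c i * W (x i) ω) P = gaussianReal 0 v)
    (hinc : ∀ (x₀ : E) (n : ℕ) (x : Fin n → E),
      Measure.map (fun ω i => W (x i + x₀) ω - W x₀ ω) P
        = Measure.map (fun ω i => W (x i) ω - W 0 ω) P)
    (hW0 : ∀ᵐ ω ∂P, W 0 ω = 0)
    (hvar : ∀ x : E, ∫ ω, (W x ω) ^ 2 ∂P = η * ‖x‖ ^ α)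

omit [NormedAddCommGroup E] in
include hWmeas hgauss in
lemma gaussian_pair (x y : E) (a b : ℝ) :
    MemLp (fun ω => a * W x ω + b * W y ω) 2 P ∧
      Integrable (fun ω => Real.exp (a * W x ω + b * W y ω)) P ∧
      ∫ ω, Real.exp (a * W x ω + b * W y ω) ∂P
        = Real.exp ((∫ ω, (a * W x ω + b * W y ω) ^ 2 ∂P) / 2) := by
  obtain ⟨v, hv⟩ := hgauss 2 ![x, y] ![a, b]
  simp only [Fin.sum_univ_two, Matrix.cons_val_zero, Matrix.cons_val_one] at hv
  have hm : Measurable fun ω => a * W x ω + b * W y ω :=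
    ((hWmeas x).const_mul a).add ((hWmeas y).const_mul b)
  obtain ⟨h1, h2, h3, h4⟩ := map_gaussianReal_facts hm hv
  exact ⟨h1, h3, by rw [h4, h2]⟩

omit [NormedAddCommGroup E] in
include hWmeas hgauss in
lemma memLp_gaussian (x : E) : MemLp (W x) 2 P := by
  simpa using (gaussian_pair hWmeas hgauss x x 1 0).1

include hWmeas hinc hW0 hvar in
lemma integral_increment_sq (x y : E) : ∫ ω, (W x ω - W y ω) ^ 2 ∂P = η * ‖x - y‖ ^ α := by
  have h := hinc y 1 fun _ => x - y
  simp only [sub_add_cancel] at h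
  have hm : ∀ u v : E, ∫ z : Fin 1 → ℝ, z 0 ^ 2 ∂(P.map fun ω (_ : Fin 1) => W u ω - W v ω)
      = ∫ ω, (W u ω - W v ω) ^ 2 ∂P := fun u v =>
    integral_map (f := fun z : Fin 1 → ℝ => z 0 ^ 2)
      (measurable_pi_iff.2 fun _ => (hWmeas u).sub (hWmeas v)).aemeasurable
      ((measurable_pi_apply 0).pow_const 2).aestronglyMeasurable
  rw [← hm x y, h, hm, ← hvar]
  refine integral_congr_ae ?_
  filter_upwards [hW0] with ω hω
  rw [hω, sub_zero]

include hWmeas hgauss hinc hW0 hvar in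
lemma integral_exp_half_sum (x y : E) :
    ∫ ω, Real.exp (2⁻¹ * W x ω + 2⁻¹ * W y ω) ∂P
      = Real.exp (η * ‖x‖ ^ α / 4 + η * ‖y‖ ^ α / 4 - η * ‖x - y‖ ^ α / 8) := by
  rw [(gaussian_pair hWmeas hgauss x y 2⁻¹ 2⁻¹).2.2]
  have h1 := (memLp_gaussian hWmeas hgauss x).integrable_sq
  have h2 := (memLp_gaussian hWmeas hgauss y).integrable_sq
  have h3 : Integrable (fun ω => (W x ω - W y ω) ^ 2) P :=
    ((memLp_gaussian hWmeas hgauss x).sub (memLp_gaussian hWmeas hgauss y)).integrable_sq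
  have h5 : Integrable (fun ω => 2⁻¹ * W x ω ^ 2 + 2⁻¹ * W y ω ^ 2) P :=
    (h1.const_mul _).add (h2.const_mul _)
  have h4 : ∀ ω, (2⁻¹ * W x ω + 2⁻¹ * W y ω) ^ 2
      = 2⁻¹ * W x ω ^ 2 + 2⁻¹ * W y ω ^ 2 - 4⁻¹ * (W x ω - W y ω) ^ 2 := fun ω => by ring
  simp only [h4]
  rw [integral_sub h5 (h3.const_mul _),
    integral_add (h1.const_mul _) (h2.const_mul _), integral_const_mul, integral_const_mul,
    integral_const_mul, hvar, hvar, integral_increment_sq hWmeas hinc hW0 hvar]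
  congr 1; ring

variable {Y : E → Ω → ℝ} (hY : ∀ x ω, Y x ω = Real.exp (W x ω - η * ‖x‖ ^ α / 2))

include hWmeas hgauss hvar hY in
lemma spectral_integrable (x : E) : Integrable (Y x) P ∧ ∫ ω, Y x ω ∂P = 1 := by
  obtain ⟨-, h1, h2⟩ := gaussian_pair hWmeas hgauss x x 1 0
  simp only [one_mul, zero_mul, add_zero, hvar] at h1 h2
  have h3 : Y x = fun ω => Real.exp (W x ω) * Real.exp (-(η * ‖x‖ ^ α / 2)) := by
    funext ω; rw [hY, ← Real.exp_add, sub_eq_add_neg]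
  rw [h3]
  refine ⟨h1.mul_const _, ?_⟩
  rw [integral_mul_const, h2, ← Real.exp_add, add_neg_cancel, Real.exp_zero]

include hWmeas hgauss hinc hW0 hvar hY in
lemma integral_min_spectral_le (x y : E) :
    ∫ ω, min (Y x ω) (Y y ω) ∂P ≤ Real.exp (-(η * ‖x - y‖ ^ α / 8)) := by
  have hle : ∀ ω, min (Y x ω) (Y y ω) ≤ Real.exp (2⁻¹ * W x ω + 2⁻¹ * W y ω) *
      Real.exp (-(η * ‖x‖ ^ α / 4 + η * ‖y‖ ^ α / 4)) := by
    intro ω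
    rw [hY, hY, ← Real.exp_add]
    rcases le_total (W x ω - η * ‖x‖ ^ α / 2) (W y ω - η * ‖y‖ ^ α / 2) with h | h
    · exact (min_le_left _ _).trans (Real.exp_le_exp.2 (by linarith))
    · exact (min_le_right _ _).trans (Real.exp_le_exp.2 (by linarith))
  have hint := (gaussian_pair hWmeas hgauss x y 2⁻¹ 2⁻¹).2.1
  refine (integral_mono ((spectral_integrable hWmeas hgauss hvar hY x).1.inf
    (spectral_integrable hWmeas hgauss hvar hY y).1) (hint.mul_const _) hle).trans (le_of_eq ?_)
  rw [integral_mul_const, integral_exp_half_sum hWmeas hgauss hinc hW0 hvar, ← Real.exp_add]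
  congr 1; ring

include hWmeas hgauss hinc hW0 hvar hY in
lemma norm_cov_field_le [IsProbabilityMeasure P] {Z : E → Ω → ℝ} (hZ : ∀ x, Measurable (Z x))
    (hfdd : ∀ (n : ℕ) (x : Fin n → E) (z : Fin n → ℝ), (∀ i, 0 < z i) →
      P {ω | ∀ i, Z (x i) ω ≤ z i}
        = ENNReal.ofReal (Real.exp (-(∫ ω, ⨆ i, Y (x i) ω / z i ∂P))))
    {J : Type*} [Fintype J] (x : J → E) {f g : (J → ℝ) → ℂ} (hf : Continuous f) (hg : Continuous g)
    {C : ℝ} (hfC : ∀ z, ‖f z‖ ≤ C) (hgC : ∀ z, ‖g z‖ ≤ C)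
    {c c' : J → ℝ} (hc : ∀ j, 0 ≤ c j) (hc' : ∀ j, 0 ≤ c' j)
    (hfc : ∀ z z', ‖f z - f z'‖ ≤ ∑ j, c j * {w : ℝ × ℝ | w.1 ≠ w.2}.indicator
      (fun _ => (1 : ℝ)) (z j, z' j))
    (hgc : ∀ z z', ‖g z - g z'‖ ≤ ∑ j, c' j * {w : ℝ × ℝ | w.1 ≠ w.2}.indicator
      (fun _ => (1 : ℝ)) (z j, z' j)) :
    ‖∫ ω, f (fun j => Z (x j) ω) * g (fun j => Z (x j) ω) ∂P
        - (∫ ω, f (fun j => Z (x j) ω) ∂P) * ∫ ω, g (fun j => Z (x j) ω) ∂P‖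
      ≤ ∑ i, ∑ j, c i * c' j * Real.exp (-(η * ‖x i - x j‖ ^ α / 8)) := by
  have hYm : ∀ x, Measurable (Y x) := fun x => by
    rw [show Y x = fun ω => Real.exp (W x ω - η * ‖x‖ ^ α / 2) from funext (hY x)]
    exact Real.measurable_exp.comp ((hWmeas x).sub_const _)
  refine (norm_cov_le_of_fdd (Y := fun ω j => Y (x j) ω) (Z := fun ω j => Z (x j) ω)
    (measurable_pi_iff.2 fun j => hYm (x j))
    (integrable_pi_iff.2 fun j => (spectral_integrable hWmeas hgauss hvar hY (x j)).1)
    (fun ω j => by rw [hY]; exact (Real.exp_pos _).le)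
    (fun j => (spectral_integrable hWmeas hgauss hvar hY (x j)).2)
    (measurable_pi_iff.2 fun j => hZ (x j)) (fun z hz => ?_) hf hg hfC hgC hc hc' hfc hgc).trans ?_
  · let e := Fintype.equivFin J
    have h := hfdd _ (x ∘ e.symm) (z ∘ e.symm) fun i => hz _
    simp only [Function.comp_apply] at h
    have h1 : {ω | ∀ j, Z (x j) ω ≤ z j} = {ω | ∀ i, Z (x (e.symm i)) ω ≤ z (e.symm i)} := by
      ext ω
      exact ⟨fun h i => h _, fun h j => by simpa using h (e j)⟩
    rw [h1, h]
    congr 4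
    funext ω
    exact e.symm.iSup_comp (g := fun j => Y (x j) ω / z j)
  · exact Finset.sum_le_sum fun i _ => Finset.sum_le_sum fun j _ =>
      mul_le_mul_of_nonneg_left (integral_min_spectral_le hWmeas hgauss hinc hW0 hvar hY _ _)
        (mul_nonneg (hc i) (hc' j))

end Gaussian

/-- The Euclidean space on which the random fields live. -/
abbrev Space (d : ℕ) := EuclideanSpace ℝ (Fin d)

section Mixing

variable {Ω : Type*} [MeasurableSpace Ω] {d : ℕ}

/-- A measurable, sample-continuous field with shift-invariant two-point distributions, whose
correlations between functionals of finitely many values are controlled by the kernel `κ`. -/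
structure IsMixingField (P : Measure Ω) (Z : Space d → Ω → ℝ) (κ : Space d → ℝ) : Prop where
  measurable : Measurable fun p : Space d × Ω => Z p.1 p.2
  continuous : ∀ᵐ ω ∂P, Continuous fun x => Z x ω
  map_pair : ∀ x y, P.map (fun ω => (Z x ω, Z y ω)) = P.map (fun ω => (Z 0 ω, Z (y - x) ω))
  kernel_pos : ∀ x, 0 < κ x
  kernel_le_one : ∀ x, κ x ≤ 1
  kernel_neg : ∀ x, κ (-x) = κ x
  kernel_continuous : Continuous κ
  kernel_integrable : ∀ θ : ℝ, 0 < θ → Integrable fun x => κ x ^ θ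
  norm_cov_le : ∀ {J : Type} [Fintype J] (x : J → Space d) {f g : (J → ℝ) → ℂ},
    Continuous f → Continuous g → ∀ {C : ℝ}, (∀ z, ‖f z‖ ≤ C) → (∀ z, ‖g z‖ ≤ C) →
    ∀ {c c' : J → ℝ}, (∀ j, 0 ≤ c j) → (∀ j, 0 ≤ c' j) →
    (∀ z z', ‖f z - f z'‖ ≤ ∑ j, c j * {w : ℝ × ℝ | w.1 ≠ w.2}.indicator
      (fun _ => (1 : ℝ)) (z j, z' j)) →
    (∀ z z', ‖g z - g z'‖ ≤ ∑ j, c' j * {w : ℝ × ℝ | w.1 ≠ w.2}.indicator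
      (fun _ => (1 : ℝ)) (z j, z' j)) →
    ‖∫ ω, f (fun j => Z (x j) ω) * g (fun j => Z (x j) ω) ∂P
        - (∫ ω, f (fun j => Z (x j) ω) ∂P) * ∫ ω, g (fun j => Z (x j) ω) ∂P‖
      ≤ ∑ i, ∑ j, c i * c' j * κ (x i - x j)

variable {P : Measure Ω} {Z : Space d → Ω → ℝ} {κ : Space d → ℝ}

lemma IsMixingField.measurable_apply (hZ : IsMixingField P Z κ) (x : Space d) : Measurable (Z x) :=
  hZ.measurable.comp measurable_prodMk_left

lemma abs_sub_le_indicator {φ : ℝ → ℝ} {M : ℝ} (hM : ∀ z, |φ z| ≤ M) (z z' : ℝ) :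
    |φ z - φ z'| ≤ 2 * M * {w : ℝ × ℝ | w.1 ≠ w.2}.indicator (fun _ => (1 : ℝ)) (z, z') := by
  by_cases h : z = z'
  · simp [h]
  · rw [Set.indicator_of_mem (show (z, z') ∈ {w : ℝ × ℝ | w.1 ≠ w.2} from h)]
    have := abs_sub (φ z) (φ z')
    linarith [hM z, hM z']

lemma IsMixingField.abs_cov_le (hZ : IsMixingField P Z κ) {φ ψ : ℝ → ℝ} (hφ : Continuous φ)
    (hψ : Continuous ψ) {M N : ℝ} (hM : ∀ z, |φ z| ≤ M) (hN : ∀ z, |ψ z| ≤ N) (x y : Space d) :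
    |cov P (fun ω => φ (Z x ω)) (fun ω => ψ (Z y ω))| ≤ 4 * M * N * κ (x - y) := by
  have hM0 : 0 ≤ M := (abs_nonneg _).trans (hM 0)
  have hN0 : 0 ≤ N := (abs_nonneg _).trans (hN 0)
  have h := hZ.norm_cov_le ![x, y] (f := fun z => (φ (z 0) : ℂ)) (g := fun z => (ψ (z 1) : ℂ))
    (by fun_prop) (by fun_prop) (C := max M N)
    (fun z => by rw [Complex.norm_real]; exact (hM _).trans (le_max_left _ _))
    (fun z => by rw [Complex.norm_real]; exact (hN _).trans (le_max_right _ _))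
    (c := ![2 * M, 0]) (c' := ![0, 2 * N])
    (fun j => by fin_cases j <;> simp [hM0]) (fun j => by fin_cases j <;> simp [hN0])
    (fun z z' => by
      rw [← Complex.ofReal_sub, Complex.norm_real]
      simpa using abs_sub_le_indicator hM (z 0) (z' 0))
    (fun z z' => by
      rw [← Complex.ofReal_sub, Complex.norm_real]
      simpa using abs_sub_le_indicator hN (z 1) (z' 1))
  simp only [Matrix.cons_val_zero, Matrix.cons_val_one, Fin.sum_univ_two, ← Complex.ofReal_mul,
    integral_complex_ofReal, ← Complex.ofReal_sub, Complex.norm_real] at h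
  refine (h.trans (le_of_eq ?_))
  ring

lemma norm_exp_I_mul_sub_le (a b : ℝ) :
    ‖Complex.exp (Complex.I * a) - Complex.exp (Complex.I * b)‖ ≤ |a - b| := by
  have h : Complex.exp (Complex.I * a) - Complex.exp (Complex.I * b)
      = Complex.exp (Complex.I * b) * (Complex.exp (Complex.I * ((a - b : ℝ) : ℂ)) - 1) := by
    rw [mul_sub, ← Complex.exp_add, mul_one]
    congr 2; push_cast; ring
  rw [h, norm_mul, Complex.norm_exp_I_mul_ofReal, one_mul]
  exact Real.norm_exp_I_mul_ofReal_sub_one_le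

lemma IsMixingField.stronglyMeasurable_integral (hZ : IsMixingField P Z κ) {φ : ℝ → ℝ}
    (hφ : Measurable φ) (A : Set (Space d)) :
    StronglyMeasurable fun ω => ∫ x in A, φ (Z x ω) := by
  have : StronglyMeasurable (fun p : Ω × Space d => φ (Z p.2 p.1)) :=
    (hφ.comp (hZ.measurable.comp measurable_swap)).stronglyMeasurable
  exact this.integral_prod_right'

lemma IsMixingField.norm_cov_exp_le [IsProbabilityMeasure P] (hZ : IsMixingField P Z κ) {φ : ℝ → ℝ} (hφ : Continuous φ)
    {M : ℝ} (hM : ∀ z, |φ z| ≤ M) {A B : Set (Space d)}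
    (hA : volume A ≠ ∞) (hB : volume B ≠ ∞) (t : ℝ) :
    ‖∫ ω, Complex.exp (Complex.I * ((t * ∫ x in A, φ (Z x ω) : ℝ) : ℂ)) *
          Complex.exp (Complex.I * ((t * ∫ x in B, φ (Z x ω) : ℝ) : ℂ)) ∂P
        - (∫ ω, Complex.exp (Complex.I * ((t * ∫ x in A, φ (Z x ω) : ℝ) : ℂ)) ∂P) *
          ∫ ω, Complex.exp (Complex.I * ((t * ∫ x in B, φ (Z x ω) : ℝ) : ℂ)) ∂P‖
      ≤ 4 * t ^ 2 * M ^ 2 * ∫ x in A, ∫ y in B, κ (x - y) := by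
  have hM0 : 0 ≤ M := (abs_nonneg _).trans (hM 0)
  have : IsFiniteMeasure (volume.restrict A) := ⟨by simpa using hA.lt_top⟩
  have : IsFiniteMeasure (volume.restrict B) := ⟨by simpa using hB.lt_top⟩
  let s : ℕ → SimpleFunc (Space d) (Space d) := fun n =>
    SimpleFunc.approxOn id measurable_id Set.univ 0 (Set.mem_univ 0) n
  have hs : ∀ x, Tendsto (fun n => s n x) atTop (𝓝 x) := fun x =>
    SimpleFunc.tendsto_approxOn measurable_id (Set.mem_univ 0) (by simp)
  have hsm : ∀ n, Measurable (s n) := fun n => (s n).measurable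
  -- discretised integrals
  let I : Set (Space d) → ℕ → Ω → ℝ := fun D n ω => ∫ x in D, φ (Z (s n x) ω)
  have hIlim : ∀ D : Set (Space d), volume D ≠ ∞ → ∀ᵐ ω ∂P,
      Tendsto (fun n => I D n ω) atTop (𝓝 (∫ x in D, φ (Z x ω))) := by
    intro D hD
    have : IsFiniteMeasure (volume.restrict D) := ⟨by simpa using hD.lt_top⟩
    filter_upwards [hZ.continuous] with ω hω
    refine tendsto_integral_of_dominated_convergence (fun _ => M) (fun n => ?_)
      (integrable_const M) (fun n => ae_of_all _ fun x => hM _) (ae_of_all _ fun x => ?_)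
    · exact (hφ.measurable.comp (hω.measurable.comp (hsm n))).aestronglyMeasurable
    · exact (hφ.tendsto _).comp ((hω.tendsto _).comp (hs x))
  let J : ℕ → Type := fun n => (s n).range
  let u : Set (Space d) → ∀ n, (s n).range → ℝ := fun D n k =>
    (volume.restrict D).real (s n ⁻¹' {(k : Space d)})
  have hu : ∀ D n k, 0 ≤ u D n k := fun D n k => measureReal_nonneg
  have hI : ∀ D : Set (Space d), volume D ≠ ∞ → ∀ n ω,
      I D n ω = ∑ k : (s n).range, u D n k * φ (Z k ω) := by
    intro D hD n ω
    have : IsFiniteMeasure (volume.restrict D) := ⟨by simpa using hD.lt_top⟩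
    exact (simpleFunc_sum_eq_integral (s n) fun x => φ (Z x ω)).symm
  have hIm : ∀ D : Set (Space d), volume D ≠ ∞ → ∀ n, Measurable (I D n) := by
    intro D hD n
    rw [show I D n = _ from funext (hI D hD n)]
    exact Finset.measurable_fun_sum _ fun k _ =>
      (hφ.measurable.comp (hZ.measurable_apply _)).const_mul _
  let f : Set (Space d) → ∀ n, ((s n).range → ℝ) → ℂ := fun D n z =>
    Complex.exp (Complex.I * ((t * ∑ k, u D n k * φ (z k) : ℝ) : ℂ))
  have hfcont : ∀ D n, Continuous (f D n) := fun D n => by fun_prop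
  have hf1 : ∀ D n z, ‖f D n z‖ ≤ 1 := fun D n z => (Complex.norm_exp_I_mul_ofReal _).le
  have hfd : ∀ D n z z', ‖f D n z - f D n z'‖ ≤ ∑ k, (2 * M * |t| * u D n k) *
      {w : ℝ × ℝ | w.1 ≠ w.2}.indicator (fun _ => (1 : ℝ)) (z k, z' k) := by
    intro D n z z'
    refine (norm_exp_I_mul_sub_le _ _).trans ?_
    rw [← mul_sub, ← Finset.sum_sub_distrib, abs_mul]
    refine (mul_le_mul_of_nonneg_left (Finset.abs_sum_le_sum_abs _ _) (abs_nonneg t)).trans ?_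
    rw [Finset.mul_sum]
    refine Finset.sum_le_sum fun k _ => ?_
    rw [← mul_sub, abs_mul, abs_of_nonneg (hu D n k)]
    have h1 := mul_le_mul_of_nonneg_left (abs_sub_le_indicator hM (z k) (z' k))
      (mul_nonneg (abs_nonneg t) (hu D n k))
    calc _ = |t| * u D n k * |φ (z k) - φ (z' k)| := by ring
      _ ≤ _ := h1
      _ = _ := by ring
  have hbound : ∀ n,
      ‖∫ ω, Complex.exp (Complex.I * ((t * I A n ω : ℝ) : ℂ)) *
          Complex.exp (Complex.I * ((t * I B n ω : ℝ) : ℂ)) ∂P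
        - (∫ ω, Complex.exp (Complex.I * ((t * I A n ω : ℝ) : ℂ)) ∂P) *
          ∫ ω, Complex.exp (Complex.I * ((t * I B n ω : ℝ) : ℂ)) ∂P‖
      ≤ 4 * t ^ 2 * M ^ 2 * ∫ x in A, ∫ y in B, κ (s n x - s n y) := by
    intro n
    have h := hZ.norm_cov_le (fun k : (s n).range => (k : Space d)) (hfcont A n) (hfcont B n)
      (hf1 A n) (hf1 B n)
      (fun k => mul_nonneg (by positivity) (hu A n k))
      (fun k => mul_nonneg (by positivity) (hu B n k)) (hfd A n) (hfd B n)
    simp only [f] at h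
    simp only [hI A hA, hI B hB]
    refine h.trans (le_of_eq ?_)
    rw [← simpleFunc_sum_eq_integral (s n) fun x => ∫ y in B, κ (x - s n y), Finset.mul_sum]
    refine Finset.sum_congr rfl fun i _ => ?_
    rw [← simpleFunc_sum_eq_integral (s n) fun y => κ (i - y), Finset.mul_sum, Finset.mul_sum]
    refine Finset.sum_congr rfl fun j _ => ?_
    have : |t| * |t| = t ^ 2 := by rw [← abs_mul, ← sq, abs_of_nonneg (sq_nonneg t)]
    calc _ = 4 * M ^ 2 * (|t| * |t|) * u A n i * u B n j * κ (i - j) := by ring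
      _ = _ := by rw [this]; simp only [u]; ring
  have hexp : ∀ a : ℝ, ‖Complex.exp (Complex.I * (a : ℂ))‖ ≤ 1 :=
    fun a => (Complex.norm_exp_I_mul_ofReal _).le
  have hce : Continuous fun a : ℝ => Complex.exp (Complex.I * ((t * a : ℝ) : ℂ)) := by fun_prop
  have hone : ∀ D : Set (Space d), volume D ≠ ∞ → Tendsto
      (fun n => ∫ ω, Complex.exp (Complex.I * ((t * I D n ω : ℝ) : ℂ)) ∂P) atTop
      (𝓝 (∫ ω, Complex.exp (Complex.I * ((t * ∫ x in D, φ (Z x ω) : ℝ) : ℂ)) ∂P)) := by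
    intro D hD
    refine tendsto_integral_of_dominated_convergence (fun _ => (1 : ℝ)) (fun n => ?_)
      (integrable_const _) (fun n => ae_of_all _ fun ω => hexp _) ?_
    · exact (hce.measurable.comp (hIm D hD n)).aestronglyMeasurable
    · filter_upwards [hIlim D hD] with ω hω
      exact (hce.tendsto _).comp hω
  have htwo : Tendsto
      (fun n => ∫ ω, Complex.exp (Complex.I * ((t * I A n ω : ℝ) : ℂ)) *
        Complex.exp (Complex.I * ((t * I B n ω : ℝ) : ℂ)) ∂P) atTop
      (𝓝 (∫ ω, Complex.exp (Complex.I * ((t * ∫ x in A, φ (Z x ω) : ℝ) : ℂ)) *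
        Complex.exp (Complex.I * ((t * ∫ x in B, φ (Z x ω) : ℝ) : ℂ)) ∂P)) := by
    refine tendsto_integral_of_dominated_convergence (fun _ => (1 : ℝ)) (fun n => ?_)
      (integrable_const _) (fun n => ae_of_all _ fun ω => ?_) ?_
    · exact ((hce.measurable.comp (hIm A hA n)).mul
        (hce.measurable.comp (hIm B hB n))).aestronglyMeasurable
    · rw [norm_mul]
      exact mul_le_one₀ (hexp _) (norm_nonneg _) (hexp _)
    · filter_upwards [hIlim A hA, hIlim B hB] with ω hω hω'
      exact ((hce.tendsto _).comp hω).mul ((hce.tendsto _).comp hω')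
  have hκ1 : ∀ x, ‖κ x‖ ≤ 1 := fun x => by
    rw [Real.norm_of_nonneg (hZ.kernel_pos x).le]; exact hZ.kernel_le_one x
  have hκ : Tendsto (fun n => ∫ x in A, ∫ y in B, κ (s n x - s n y)) atTop
      (𝓝 (∫ x in A, ∫ y in B, κ (x - y))) := by
    refine tendsto_integral_of_dominated_convergence
      (fun _ => 1 * (volume.restrict B).real Set.univ) (fun n => ?_)
      (integrable_const _) (fun n => ae_of_all _ fun x => ?_) (ae_of_all _ fun x => ?_)
    · have : StronglyMeasurable (fun p : Space d × Space d => κ (s n p.1 - s n p.2)) :=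
        (hZ.kernel_continuous.measurable.comp (((hsm n).comp measurable_fst).sub
          ((hsm n).comp measurable_snd))).stronglyMeasurable
      exact this.integral_prod_right'.aestronglyMeasurable
    · exact norm_integral_le_of_norm_le_const (ae_of_all _ fun y => hκ1 _)
    · refine tendsto_integral_of_dominated_convergence (fun _ => (1 : ℝ)) (fun n => ?_)
        (integrable_const _) (fun n => ae_of_all _ fun y => hκ1 _) (ae_of_all _ fun y => ?_)
      · exact (hZ.kernel_continuous.measurable.comp
          ((hsm n).const_sub (s n x))).aestronglyMeasurable
      · exact (hZ.kernel_continuous.tendsto _).comp ((hs x).sub (hs y))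
  exact le_of_tendsto_of_tendsto (htwo.sub ((hone A hA).mul (hone B hB))).norm
    (hκ.const_mul _) (Eventually.of_forall hbound)

end Mixing

section Covariance

variable {Ω : Type*} [MeasurableSpace Ω] {P : Measure Ω}

lemma abs_integral_mul_le_sqrt {U V : Ω → ℝ} (hU : MemLp U 2 P) (hV : MemLp V 2 P) :
    |∫ ω, U ω * V ω ∂P| ≤ √(∫ ω, U ω ^ 2 ∂P) * √(∫ ω, V ω ^ 2 ∂P) := by
  have h2 : ENNReal.ofReal 2 = 2 := by simp
  have h := integral_mul_norm_le_Lp_mul_Lq (μ := P) (f := U) (g := V) Real.HolderConjugate.two_two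
    (by rwa [h2]) (by rwa [h2])
  simp only [Real.norm_eq_abs, Real.rpow_two, sq_abs, ← Real.sqrt_eq_rpow] at h
  refine (abs_integral_le_integral_abs).trans ?_
  simpa only [abs_mul] using h

lemma abs_cov_le_sqrt [IsProbabilityMeasure P] {U V : Ω → ℝ} (hU : MemLp U 2 P)
    (hV : MemLp V 2 P) :
    |cov P U V| ≤ 2 * (√(∫ ω, U ω ^ 2 ∂P) * √(∫ ω, V ω ^ 2 ∂P)) := by
  have h1 : MemLp (fun _ : Ω => (1 : ℝ)) 2 P := memLp_const 1
  have hU1 := abs_integral_mul_le_sqrt hU h1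
  have hV1 := abs_integral_mul_le_sqrt hV h1
  simp only [mul_one, one_pow, integral_const, probReal_univ, smul_eq_mul, Real.sqrt_one] at hU1 hV1
  have h := abs_integral_mul_le_sqrt hU hV
  have h' := mul_le_mul hU1 hV1 (abs_nonneg _) (Real.sqrt_nonneg _)
  rw [← abs_mul] at h'
  rw [cov]
  refine (abs_sub _ _).trans ?_
  linarith

lemma abs_cov_sub_cov_le [IsProbabilityMeasure P] {U U' V V' : Ω → ℝ} (hU : MemLp U 2 P)
    (hU' : MemLp U' 2 P) (hV : MemLp V 2 P) (hV' : MemLp V' 2 P) {D S : ℝ}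
    (hUD : ∫ ω, (U ω - U' ω) ^ 2 ∂P ≤ D) (hVD : ∫ ω, (V ω - V' ω) ^ 2 ∂P ≤ D)
    (hUS : ∫ ω, U' ω ^ 2 ∂P ≤ S) (hVS : ∫ ω, V ω ^ 2 ∂P ≤ S) :
    |cov P U V - cov P U' V'| ≤ 4 * (√D * √S) := by
  have hUU : MemLp (fun ω => U ω - U' ω) 2 P := hU.sub hU'
  have hVV : MemLp (fun ω => V ω - V' ω) 2 P := hV.sub hV'
  have i1 : Integrable (fun ω => U ω * V ω) P := hU.integrable_mul hV
  have i2 : Integrable (fun ω => U' ω * V ω) P := hU'.integrable_mul hV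
  have i3 : Integrable (fun ω => U' ω * V' ω) P := hU'.integrable_mul hV'
  have e : cov P U V - cov P U' V'
      = cov P (fun ω => U ω - U' ω) V + cov P U' (fun ω => V ω - V' ω) := by
    simp only [cov, sub_mul, mul_sub]
    rw [integral_sub i1 i2, integral_sub i2 i3,
      integral_sub (hU.integrable one_le_two) (hU'.integrable one_le_two),
      integral_sub (hV.integrable one_le_two) (hV'.integrable one_le_two)]
    ring
  rw [e]
  refine (abs_add_le _ _).trans ?_
  have h1 := abs_cov_le_sqrt hUU hV
  have h2 := abs_cov_le_sqrt hU' hVV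
  have h3 : √(∫ ω, (U ω - U' ω) ^ 2 ∂P) * √(∫ ω, V ω ^ 2 ∂P) ≤ √D * √S := by gcongr
  have h4 : √(∫ ω, U' ω ^ 2 ∂P) * √(∫ ω, (V ω - V' ω) ^ 2 ∂P) ≤ √S * √D := by gcongr
  rw [mul_comm (√S)] at h4
  linarith

/-- Truncation of a real number at level `T`. -/
def clamp (T z : ℝ) : ℝ := max (-T) (min T z)

lemma continuous_clamp (T : ℝ) : Continuous (clamp T) := by unfold clamp; fun_prop

lemma abs_clamp_le {T : ℝ} (hT : 0 ≤ T) (z : ℝ) : |clamp T z| ≤ T := by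
  unfold clamp
  rw [abs_le]
  exact ⟨le_max_left _ _, max_le (by linarith) (min_le_left _ _)⟩

lemma abs_clamp_sub_le (T z w : ℝ) : |clamp T z - clamp T w| ≤ |z - w| := by
  unfold clamp
  have h1 := abs_max_sub_max_le_max (-T) (min T z) (-T) (min T w)
  have h2 := abs_min_sub_min_le_max T z T w
  simp only [sub_self, abs_zero, abs_nonneg, sup_of_le_right] at h1 h2
  exact h1.trans h2

lemma sq_sub_clamp_le {T δ : ℝ} (hT : 0 < T) (hδ : 0 < δ) (z : ℝ) :
    (z - clamp T z) ^ 2 ≤ T ^ (-δ) * |z| ^ ((2 : ℝ) + δ) := by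
  by_cases h : |z| ≤ T
  · have : clamp T z = z := by
      rw [abs_le] at h
      rw [clamp, min_eq_right h.2, max_eq_right h.1]
    rw [this]; simp; positivity
  · push Not at h
    have hz : 0 < |z| := hT.trans h
    have h1 : (z - clamp T z) ^ 2 ≤ |z| ^ 2 := by
      rw [sq_abs, sq_le_sq]
      unfold clamp
      rcases le_total 0 z with h0 | h0
      · rw [abs_of_nonneg h0] at h ⊢
        rw [min_eq_left h.le, max_eq_right (by linarith), abs_of_nonneg] <;> linarith
      · rw [abs_of_nonpos h0] at h ⊢
        rw [min_eq_right (by linarith), max_eq_left (by linarith), abs_of_nonpos] <;> linarith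
    refine h1.trans ?_
    rw [Real.rpow_add hz, Real.rpow_two, Real.rpow_neg hT.le, mul_left_comm]
    refine le_mul_of_one_le_right (by positivity) ?_
    rw [inv_mul_eq_div, one_le_div (by positivity)]
    exact Real.rpow_le_rpow hT.le h.le hδ.le

lemma sq_le_one_add_rpow {δ : ℝ} (hδ : 0 < δ) (z : ℝ) : z ^ 2 ≤ 1 + |z| ^ ((2 : ℝ) + δ) := by
  rw [← sq_abs]
  have h0 : 0 ≤ |z| ^ ((2 : ℝ) + δ) := by positivity
  by_cases h : |z| ≤ 1
  · have : |z| ^ 2 ≤ 1 := pow_le_one₀ (abs_nonneg _) h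
    linarith
  · push Not at h
    have : |z| ^ (2 : ℝ) ≤ |z| ^ ((2 : ℝ) + δ) := Real.rpow_le_rpow_of_exponent_le h.le (by linarith)
    rw [Real.rpow_two] at this
    linarith

end Covariance

section Mixing

variable {Ω : Type*} [MeasurableSpace Ω] {d : ℕ} {P : Measure Ω} {Z : Space d → Ω → ℝ}
  {κ : Space d → ℝ}

lemma IsMixingField.identDistrib (hZ : IsMixingField P Z κ) (x : Space d) :
    IdentDistrib (Z x) (Z 0) P P := by
  have h := hZ.map_pair x x
  have hm : ∀ u v : Space d, Measurable fun ω => (Z u ω, Z v ω) := fun u v =>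
    (hZ.measurable_apply u).prodMk (hZ.measurable_apply v)
  exact (IdentDistrib.mk (hm x x).aemeasurable (hm 0 (x - x)).aemeasurable h).comp measurable_fst

lemma IsMixingField.integral_comp (hZ : IsMixingField P Z κ) {φ : ℝ → ℝ} (hφ : Measurable φ)
    (x : Space d) : ∫ ω, φ (Z x ω) ∂P = ∫ ω, φ (Z 0 ω) ∂P :=
  ((hZ.identDistrib x).comp hφ).integral_eq

lemma IsMixingField.memLp_comp (hZ : IsMixingField P Z κ) {φ : ℝ → ℝ} (hφ : Measurable φ)
    {p : ℝ≥0∞} (h : MemLp (fun ω => φ (Z 0 ω)) p P) (x : Space d) :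
    MemLp (fun ω => φ (Z x ω)) p P :=
  ((hZ.identDistrib x).comp hφ).memLp_iff.2 h

lemma IsMixingField.cov_comp (hZ : IsMixingField P Z κ) {φ ψ : ℝ → ℝ} (hφ : Measurable φ)
    (hψ : Measurable ψ) (x y : Space d) :
    cov P (fun ω => φ (Z x ω)) (fun ω => ψ (Z y ω))
      = cov P (fun ω => φ (Z 0 ω)) (fun ω => ψ (Z (y - x) ω)) := by
  have hm : ∀ u v : Space d, Measurable fun ω => (Z u ω, Z v ω) := fun u v =>
    (hZ.measurable_apply u).prodMk (hZ.measurable_apply v)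
  have h := ((IdentDistrib.mk (hm x y).aemeasurable (hm 0 (y - x)).aemeasurable
    (hZ.map_pair x y)).comp (u := fun p : ℝ × ℝ => φ p.1 * ψ p.2)
    ((hφ.comp measurable_fst).mul (hψ.comp measurable_snd))).integral_eq
  simp only [Function.comp_def] at h
  rw [cov, cov, h, hZ.integral_comp hφ x, hZ.integral_comp hψ y, hZ.integral_comp hψ (y - x)]

lemma memLp_two_of_rpow [IsProbabilityMeasure P] {δ : ℝ} (hδ : 0 < δ) {U : Ω → ℝ}
    (hU : Measurable U) (h : Integrable (fun ω => |U ω| ^ ((2 : ℝ) + δ)) P) : MemLp U 2 P := by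
  rw [memLp_two_iff_integrable_sq hU.aestronglyMeasurable]
  refine Integrable.mono' ((integrable_const 1).add h) (hU.pow_const 2).aestronglyMeasurable
    (ae_of_all _ fun ω => ?_)
  rw [Real.norm_eq_abs, abs_of_nonneg (sq_nonneg _)]
  exact sq_le_one_add_rpow hδ _

/-- Bounded continuous functions are dense in `L²` of the one-point law. -/
lemma IsMixingField.exists_continuous_sq_sub_le [IsProbabilityMeasure P]
    (hZ : IsMixingField P Z κ) {G : ℝ → ℝ} (hG : Measurable G)
    (hG2 : MemLp (fun ω => G (Z 0 ω)) 2 P) {ε : ℝ} (hε : 0 < ε) :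
    ∃ g : BoundedContinuousFunction ℝ ℝ, ∫ ω, (G (Z 0 ω) - g (Z 0 ω)) ^ 2 ∂P ≤ ε := by
  have hm := (hZ.measurable_apply 0)
  have : IsProbabilityMeasure (P.map (Z 0)) := Measure.isProbabilityMeasure_map hm.aemeasurable
  have h2 : ENNReal.ofReal 2 = 2 := by simp
  have h : MemLp G (ENNReal.ofReal 2) (P.map (Z 0)) := by
    rw [h2]; exact (memLp_map_measure_iff hG.aestronglyMeasurable hm.aemeasurable).2 hG2
  obtain ⟨g, hg, -⟩ := h.exists_boundedContinuous_integral_rpow_sub_le two_pos hε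
  refine ⟨g, ?_⟩
  simp only [Real.norm_eq_abs, Real.rpow_two, sq_abs] at hg
  have hGg : Measurable fun z => (G z - g z) ^ 2 := (hG.sub g.continuous.measurable).pow_const 2
  rwa [integral_map hm.aemeasurable hGg.aestronglyMeasurable] at hg

lemma IsMixingField.abs_cov_le_rpow [IsProbabilityMeasure P] (hZ : IsMixingField P Z κ)
    {G : ℝ → ℝ} (hG : Measurable G) {δ : ℝ} (hδ : 0 < δ) {A : ℝ}
    (hmom : Integrable (fun ω => |G (Z 0 ω)| ^ ((2 : ℝ) + δ)) P)
    (hA : ∫ ω, |G (Z 0 ω)| ^ ((2 : ℝ) + δ) ∂P ≤ A) (x y : Space d) :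
    |cov P (fun ω => G (Z x ω)) (fun ω => G (Z y ω))|
      ≤ 30 * (1 + A) * κ (x - y) ^ (min (1 / 2) (δ / 8)) := by
  set k := κ (x - y) with hk
  have hk0 : 0 < k := hZ.kernel_pos _
  have hk1 : k ≤ 1 := hZ.kernel_le_one _
  have hA0 : 0 ≤ A := le_trans (integral_nonneg fun ω => by positivity) hA
  set T : ℝ := k ^ (-(1 / 4) : ℝ) with hTdef
  have hT : 0 < T := by positivity
  have hT1 : T ^ (-δ) ≤ 1 := by
    rw [hTdef, ← Real.rpow_mul hk0.le]
    exact Real.rpow_le_one hk0.le hk1 (by linarith)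
  have hTδ : 0 < T ^ (-δ) := by positivity
  have hm0 : Measurable fun ω => G (Z 0 ω) := hG.comp (hZ.measurable_apply 0)
  have hG2 : MemLp (fun ω => G (Z 0 ω)) 2 P := memLp_two_of_rpow hδ hm0 hmom
  obtain ⟨g, hg⟩ := hZ.exists_continuous_sq_sub_le hG hG2 (ε := T ^ (-δ)) hTδ
  set φ : ℝ → ℝ := fun z => clamp T (g z) with hφdef
  have hφ : Continuous φ := (continuous_clamp T).comp g.continuous
  have hφT : ∀ z, |φ z| ≤ T := fun z => abs_clamp_le hT.le _
  have hφ2 : MemLp (fun ω => φ (Z 0 ω)) 2 P :=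
    MemLp.of_bound (hφ.measurable.comp (hZ.measurable_apply 0)).aestronglyMeasurable T
      (ae_of_all _ fun ω => hφT _)
  have hg2 : MemLp (fun ω => g (Z 0 ω)) 2 P :=
    MemLp.of_bound (g.continuous.measurable.comp (hZ.measurable_apply 0)).aestronglyMeasurable ‖g‖
      (ae_of_all _ fun ω => g.norm_coe_le_norm _)
  have hD : ∫ ω, (G (Z 0 ω) - φ (Z 0 ω)) ^ 2 ∂P ≤ 4 * (1 + A) * T ^ (-δ) := by
    have hi : Integrable (fun ω => (G (Z 0 ω) - g (Z 0 ω)) ^ 2) P := (hG2.sub hg2).integrable_sq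
    have h1 : ∫ ω, (G (Z 0 ω) - φ (Z 0 ω)) ^ 2 ∂P
        ≤ ∫ ω, (2 * (T ^ (-δ) * |G (Z 0 ω)| ^ ((2 : ℝ) + δ)) + 2 * (G (Z 0 ω) - g (Z 0 ω)) ^ 2) ∂P := by
      refine integral_mono (hG2.sub hφ2).integrable_sq
        (((hmom.const_mul _).const_mul _).add (hi.const_mul _)) fun ω => ?_
      have h1 := sq_sub_clamp_le hT hδ (G (Z 0 ω))
      have h2 := sq_le_sq.2 (abs_clamp_sub_le T (G (Z 0 ω)) (g (Z 0 ω)))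
      have h3 : (G (Z 0 ω) - φ (Z 0 ω)) ^ 2 ≤ 2 * (G (Z 0 ω) - clamp T (G (Z 0 ω))) ^ 2
          + 2 * (clamp T (G (Z 0 ω)) - φ (Z 0 ω)) ^ 2 := by
        nlinarith [sq_nonneg ((G (Z 0 ω) - clamp T (G (Z 0 ω))) - (clamp T (G (Z 0 ω)) - φ (Z 0 ω)))]
      simp only [hφdef] at h3 ⊢
      linarith
    rw [integral_add ((hmom.const_mul _).const_mul _) (hi.const_mul _), integral_const_mul,
      integral_const_mul, integral_const_mul] at h1
    have h4 : T ^ (-δ) * ∫ ω, |G (Z 0 ω)| ^ ((2 : ℝ) + δ) ∂P ≤ T ^ (-δ) * A := by gcongr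
    nlinarith
  have hS : ∫ ω, G (Z 0 ω) ^ 2 ∂P ≤ 1 + A := by
    have h : ∫ ω, G (Z 0 ω) ^ 2 ∂P ≤ ∫ ω, (1 + |G (Z 0 ω)| ^ ((2 : ℝ) + δ)) ∂P :=
      integral_mono hG2.integrable_sq ((integrable_const _).add hmom) fun ω =>
        sq_le_one_add_rpow hδ _
    rw [integral_add (integrable_const _) hmom] at h
    simp only [integral_const, probReal_univ, smul_eq_mul, mul_one] at h
    linarith
  have hS' : ∫ ω, φ (Z 0 ω) ^ 2 ∂P ≤ 10 * (1 + A) := by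
    have hi : Integrable (fun ω => (G (Z 0 ω) - φ (Z 0 ω)) ^ 2) P := (hG2.sub hφ2).integrable_sq
    have h : ∫ ω, φ (Z 0 ω) ^ 2 ∂P
        ≤ ∫ ω, (2 * G (Z 0 ω) ^ 2 + 2 * (G (Z 0 ω) - φ (Z 0 ω)) ^ 2) ∂P :=
      integral_mono hφ2.integrable_sq ((hG2.integrable_sq.const_mul _).add (hi.const_mul _))
        fun ω => by nlinarith [sq_nonneg (2 * G (Z 0 ω) - φ (Z 0 ω))]
    rw [integral_add (hG2.integrable_sq.const_mul _) (hi.const_mul _), integral_const_mul,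
      integral_const_mul] at h
    nlinarith
  have hGφm : Measurable fun z => (G z - φ z) ^ 2 := (hG.sub hφ.measurable).pow_const 2
  have hφm2 : Measurable fun z => φ z ^ 2 := hφ.measurable.pow_const 2
  have hGm2 : Measurable fun z => G z ^ 2 := hG.pow_const 2
  have key := abs_cov_sub_cov_le (hZ.memLp_comp hG hG2 x) (hZ.memLp_comp hφ.measurable hφ2 x)
    (hZ.memLp_comp hG hG2 y) (hZ.memLp_comp hφ.measurable hφ2 y)
    ((hZ.integral_comp hGφm x).trans_le hD) ((hZ.integral_comp hGφm y).trans_le hD)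
    ((hZ.integral_comp hφm2 x).trans_le hS')
    ((hZ.integral_comp hGm2 y).trans_le (hS.trans (by linarith)))
  have hc := hZ.abs_cov_le hφ hφ hφT hφT x y
  set θ : ℝ := min (1 / 2) (δ / 8) with hθ
  have h1 : 4 * T * T * κ (x - y) ≤ 4 * (1 + A) * k ^ θ := by
    have : T * T * k = k ^ (1 / 2 : ℝ) := by
      rw [hTdef, ← Real.rpow_add hk0]
      nth_rewrite 2 [← Real.rpow_one k]
      rw [← Real.rpow_add hk0]; norm_num
    have h2 : k ^ (1 / 2 : ℝ) ≤ k ^ θ := Real.rpow_le_rpow_of_exponent_ge hk0 hk1 (min_le_left _ _)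
    have h3 : 0 ≤ k ^ θ := by positivity
    rw [← hk]
    nlinarith
  have h2 : √(4 * (1 + A) * T ^ (-δ)) * √(10 * (1 + A)) ≤ 13 / 2 * (1 + A) * k ^ θ := by
    rw [← Real.sqrt_mul (by positivity)]
    refine Real.sqrt_le_iff.2 ⟨by positivity, ?_⟩
    have h3 : T ^ (-δ) = (k ^ (δ / 8)) ^ 2 := by
      rw [hTdef, ← Real.rpow_mul hk0.le, ← Real.rpow_natCast, ← Real.rpow_mul hk0.le]
      congr 1; push_cast; ring
    have h4 : k ^ (δ / 8) ≤ k ^ θ := Real.rpow_le_rpow_of_exponent_ge hk0 hk1 (min_le_right _ _)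
    have h5 : (k ^ (δ / 8)) ^ 2 ≤ (k ^ θ) ^ 2 := by gcongr
    rw [h3]
    have h6 : (1 + A) ^ 2 * (k ^ (δ / 8)) ^ 2 ≤ (1 + A) ^ 2 * (k ^ θ) ^ 2 := by gcongr
    nlinarith [show 0 ≤ (1 + A) ^ 2 * (k ^ θ) ^ 2 by positivity]
  have h3 := abs_sub_abs_le_abs_sub (cov P (fun ω => G (Z x ω)) (fun ω => G (Z y ω)))
    (cov P (fun ω => φ (Z x ω)) (fun ω => φ (Z y ω)))
  linarith

end Mixing

section Mixing

variable {Ω : Type*} [MeasurableSpace Ω] {d : ℕ} {P : Measure Ω} {Z : Space d → Ω → ℝ}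
  {κ : Space d → ℝ}

/-- The covariance function of the stationary field `x ↦ G (Z x)`. -/
def covFn (P : Measure Ω) (Z : Space d → Ω → ℝ) (G : ℝ → ℝ) (x : Space d) : ℝ :=
  cov P (fun ω => G (Z 0 ω)) (fun ω => G (Z x ω))

lemma IsMixingField.measurable_covFn [IsProbabilityMeasure P] (hZ : IsMixingField P Z κ)
    {G : ℝ → ℝ} (hG : Measurable G) : Measurable (covFn P Z G) := by
  have hm : Measurable fun p : Space d × Ω => G (Z p.1 p.2) := hG.comp hZ.measurable
  have hm0 : Measurable fun p : Space d × Ω => G (Z 0 p.2) :=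
    hG.comp ((hZ.measurable_apply 0).comp measurable_snd)
  have h1 : Measurable fun x => ∫ ω, G (Z 0 ω) * G (Z x ω) ∂P :=
    ((hm0.mul hm).stronglyMeasurable.integral_prod_right' (ν := P)).measurable
  have h2 : Measurable fun x => ∫ ω, G (Z x ω) ∂P :=
    (hm.stronglyMeasurable.integral_prod_right' (ν := P)).measurable
  exact h1.sub (h2.const_mul _)

lemma IsMixingField.abs_covFn_le [IsProbabilityMeasure P] (hZ : IsMixingField P Z κ)
    {G : ℝ → ℝ} (hG : Measurable G) {δ : ℝ} (hδ : 0 < δ) {A : ℝ}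
    (hmom : Integrable (fun ω => |G (Z 0 ω)| ^ ((2 : ℝ) + δ)) P)
    (hA : ∫ ω, |G (Z 0 ω)| ^ ((2 : ℝ) + δ) ∂P ≤ A) (x : Space d) :
    |covFn P Z G x| ≤ 30 * (1 + A) * κ x ^ (min (1 / 2) (δ / 8)) := by
  have h := hZ.abs_cov_le_rpow hG hδ hmom hA 0 x
  rwa [zero_sub, hZ.kernel_neg] at h

lemma IsMixingField.integrable_covFn [IsProbabilityMeasure P] (hZ : IsMixingField P Z κ)
    {G : ℝ → ℝ} (hG : Measurable G) {δ : ℝ} (hδ : 0 < δ)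
    (hmom : Integrable (fun ω => |G (Z 0 ω)| ^ ((2 : ℝ) + δ)) P) : Integrable (covFn P Z G) :=
  ((hZ.kernel_integrable _ (lt_min one_half_pos (by positivity))).const_mul _).mono'
    (hZ.measurable_covFn hG).aestronglyMeasurable
    (ae_of_all _ fun x => hZ.abs_covFn_le hG hδ hmom le_rfl x)

lemma IsMixingField.cov_eq_covFn (hZ : IsMixingField P Z κ) {G : ℝ → ℝ} (hG : Measurable G)
    (x y : Space d) :
    cov P (fun ω => G (Z x ω)) (fun ω => G (Z y ω)) = covFn P Z G (y - x) :=
  hZ.cov_comp hG hG x y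

lemma IsMixingField.abs_covFn_le_sq [IsProbabilityMeasure P] (hZ : IsMixingField P Z κ)
    {G : ℝ → ℝ} (hG : Measurable G) (hG2 : MemLp (fun ω => G (Z 0 ω)) 2 P) (x : Space d) :
    |covFn P Z G x| ≤ 2 * ∫ ω, G (Z 0 ω) ^ 2 ∂P := by
  have h := abs_cov_le_sqrt hG2 (hZ.memLp_comp hG hG2 x)
  rw [hZ.integral_comp (φ := fun z => G z ^ 2) (hG.pow_const 2) x, Real.mul_self_sqrt
    (integral_nonneg fun ω => sq_nonneg _)] at h
  exact h

lemma IsMixingField.covFn_sub_const [IsProbabilityMeasure P] (hZ : IsMixingField P Z κ)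
    {G : ℝ → ℝ} (hG : Measurable G) (hG2 : MemLp (fun ω => G (Z 0 ω)) 2 P) (m : ℝ) :
    covFn P Z (fun z => G z - m) = covFn P Z G := by
  funext x
  have h0 := hG2.integrable one_le_two
  have hx2 := hZ.memLp_comp hG hG2 x
  have hx := hx2.integrable one_le_two
  have h0x : Integrable (fun ω => G (Z 0 ω) * G (Z x ω)) P := hG2.integrable_mul hx2
  have e : ∫ ω, (G (Z 0 ω) - m) * (G (Z x ω) - m) ∂P
      = ∫ ω, G (Z 0 ω) * G (Z x ω) ∂P - m * ∫ ω, G (Z x ω) ∂P - m * ∫ ω, G (Z 0 ω) ∂P + m * m := by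
    have : ∀ ω, (G (Z 0 ω) - m) * (G (Z x ω) - m)
        = G (Z 0 ω) * G (Z x ω) - m * G (Z x ω) - m * G (Z 0 ω) + m * m := fun ω => by ring
    simp only [this]
    have i1 : Integrable (fun ω => G (Z 0 ω) * G (Z x ω) - m * G (Z x ω)) P :=
      h0x.sub (hx.const_mul m)
    have i2 : Integrable (fun ω => G (Z 0 ω) * G (Z x ω) - m * G (Z x ω) - m * G (Z 0 ω)) P :=
      i1.sub (h0.const_mul m)
    rw [integral_add i2 (integrable_const _), integral_sub i1 (h0.const_mul m),
      integral_sub h0x (hx.const_mul m),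
      integral_const_mul, integral_const_mul]
    simp
  simp only [covFn, cov]
  rw [e, integral_sub h0 (integrable_const _), integral_sub hx (integrable_const _)]
  simp only [integral_const, probReal_univ, smul_eq_mul, one_mul]
  ring

section SecondMoment

variable [IsProbabilityMeasure P] {G : ℝ → ℝ} {A : Set (Space d)}

lemma IsMixingField.integrable_prod_mul (hZ : IsMixingField P Z κ) (hG : Measurable G)
    (hG2 : MemLp (fun ω => G (Z 0 ω)) 2 P) (hA : volume A ≠ ∞) :
    Integrable (fun q : Ω × (Space d × Space d) => G (Z q.2.1 q.1) * G (Z q.2.2 q.1))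
      (P.prod ((volume.restrict A).prod (volume.restrict A))) := by
  have : IsFiniteMeasure (volume.restrict A) := ⟨by simpa using hA.lt_top⟩
  have hm1 : Measurable fun q : Ω × (Space d × Space d) => G (Z q.2.1 q.1) :=
    hG.comp (hZ.measurable.comp (f := fun q : Ω × (Space d × Space d) => (q.2.1, q.1))
      (by fun_prop))
  have hm2 : Measurable fun q : Ω × (Space d × Space d) => G (Z q.2.2 q.1) :=
    hG.comp (hZ.measurable.comp (f := fun q : Ω × (Space d × Space d) => (q.2.2, q.1))
      (by fun_prop))
  have hm := hm1.mul hm2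
  have hi : ∀ p : Space d × Space d, Integrable (fun ω => G (Z p.1 ω) * G (Z p.2 ω)) P :=
    fun p => (hZ.memLp_comp hG hG2 p.1).integrable_mul (hZ.memLp_comp hG hG2 p.2)
  refine (integrable_prod_iff' hm.aestronglyMeasurable).2 ⟨ae_of_all _ hi, ?_⟩
  refine Integrable.mono' (integrable_const (∫ ω, G (Z 0 ω) ^ 2 ∂P))
    (hm.norm.stronglyMeasurable.comp_measurable measurable_swap).integral_prod_right'.aestronglyMeasurable
    (ae_of_all _ fun p => ?_)
  rw [Real.norm_eq_abs, abs_of_nonneg (integral_nonneg fun ω => norm_nonneg _)]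
  have h := abs_integral_mul_le_sqrt (hZ.memLp_comp hG hG2 p.1).abs (hZ.memLp_comp hG hG2 p.2).abs
  simp only [Pi.abs_apply, sq_abs] at h
  rw [hZ.integral_comp (φ := fun z => G z ^ 2) (hG.pow_const 2) p.1,
    hZ.integral_comp (φ := fun z => G z ^ 2) (hG.pow_const 2) p.2,
    Real.mul_self_sqrt (integral_nonneg fun ω => sq_nonneg _)] at h
  simp only [Pi.mul_apply, norm_mul, Real.norm_eq_abs]
  exact (le_abs_self _).trans h

omit [IsProbabilityMeasure P] in
lemma IsMixingField.integral_mul_eq_covFn (hZ : IsMixingField P Z κ) (hG : Measurable G)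
    (h0 : ∫ ω, G (Z 0 ω) ∂P = 0) (x y : Space d) :
    ∫ ω, G (Z x ω) * G (Z y ω) ∂P = covFn P Z G (y - x) := by
  rw [← hZ.cov_eq_covFn hG, cov, hZ.integral_comp hG x, h0, zero_mul, sub_zero]

lemma IsMixingField.integrable_covFn_prod (hZ : IsMixingField P Z κ) (hG : Measurable G)
    (hG2 : MemLp (fun ω => G (Z 0 ω)) 2 P) (h0 : ∫ ω, G (Z 0 ω) ∂P = 0) (hA : volume A ≠ ∞) :
    Integrable (fun p : Space d × Space d => covFn P Z G (p.2 - p.1))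
      ((volume.restrict A).prod (volume.restrict A)) := by
  have : IsFiniteMeasure (volume.restrict A) := ⟨by simpa using hA.lt_top⟩
  refine (hZ.integrable_prod_mul hG hG2 hA).integral_prod_right.congr (ae_of_all _ fun p => ?_)
  exact hZ.integral_mul_eq_covFn hG h0 p.1 p.2

lemma IsMixingField.memLp_setIntegral (hZ : IsMixingField P Z κ) (hG : Measurable G)
    (hG2 : MemLp (fun ω => G (Z 0 ω)) 2 P) (hA : volume A ≠ ∞) :
    MemLp (fun ω => ∫ x in A, G (Z x ω)) 2 P := by
  have : IsFiniteMeasure (volume.restrict A) := ⟨by simpa using hA.lt_top⟩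
  rw [memLp_two_iff_integrable_sq (hZ.stronglyMeasurable_integral hG A).aestronglyMeasurable]
  refine (hZ.integrable_prod_mul hG hG2 hA).integral_prod_left.congr (ae_of_all _ fun ω => ?_)
  simp only [sq]
  exact integral_prod_mul (fun x => G (Z x ω)) (fun x => G (Z x ω))

lemma IsMixingField.integral_sq_setIntegral (hZ : IsMixingField P Z κ) (hG : Measurable G)
    (hG2 : MemLp (fun ω => G (Z 0 ω)) 2 P) (h0 : ∫ ω, G (Z 0 ω) ∂P = 0) (hA : volume A ≠ ∞) :
    ∫ ω, (∫ x in A, G (Z x ω)) ^ 2 ∂P = ∫ x in A, ∫ y in A, covFn P Z G (y - x) := by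
  have : IsFiniteMeasure (volume.restrict A) := ⟨by simpa using hA.lt_top⟩
  have h := integral_integral_swap (f := fun ω (p : Space d × Space d) =>
    G (Z p.1 ω) * G (Z p.2 ω)) (hZ.integrable_prod_mul hG hG2 hA)
  rw [← integral_prod _ (hZ.integrable_covFn_prod hG hG2 h0 hA)]
  simp only [hZ.integral_mul_eq_covFn hG h0] at h
  rw [← h]
  refine integral_congr_ae (ae_of_all _ fun ω => ?_)
  simp only [sq]
  exact (integral_prod_mul (fun x => G (Z x ω)) (fun x => G (Z x ω))).symm

lemma IsMixingField.integral_sq_setIntegral_le (hZ : IsMixingField P Z κ) (hG : Measurable G)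
    (hG2 : MemLp (fun ω => G (Z 0 ω)) 2 P) (h0 : ∫ ω, G (Z 0 ω) ∂P = 0) (hA : volume A ≠ ∞)
    (hC : Integrable (covFn P Z G)) :
    ∫ ω, (∫ x in A, G (Z x ω)) ^ 2 ∂P ≤ volume.real A * ∫ x, |covFn P Z G x| := by
  have : IsFiniteMeasure (volume.restrict A) := ⟨by simpa using hA.lt_top⟩
  rw [hZ.integral_sq_setIntegral hG hG2 h0 hA]
  have hi := (hZ.integrable_covFn_prod hG hG2 h0 hA).integral_prod_left
  have hb : ∀ x, ∫ y in A, covFn P Z G (y - x) ≤ ∫ x, |covFn P Z G x| := fun x => by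
    have h1 : Integrable fun y => |covFn P Z G (y - x)| := hC.abs.comp_sub_right x
    calc _ ≤ ∫ y in A, |covFn P Z G (y - x)| :=
          integral_mono (hC.comp_sub_right x).integrableOn h1.integrableOn fun y => le_abs_self _
      _ ≤ ∫ y, |covFn P Z G (y - x)| := setIntegral_le_integral h1 (ae_of_all _ fun _ => abs_nonneg _)
      _ = _ := integral_sub_right_eq_self (fun y => |covFn P Z G y|) x
  refine (integral_mono hi (integrable_const _) hb).trans (le_of_eq ?_)
  simp

end SecondMoment

end Mixing

lemma sq_le_sq_add_rpow {s δ : ℝ} (hs : 0 < s) (hδ : 0 < δ) (z : ℝ) :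
    z ^ 2 ≤ s ^ 2 + s ^ (-δ) * |z| ^ ((2 : ℝ) + δ) := by
  have h := sq_le_one_add_rpow hδ (z / s)
  rw [abs_div, abs_of_pos hs, Real.div_rpow (abs_nonneg _) hs.le, div_pow, div_le_iff₀ (by positivity)] at h
  refine h.trans (le_of_eq ?_)
  rw [Real.rpow_add hs, Real.rpow_two, Real.rpow_neg hs.le]
  field_simp

lemma abs_add_rpow_le {p : ℝ} (hp : 0 ≤ p) (a b : ℝ) :
    |a + b| ^ p ≤ 2 ^ p * (|a| ^ p + |b| ^ p) := by
  have h : |a + b| ≤ 2 * max |a| |b| := by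
    have := abs_add_le a b
    linarith [le_max_left |a| |b|, le_max_right |a| |b|]
  have hmax : (max |a| |b|) ^ p ≤ |a| ^ p + |b| ^ p := by
    rcases max_choice |a| |b| with h | h <;> rw [h]
    · linarith [Real.rpow_nonneg (abs_nonneg b) p]
    · linarith [Real.rpow_nonneg (abs_nonneg a) p]
  calc |a + b| ^ p ≤ (2 * max |a| |b|) ^ p := Real.rpow_le_rpow (abs_nonneg _) h hp
    _ = 2 ^ p * (max |a| |b|) ^ p := Real.mul_rpow two_pos.le (le_max_of_le_left (abs_nonneg _))
    _ ≤ _ := by gcongr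

section Mixing

variable {Ω : Type*} [MeasurableSpace Ω] {d : ℕ} {P : Measure Ω} {Z : Space d → Ω → ℝ}
  {κ : Space d → ℝ}

lemma IsMixingField.exists_continuous_approx [IsProbabilityMeasure P]
    (hZ : IsMixingField P Z κ) {G : ℝ → ℝ} (hG : Measurable G) {δ : ℝ} (hδ : 0 < δ)
    (hmom : Integrable (fun ω => |G (Z 0 ω)| ^ ((2 : ℝ) + δ)) P) {s : ℝ} (hs : 0 < s) :
    ∃ g : BoundedContinuousFunction ℝ ℝ,
      Integrable (fun ω => |G (Z 0 ω) - g (Z 0 ω)| ^ ((2 : ℝ) + δ)) P ∧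
      ∫ ω, |G (Z 0 ω) - g (Z 0 ω)| ^ ((2 : ℝ) + δ) ∂P ≤ s ^ ((2 : ℝ) + δ) := by
  have hm := (hZ.measurable_apply 0)
  have : IsProbabilityMeasure (P.map (Z 0)) := Measure.isProbabilityMeasure_map hm.aemeasurable
  have hp : (0 : ℝ) < 2 + δ := by linarith
  have hp0 : ENNReal.ofReal (2 + δ) ≠ 0 := by simpa using hp
  have h1 : MemLp (fun ω => G (Z 0 ω)) (ENNReal.ofReal (2 + δ)) P := by
    rw [← integrable_norm_rpow_iff (f := fun ω => G (Z 0 ω))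
      (hG.comp hm).aestronglyMeasurable hp0 ENNReal.ofReal_ne_top,
      ENNReal.toReal_ofReal hp.le]
    exact hmom
  have h : MemLp G (ENNReal.ofReal (2 + δ)) (P.map (Z 0)) :=
    (memLp_map_measure_iff hG.aestronglyMeasurable hm.aemeasurable).2 h1
  obtain ⟨g, hg, hgL⟩ := h.exists_boundedContinuous_integral_rpow_sub_le hp
    (ε := s ^ ((2 : ℝ) + δ)) (by positivity)
  have hGg : Measurable fun z => ‖G z - g z‖ ^ ((2 : ℝ) + δ) :=
    (hG.sub g.continuous.measurable).norm.pow_const _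
  rw [integral_map hm.aemeasurable hGg.aestronglyMeasurable] at hg
  refine ⟨g, ?_, hg⟩
  have h2 : MemLp (fun ω => G (Z 0 ω) - g (Z 0 ω)) (ENNReal.ofReal (2 + δ)) P :=
    h1.sub ((memLp_map_measure_iff g.continuous.measurable.aestronglyMeasurable hm.aemeasurable).1
      hgL)
  have h3 := h2.integrable_norm_rpow hp0 ENNReal.ofReal_ne_top
  rwa [ENNReal.toReal_ofReal hp.le] at h3

/-- The field `G (Z x)` is approximated by bounded continuous functionals of `Z x`, with
convergence of the integrated covariances. -/
lemma IsMixingField.exists_seq_approx [IsProbabilityMeasure P]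
    (hZ : IsMixingField P Z κ) {G : ℝ → ℝ} (hG : Measurable G) {δ : ℝ} (hδ : 0 < δ)
    (hmom : Integrable (fun ω => |G (Z 0 ω)| ^ ((2 : ℝ) + δ)) P) :
    ∃ g : ℕ → BoundedContinuousFunction ℝ ℝ,
      (∀ m, Integrable (covFn P Z fun z => G z - g m z)) ∧
      Tendsto (fun m => ∫ x, |covFn P Z (fun z => G z - g m z) x|) atTop (𝓝 0) ∧
      Tendsto (fun m => ∫ x, covFn P Z (g m) x) atTop (𝓝 (∫ x, covFn P Z G x)) := by
  set s : ℕ → ℝ := fun m => 1 / ((m : ℝ) + 1) with hsdef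
  have hs : ∀ m, 0 < s m := fun m => by positivity
  have hs1 : ∀ m, s m ≤ 1 := fun m => by
    simp only [hsdef]; rw [div_le_one (by positivity)]; linarith [Nat.cast_nonneg (α := ℝ) m]
  have hs0 : Tendsto s atTop (𝓝 0) := tendsto_one_div_add_atTop_nhds_zero_nat
  choose g hgi hg using fun m => hZ.exists_continuous_approx hG hδ hmom (hs m)
  have hp : (0 : ℝ) ≤ 2 + δ := by linarith
  have hm := hZ.measurable_apply 0
  have hgm : ∀ m, Measurable (g m) := fun m => (g m).continuous.measurable
  have hGg : ∀ m, Measurable fun z => G z - g m z := fun m => hG.sub (hgm m)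
  have hG2 : MemLp (fun ω => G (Z 0 ω)) 2 P := memLp_two_of_rpow hδ (hG.comp hm) hmom
  have hGg2 : ∀ m, MemLp (fun ω => G (Z 0 ω) - g m (Z 0 ω)) 2 P := fun m =>
    memLp_two_of_rpow hδ ((hGg m).comp hm) (hgi m)
  have hg2 : ∀ m, MemLp (fun ω => g m (Z 0 ω)) 2 P := fun m =>
    MemLp.of_bound ((hgm m).comp hm).aestronglyMeasurable ‖g m‖
      (ae_of_all _ fun ω => (g m).norm_coe_le_norm _)
  have hg1 : ∀ m, ∫ ω, |G (Z 0 ω) - g m (Z 0 ω)| ^ ((2 : ℝ) + δ) ∂P ≤ 1 := fun m =>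
    (hg m).trans (Real.rpow_le_one (hs m).le (hs1 m) hp)
  have hD : ∀ m, ∫ ω, (G (Z 0 ω) - g m (Z 0 ω)) ^ 2 ∂P ≤ 2 * s m ^ 2 := fun m => by
    have h : ∫ ω, (G (Z 0 ω) - g m (Z 0 ω)) ^ 2 ∂P
        ≤ ∫ ω, (s m ^ 2 + s m ^ (-δ) * |G (Z 0 ω) - g m (Z 0 ω)| ^ ((2 : ℝ) + δ)) ∂P :=
      integral_mono (hGg2 m).integrable_sq ((integrable_const _).add ((hgi m).const_mul _))
        fun ω => sq_le_sq_add_rpow (hs m) hδ _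
    rw [integral_add (integrable_const _) ((hgi m).const_mul _), integral_const_mul] at h
    simp only [integral_const, probReal_univ, smul_eq_mul, one_mul] at h
    have h2 : s m ^ (-δ) * ∫ ω, |G (Z 0 ω) - g m (Z 0 ω)| ^ ((2 : ℝ) + δ) ∂P ≤ s m ^ 2 := by
      calc _ ≤ s m ^ (-δ) * s m ^ ((2 : ℝ) + δ) :=
            mul_le_mul_of_nonneg_left (hg m) (Real.rpow_nonneg (hs m).le _)
        _ = s m ^ 2 := by rw [← Real.rpow_add (hs m), ← Real.rpow_two]; congr 1; ring
    linarith
  have hD0 : Tendsto (fun m => 2 * s m ^ 2) atTop (𝓝 0) := by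
    simpa using (hs0.pow 2).const_mul 2
  set A : ℝ := ∫ ω, |G (Z 0 ω)| ^ ((2 : ℝ) + δ) ∂P with hA
  set B : ℝ := 2 ^ ((2 : ℝ) + δ) * (A + 1) with hB
  have hgmom : ∀ m, Integrable (fun ω => |g m (Z 0 ω)| ^ ((2 : ℝ) + δ)) P ∧
      ∫ ω, |g m (Z 0 ω)| ^ ((2 : ℝ) + δ) ∂P ≤ B := fun m => by
    have hle : ∀ ω, |g m (Z 0 ω)| ^ ((2 : ℝ) + δ) ≤ 2 ^ ((2 : ℝ) + δ) *
        (|G (Z 0 ω)| ^ ((2 : ℝ) + δ) + |G (Z 0 ω) - g m (Z 0 ω)| ^ ((2 : ℝ) + δ)) := fun ω => by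
      have := abs_add_rpow_le hp (G (Z 0 ω)) (-(G (Z 0 ω) - g m (Z 0 ω)))
      rwa [abs_neg, neg_sub, add_sub_cancel] at this
    have hi := (hmom.add (hgi m)).const_mul (2 ^ ((2 : ℝ) + δ))
    have hint : Integrable (fun ω => |g m (Z 0 ω)| ^ ((2 : ℝ) + δ)) P := by
      refine hi.mono' (((hgm m).comp hm).abs.pow_const _).aestronglyMeasurable
        (ae_of_all _ fun ω => ?_)
      rw [Real.norm_eq_abs, abs_of_nonneg (by positivity)]
      exact hle ω
    refine ⟨hint, (integral_mono hint hi hle).trans ?_⟩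
    simp only [Pi.add_apply]
    rw [integral_const_mul, integral_add hmom (hgi m), hB]
    gcongr
    exact hg1 m
  set θ : ℝ := min (1 / 2) (δ / 8) with hθ
  have hκ : Integrable fun x => κ x ^ θ :=
    hZ.kernel_integrable _ (lt_min one_half_pos (by positivity))
  refine ⟨g, fun m => hZ.integrable_covFn (hGg m) hδ (hgi m), ?_, ?_⟩
  · have h0 : (0 : ℝ) = ∫ _ : Space d, (0 : ℝ) := by simp
    rw [h0]
    refine tendsto_integral_of_dominated_convergence (fun x => 30 * (1 + 1) * κ x ^ θ)
      (fun m => (hZ.measurable_covFn (hGg m)).abs.aestronglyMeasurable) (hκ.const_mul _)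
      (fun m => ae_of_all _ fun x => ?_) (ae_of_all _ fun x => ?_)
    · rw [Real.norm_eq_abs, abs_abs]
      exact hZ.abs_covFn_le (hGg m) hδ (hgi m) (hg1 m) x
    · refine squeeze_zero (fun m => abs_nonneg _) (fun m => ?_) (by simpa using hD0.const_mul 2)
      exact (hZ.abs_covFn_le_sq (hGg m) (hGg2 m) x).trans (by linarith [hD m])
  · refine tendsto_integral_of_dominated_convergence (fun x => 30 * (1 + B) * κ x ^ θ)
      (fun m => (hZ.measurable_covFn (hgm m)).aestronglyMeasurable) (hκ.const_mul _)
      (fun m => ae_of_all _ fun x => ?_) (ae_of_all _ fun x => ?_)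
    · exact hZ.abs_covFn_le (hgm m) hδ (hgmom m).1 (hgmom m).2 x
    · rw [tendsto_iff_dist_tendsto_zero]
      refine squeeze_zero (fun m => dist_nonneg) (g := fun m => 4 * (√(2 * s m ^ 2) *
        √(max (1 + B) (∫ ω, G (Z 0 ω) ^ 2 ∂P)))) (fun m => ?_) ?_
      · rw [dist_comm, Real.dist_eq]
        have hGφm : Measurable fun z => (G z - g m z) ^ 2 := (hGg m).pow_const 2
        refine abs_cov_sub_cov_le hG2 (hg2 m) (hZ.memLp_comp hG hG2 x)
          (hZ.memLp_comp (hgm m) (hg2 m) x) (hD m) ((hZ.integral_comp hGφm x).trans_le (hD m))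
          (le_max_of_le_left ?_)
          ((hZ.integral_comp (φ := fun z => G z ^ 2) (hG.pow_const 2) x).trans_le (le_max_right _ _))
        have h : ∫ ω, g m (Z 0 ω) ^ 2 ∂P ≤ ∫ ω, (1 + |g m (Z 0 ω)| ^ ((2 : ℝ) + δ)) ∂P :=
          integral_mono (hg2 m).integrable_sq ((integrable_const _).add (hgmom m).1) fun ω =>
            sq_le_one_add_rpow hδ _
        rw [integral_add (integrable_const _) (hgmom m).1] at h
        simp only [integral_const, probReal_univ, smul_eq_mul, mul_one] at h
        linarith [(hgmom m).2]
      · simpa using ((hD0.sqrt).mul_const _).const_mul 4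

end Mixing

section Boxes

variable {d : ℕ}

/-- A half-open box with sides parallel to the axes. -/
def box (a b : Fin d → ℝ) : Set (Space d) := {x | ∀ i, x i ∈ Set.Ico (a i) (b i)}

lemma measurableSet_box (a b : Fin d → ℝ) : MeasurableSet (box a b) := by
  have : box a b = ⋂ i, (fun x : Space d => x i) ⁻¹' Set.Ico (a i) (b i) := by
    ext x; simp [box]
  rw [this]
  exact MeasurableSet.iInter fun i => measurableSet_Ico.preimage (by fun_prop)

lemma volume_box (a b : Fin d → ℝ) :
    volume (box a b) = ∏ i, ENNReal.ofReal (b i - a i) := by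
  rw [← Real.volume_pi_Ico, ← (PiLp.volume_preserving_toLp (Fin d)).measure_preimage
    (measurableSet_box a b).nullMeasurableSet]
  congr 1
  ext x
  simp [box]

lemma volume_box_ne_top (a b : Fin d → ℝ) : volume (box a b) ≠ ∞ := by
  rw [volume_box]; exact ENNReal.prod_ne_top fun _ _ => ENNReal.ofReal_ne_top

lemma volume_real_box (a b : Fin d → ℝ) : volume.real (box a b) = ∏ i, max (b i - a i) 0 := by
  rw [Measure.real, volume_box, ENNReal.toReal_prod]
  rfl

lemma convex_box (a b : Fin d → ℝ) : Convex ℝ (box a b) := by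
  have : box a b = ⋂ i, (EuclideanSpace.proj i : Space d →L[ℝ] ℝ) ⁻¹' Set.Ico (a i) (b i) := by
    ext x; simp [box]
  rw [this]
  exact convex_iInter fun i => (convex_Ico _ _).linear_preimage _

/-- The half-open cube of side `L` with index `z` in the tiling of the space. -/
def cube (L : ℝ) (z : Fin d → ℤ) : Set (Space d) :=
  box (fun i => z i * L) (fun i => (z i + 1) * L)

lemma measurableSet_cube (L : ℝ) (z : Fin d → ℤ) : MeasurableSet (cube L z) :=
  measurableSet_box _ _

lemma volume_real_cube {L : ℝ} (hL : 0 ≤ L) (z : Fin d → ℤ) : volume.real (cube L z) = L ^ d := by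
  rw [cube, volume_real_box]
  have : ∀ i : Fin d, max (((z i : ℝ) + 1) * L - z i * L) 0 = L := fun i => by
    rw [max_eq_left] <;> ring_nf; exact hL
  simp [this]

lemma volume_cube_ne_top (L : ℝ) (z : Fin d → ℤ) : volume (cube L z) ≠ ∞ :=
  volume_box_ne_top _ _

lemma mem_cube_iff {L : ℝ} (hL : 0 < L) (z : Fin d → ℤ) (x : Space d) :
    x ∈ cube L z ↔ ∀ i, ⌊x i / L⌋ = z i := by
  simp only [cube, box, Set.mem_ofPred_eq, Set.mem_Ico, Int.floor_eq_iff, le_div_iff₀ hL,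
    div_lt_iff₀ hL]

lemma disjoint_cube {L : ℝ} (hL : 0 < L) {z z' : Fin d → ℤ} (h : z ≠ z') :
    Disjoint (cube L z) (cube L z') := by
  rw [Set.disjoint_left]
  intro x hx hx'
  rw [mem_cube_iff hL] at hx hx'
  exact h (funext fun i => (hx i).symm.trans (hx' i))

lemma dist_le_of_mem_cube {L : ℝ} {z : Fin d → ℤ} {x y : Space d} (hx : x ∈ cube L z)
    (hy : y ∈ cube L z) : dist x y ≤ √(d * L ^ 2) := by
  rw [EuclideanSpace.dist_eq]
  refine Real.sqrt_le_sqrt ?_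
  have : ∀ i ∈ Finset.univ, dist (x i) (y i) ^ 2 ≤ L ^ 2 := fun i _ => by
    have h1 := hx i
    have h2 := hy i
    simp only [Set.mem_Ico] at h1 h2
    have : dist (x i) (y i) ≤ L := by
      rw [Real.dist_eq, abs_le]
      constructor <;> linarith
    gcongr
  simpa using Finset.sum_le_card_nsmul _ _ _ this

lemma finite_cube_subset {L : ℝ} (hL : 0 < L) {V : Set (Space d)} (hV : volume V ≠ ∞) :
    {z : Fin d → ℤ | cube L z ⊆ V}.Finite := by
  have h := Measure.finite_const_le_meas_of_disjoint_iUnion (volume : Measure (Space d))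
    (ε := ENNReal.ofReal (L ^ d)) (by simpa using pow_pos hL d)
    (As := fun z : {z : Fin d → ℤ // cube L z ⊆ V} => cube L z.1)
    (fun z => measurableSet_cube L _)
    (fun z z' hz => disjoint_cube hL fun h => hz (Subtype.ext h))
    (measure_ne_top_of_subset (Set.iUnion_subset fun z => z.2) hV)
  have h' : {z : {z : Fin d → ℤ // cube L z ⊆ V} |
      ENNReal.ofReal (L ^ d) ≤ volume (cube L z.1)} = Set.univ := by
    ext z
    simp only [Set.mem_ofPred_eq, Set.mem_univ, iff_true]
    rw [← volume_real_cube hL.le z.1, Measure.real, ENNReal.ofReal_toReal (volume_cube_ne_top _ _)]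
  rw [h', Set.finite_univ_iff] at h
  exact Set.finite_coe_iff.1 h

/-- A bounded set is tiled by the cubes it contains, up to a neighbourhood of its frontier. -/
lemma exists_tiling {L : ℝ} (hL : 0 < L) {V : Set (Space d)} (hV : Bornology.IsBounded V) :
    ∃ T : Finset (Fin d → ℤ), (⋃ z ∈ T, cube L z) ⊆ V ∧
      volume.real (V \ ⋃ z ∈ T, cube L z)
        ≤ (volume {x | Metric.infDist x (frontier V) ≤ √(d * L ^ 2) + 1}).toReal := by
  have hfin := finite_cube_subset hL (hV.measure_lt_top (μ := volume)).ne
  refine ⟨hfin.toFinset, by simp, ?_⟩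
  rcases Set.eq_empty_or_nonempty (V \ ⋃ z ∈ hfin.toFinset, cube L z) with h | ⟨x₀, hx₀⟩
  · rw [h]; simp
  have key : ∀ x ∈ V \ ⋃ z ∈ hfin.toFinset, cube L z,
      ∃ p ∈ frontier V, dist x p ≤ √(d * L ^ 2) := fun x hx => by
    set z : Fin d → ℤ := fun i => ⌊x i / L⌋ with hz
    have hxz : x ∈ cube L z := (mem_cube_iff hL _ _).2 fun i => rfl
    have hnot : ¬ cube L z ⊆ V := fun hsub =>
      hx.2 (Set.mem_iUnion₂.2 ⟨z, hfin.mem_toFinset.2 hsub, hxz⟩)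
    by_contra! hcon
    have hdis : ∀ y ∈ cube L z, y ∉ frontier V := fun y hy hyf =>
      (hcon y hyf).not_ge (dist_le_of_mem_cube hxz hy)
    refine hnot ((IsPreconnected.subset_left_of_subset_union (u := interior V) (v := (closure V)ᶜ)
      isOpen_interior isClosed_closure.isOpen_compl ?_ ?_ ?_
      (convex_box _ _).isPreconnected).trans interior_subset)
    · exact Set.disjoint_left.2 fun y hy hy' => hy' (subset_closure (interior_subset hy))
    · intro y hy
      by_cases hyc : y ∈ closure V
      · exact Or.inl (by_contra fun hyi => hdis y hy ⟨hyc, hyi⟩)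
      · exact Or.inr hyc
    · exact ⟨x, hxz, by_contra fun hxi => hdis x hxz ⟨subset_closure hx.1, hxi⟩⟩
  have hne : (frontier V).Nonempty := let ⟨p, hp, _⟩ := key x₀ hx₀; ⟨p, hp⟩
  have hfb : Bornology.IsBounded (frontier V) :=
    (Metric.isBounded_closure_of_isBounded hV).subset frontier_subset_closure
  refine measureReal_mono (fun x hx => ?_) ?_
  · obtain ⟨p, hp, hpx⟩ := key x hx
    exact (Metric.infDist_le_dist_of_mem hp).trans (hpx.trans (by linarith))
  · have hb : Bornology.IsBounded {x | Metric.infDist x (frontier V) ≤ √(d * L ^ 2) + 1} := by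
      refine (hfb.thickening (δ := √(d * L ^ 2) + 2)).subset fun x hx => ?_
      rw [Metric.mem_thickening_iff]
      obtain ⟨p, hp, h⟩ := (Metric.infDist_lt_iff hne).1
        (lt_of_le_of_lt hx (show √(d * L ^ 2) + 1 < √(d * L ^ 2) + 2 by linarith))
      exact ⟨p, hp, h⟩
    exact hb.measure_lt_top.ne

/-- Double integrals of a convolution kernel over a set, in terms of the overlaps of the set with
its translates. -/
lemma integral_integral_sub_eq {A : Set (Space d)} (hA : MeasurableSet A) (hA' : volume A ≠ ∞)
    {h : Space d → ℝ} (hh : Integrable h) :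
    ∫ x in A, ∫ y in A, h (y - x) = ∫ u, h u * volume.real {x | x ∈ A ∧ x + u ∈ A} := by
  have e1 : ∀ x, ∫ y in A, h (y - x) = ∫ u, A.indicator (fun _ => (1 : ℝ)) (x + u) * h u := fun x => by
    rw [← integral_indicator hA, ← integral_add_left_eq_self _ x]
    refine integral_congr_ae (ae_of_all _ fun u => ?_)
    by_cases hu : x + u ∈ A <;> simp [hu]
  simp only [e1]
  have hi : Integrable (fun p : Space d × Space d => A.indicator (fun _ => (1 : ℝ)) (p.1 + p.2) * h p.2)
      ((volume.restrict A).prod volume) := by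
    have : IsFiniteMeasure (volume.restrict A) := ⟨by simpa using hA'.lt_top⟩
    have h2 : Integrable (fun p : Space d × Space d => h p.2) ((volume.restrict A).prod volume) :=
      hh.comp_snd _
    refine h2.bdd_mul (c := 1) ?_ (ae_of_all _ fun p => ?_)
    · exact ((measurable_const.indicator hA).comp
        (measurable_fst.add measurable_snd)).aestronglyMeasurable
    · by_cases hp : p.1 + p.2 ∈ A <;> simp [hp]
  rw [integral_integral_swap hi]
  refine integral_congr_ae (ae_of_all _ fun u => ?_)
  simp only
  rw [integral_mul_const, mul_comm]
  congr 1
  have hB : MeasurableSet {x | x + u ∈ A} := hA.preimage (measurable_add_const u)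
  have e : (fun x => A.indicator (fun _ => (1 : ℝ)) (x + u))
      = {x | x + u ∈ A}.indicator fun _ => (1 : ℝ) := by
    ext x; by_cases hx : x + u ∈ A <;> simp [hx]
  rw [e, integral_indicator_const _ hB, smul_eq_mul, mul_one, measureReal_restrict_apply hB]
  congr 1
  ext x
  simp [and_comm]

lemma volume_cube_inter {L : ℝ} (z : Fin d → ℤ) (u : Space d) :
    volume.real {x | x ∈ cube L z ∧ x + u ∈ cube L z} = ∏ i, max (L - |u i|) 0 := by
  have e : {x | x ∈ cube L z ∧ x + u ∈ cube L z}
      = box (fun i => max (z i * L) (z i * L - u i))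
        (fun i => min ((z i + 1) * L) ((z i + 1) * L - u i)) := by
    ext x
    simp only [cube, box, Set.mem_ofPred_eq, Set.mem_Ico, PiLp.add_apply, ← forall_and, max_le_iff,
      lt_min_iff]
    refine forall_congr' fun i => ?_
    constructor
    · rintro ⟨⟨h1, h2⟩, h3, h4⟩
      exact ⟨⟨h1, by linarith⟩, h2, by linarith⟩
    · rintro ⟨⟨h1, h2⟩, h3, h4⟩
      exact ⟨⟨h1, h3⟩, by linarith, by linarith⟩
  rw [e, volume_real_box]
  refine Finset.prod_congr rfl fun i _ => ?_
  congr 1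
  rcases le_total 0 (u i) with h | h
  · rw [min_eq_right (by linarith), max_eq_left (by linarith), abs_of_nonneg h]; ring
  · rw [min_eq_left (by linarith), max_eq_right (by linarith), abs_of_nonpos h]; ring

/-- The double integral of `h (y - x)` over a cube of side `L`. -/
def cubeEnergy (h : Space d → ℝ) (L : ℝ) : ℝ := ∫ u, h u * ∏ i, max (L - |u i|) 0

lemma integral_cube_eq {L : ℝ} (z : Fin d → ℤ) {h : Space d → ℝ} (hh : Integrable h) :
    ∫ x in cube L z, ∫ y in cube L z, h (y - x) = cubeEnergy h L := by
  rw [integral_integral_sub_eq (measurableSet_cube L z) (volume_cube_ne_top L z) hh]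
  simp only [volume_cube_inter, cubeEnergy]

lemma tendsto_cubeEnergy_div {h : Space d → ℝ} (hh : Integrable h) :
    Tendsto (fun L => cubeEnergy h L / L ^ d) atTop (𝓝 (∫ u, h u)) := by
  have e : ∀ᶠ L : ℝ in atTop, ∫ u : Space d, h u * ∏ i, max (1 - |u i| / L) 0
      = cubeEnergy h L / L ^ d := by
    filter_upwards [eventually_gt_atTop 0] with L hL
    rw [cubeEnergy, ← integral_div]
    refine integral_congr_ae (ae_of_all _ fun u => ?_)
    simp only
    rw [mul_div_assoc]
    congr 1
    have : L ^ d = ∏ _i : Fin d, L := by simp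
    rw [this, ← Finset.prod_div_distrib]
    refine Finset.prod_congr rfl fun i _ => ?_
    rw [← max_div_div_right hL.le, zero_div, sub_div, div_self hL.ne']
  refine Tendsto.congr' e ?_
  have hb : ∀ L : ℝ, 0 < L → ∀ t : ℝ, 0 ≤ max (1 - |t| / L) 0 ∧ max (1 - |t| / L) 0 ≤ 1 :=
    fun L hL t => ⟨le_max_right _ _, max_le (by have : 0 ≤ |t| / L := by positivity
                                                linarith) zero_le_one⟩
  refine tendsto_integral_filter_of_dominated_convergence (fun u => |h u|) ?_ ?_ hh.abs ?_
  · exact Eventually.of_forall fun L => hh.aestronglyMeasurable.mul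
      (Continuous.aestronglyMeasurable (by fun_prop))
  · filter_upwards [eventually_gt_atTop 0] with L hL
    refine ae_of_all _ fun u => ?_
    rw [norm_mul, Real.norm_eq_abs, Real.norm_eq_abs, Finset.abs_prod]
    refine mul_le_of_le_one_right (abs_nonneg _) (Finset.prod_le_one (fun i _ => abs_nonneg _)
      fun i _ => ?_)
    rw [abs_of_nonneg (hb L hL _).1]
    exact (hb L hL _).2
  · refine ae_of_all _ fun u => ?_
    have : Tendsto (fun L : ℝ => ∏ i : Fin d, max (1 - |u i| / L) 0) atTop (𝓝 (∏ _i : Fin d, (1 : ℝ))) := by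
      refine tendsto_finsetProd _ fun i _ => ?_
      have h1 : Tendsto (fun L : ℝ => 1 - |u i| / L) atTop (𝓝 (1 - 0)) :=
        tendsto_const_nhds.sub (tendsto_const_nhds.div_atTop tendsto_id)
      simpa using h1.max (tendsto_const_nhds (x := (0 : ℝ)))
    simpa using this.const_mul (h u)

end Boxes

lemma norm_exp_I_mul_sub_taylor_le {y : ℝ} (hy : |y| ≤ 1) :
    ‖Complex.exp (Complex.I * y) - (1 + Complex.I * y - y ^ 2 / 2)‖ ≤ |y| ^ 3 := by
  have hn : ‖Complex.I * (y : ℂ)‖ = |y| := by simp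
  have h := Complex.exp_bound (x := Complex.I * y) (hn.trans_le hy) (n := 3) (by norm_num)
  rw [hn] at h
  have e : ∑ m ∈ Finset.range 3, (Complex.I * (y : ℂ)) ^ m / (m.factorial : ℂ)
      = 1 + Complex.I * y - y ^ 2 / 2 := by
    simp [Finset.sum_range_succ, mul_pow]; ring
  rw [e] at h
  refine h.trans (mul_le_of_le_one_right (by positivity) ?_)
  norm_num [Nat.factorial]

section Char

variable {Ω : Type*} [MeasurableSpace Ω] {P : Measure Ω} [IsProbabilityMeasure P]

/-- The characteristic function of a bounded centred variable near the origin. -/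
lemma norm_integral_exp_sub_le {X : Ω → ℝ} (hX : Measurable X) {B : ℝ} (hB : ∀ ω, |X ω| ≤ B)
    (h0 : ∫ ω, X ω ∂P = 0) {τ : ℝ} (hτ : |τ| * B ≤ 1) :
    ‖∫ ω, Complex.exp (Complex.I * ((τ * X ω : ℝ) : ℂ)) ∂P
        - (Real.exp (-(τ ^ 2 * (∫ ω, X ω ^ 2 ∂P) / 2)) : ℂ)‖ ≤ 2 * (|τ| * B) ^ 3 := by
  have hB0 : 0 ≤ B := by
    obtain ⟨ω⟩ := P.nonempty_of_neZero
    exact (abs_nonneg _).trans (hB ω)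
  have hy : ∀ ω, |τ * X ω| ≤ |τ| * B := fun ω => by
    rw [abs_mul]; exact mul_le_mul_of_nonneg_left (hB ω) (abs_nonneg _)
  have hXi : Integrable X P := (memLp_top_of_bound hX.aestronglyMeasurable B
    (ae_of_all _ hB)).integrable le_top
  have hX2 : Integrable (fun ω => X ω ^ 2) P := (MemLp.of_bound hX.aestronglyMeasurable B
    (ae_of_all _ hB) : MemLp X 2 P).integrable_sq
  have hei : Integrable (fun ω => Complex.exp (Complex.I * ((τ * X ω : ℝ) : ℂ))) P :=
    Integrable.of_bound (C := 1) (by fun_prop) (ae_of_all _ fun ω => by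
      rw [Complex.norm_exp_I_mul_ofReal])
  set v := ∫ ω, X ω ^ 2 ∂P with hv
  have hv0 : 0 ≤ v := integral_nonneg fun ω => sq_nonneg _
  have hvB : v ≤ B ^ 2 := by
    have : v ≤ ∫ _, B ^ 2 ∂P := integral_mono hX2 (integrable_const _) fun ω => by
      have := hB ω
      rw [← sq_abs]
      simp only
      gcongr
    simpa using this
  have h1 : ‖∫ ω, Complex.exp (Complex.I * ((τ * X ω : ℝ) : ℂ)) ∂P - (1 - τ ^ 2 * v / 2 : ℝ)‖
      ≤ (|τ| * B) ^ 3 := by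
    have hti : Integrable (fun ω => ((1 - τ ^ 2 * X ω ^ 2 / 2 : ℝ) : ℂ)
        + Complex.I * ((τ * X ω : ℝ) : ℂ)) P :=
      ((integrable_const 1).sub ((hX2.const_mul _).div_const _)).ofReal.add
        ((hXi.const_mul τ).ofReal.const_mul _)
    have e : ((1 - τ ^ 2 * v / 2 : ℝ) : ℂ) = ∫ ω, (((1 - τ ^ 2 * X ω ^ 2 / 2 : ℝ) : ℂ)
        + Complex.I * ((τ * X ω : ℝ) : ℂ)) ∂P := by
      have i1 : Integrable (fun ω => ((1 - τ ^ 2 * X ω ^ 2 / 2 : ℝ) : ℂ)) P :=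
        ((integrable_const 1).sub ((hX2.const_mul _).div_const _)).ofReal
      have i2 : Integrable (fun ω => Complex.I * ((τ * X ω : ℝ) : ℂ)) P :=
        (hXi.const_mul τ).ofReal.const_mul _
      rw [integral_add i1 i2,
        integral_const_mul, integral_complex_ofReal, integral_complex_ofReal, integral_const_mul, h0,
        integral_sub (integrable_const _) ((hX2.const_mul _).div_const _), integral_div,
        integral_const_mul]
      simp [hv]
    rw [e, ← integral_sub hei hti]
    refine (norm_integral_le_of_norm_le_const (C := (|τ| * B) ^ 3) (ae_of_all _ fun ω => ?_)).trans
      (by simp)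
    have h := norm_exp_I_mul_sub_taylor_le ((hy ω).trans hτ)
    have h2 : |τ * X ω| ^ 3 ≤ (|τ| * B) ^ 3 := by gcongr; exact hy ω
    refine le_trans (le_of_eq ?_) (h.trans h2)
    congr 2
    push_cast
    ring
  have h2 : ‖((1 - τ ^ 2 * v / 2 : ℝ) : ℂ) - (Real.exp (-(τ ^ 2 * v / 2)) : ℂ)‖ ≤ (|τ| * B) ^ 3 := by
    have hq : |τ| ^ 2 * v ≤ (|τ| * B) ^ 2 := by rw [mul_pow]; gcongr
    have hq1 : (|τ| * B) ^ 2 ≤ 1 := pow_le_one₀ (by positivity) hτ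
    rw [sq_abs] at hq
    have hpos : 0 ≤ τ ^ 2 * v := by positivity
    have h := Real.norm_exp_sub_one_sub_id_le (x := -(τ ^ 2 * v / 2)) (by
      rw [Real.norm_eq_abs, abs_neg, abs_of_nonneg (by positivity)]; linarith)
    rw [← Complex.ofReal_sub, Complex.norm_real, norm_sub_rev]
    refine le_trans (le_of_eq ?_) (h.trans ?_)
    · congr 1; ring
    · rw [Real.norm_eq_abs, sq_abs, neg_sq]
      have h3 : (τ ^ 2 * v / 2) ^ 2 ≤ (|τ| * B) ^ 2 * (|τ| * B) ^ 2 := by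
        have : τ ^ 2 * v / 2 ≤ (|τ| * B) ^ 2 := by linarith
        rw [← sq]; gcongr
      have h4 : (|τ| * B) ^ 2 * (|τ| * B) ^ 2 ≤ (|τ| * B) ^ 3 := by
        rw [← pow_add]; exact pow_le_pow_of_le_one (by positivity) hτ (by norm_num)
      exact h3.trans h4
  calc _ ≤ _ := norm_sub_le_norm_sub_add_norm_sub _ ((1 - τ ^ 2 * v / 2 : ℝ) : ℂ) _
    _ ≤ _ := by linarith

lemma norm_integral_exp_sub_le_sqrt {X Y : Ω → ℝ} (hX : Measurable X) (hY : Measurable Y)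
    (hXY : MemLp (fun ω => X ω - Y ω) 2 P) (τ : ℝ) :
    ‖∫ ω, Complex.exp (Complex.I * ((τ * X ω : ℝ) : ℂ)) ∂P
        - ∫ ω, Complex.exp (Complex.I * ((τ * Y ω : ℝ) : ℂ)) ∂P‖
      ≤ |τ| * √(∫ ω, (X ω - Y ω) ^ 2 ∂P) := by
  have hei : ∀ {U : Ω → ℝ}, Measurable U →
      Integrable (fun ω => Complex.exp (Complex.I * ((τ * U ω : ℝ) : ℂ))) P := fun hU =>
    Integrable.of_bound (C := 1) (by fun_prop) (ae_of_all _ fun ω => by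
      rw [Complex.norm_exp_I_mul_ofReal])
  rw [← integral_sub (hei hX) (hei hY)]
  have hi := (hXY.integrable one_le_two).abs
  refine (norm_integral_le_of_norm_le (hi.const_mul |τ|) (ae_of_all _ fun ω => ?_)).trans ?_
  · refine (norm_exp_I_mul_sub_le _ _).trans (le_of_eq ?_)
    rw [← mul_sub, abs_mul]
  · rw [integral_const_mul]
    gcongr
    have h := abs_integral_mul_le_sqrt hXY.abs (memLp_const (1 : ℝ))
    simp only [mul_one, one_pow, integral_const, probReal_univ, smul_eq_mul, Real.sqrt_one,
      Pi.abs_apply, sq_abs] at h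
    exact (le_abs_self _).trans h

end Char

section Mixing

variable {Ω : Type*} [MeasurableSpace Ω] {d : ℕ} {P : Measure Ω} {Z : Space d → Ω → ℝ}
  {κ : Space d → ℝ}

/-- The characteristic function at `τ` of the integral of `φ (Z x)` over `A`. -/
def charInt (P : Measure Ω) (Z : Space d → Ω → ℝ) (φ : ℝ → ℝ) (τ : ℝ) (A : Set (Space d)) : ℂ :=
  ∫ ω, Complex.exp (Complex.I * ((τ * ∫ x in A, φ (Z x ω) : ℝ) : ℂ)) ∂P

lemma IsMixingField.integrable_kernel (hZ : IsMixingField P Z κ) : Integrable κ :=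
  (hZ.kernel_integrable 1 one_pos).congr (ae_of_all _ fun _ => Real.rpow_one _)

lemma IsMixingField.integral_cube_compl_le (hZ : IsMixingField P Z κ) {L : ℝ} (hL : 0 ≤ L)
    (z : Fin d → ℤ) {U : Set (Space d)} (hU : Disjoint (cube L z) U) :
    ∫ x in cube L z, ∫ y in U, κ (x - y) ≤ L ^ d * (∫ x, κ x) - cubeEnergy κ L := by
  have hκ := hZ.integrable_kernel
  have hκ0 : ∀ x, 0 ≤ κ x := fun x => (hZ.kernel_pos x).le
  have hsymm : ∀ x, ∫ y in U, κ (x - y) = ∫ y in U, κ (y - x) := fun x =>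
    integral_congr_ae (ae_of_all _ fun y => by simp only; rw [← neg_sub, hZ.kernel_neg])
  simp only [hsymm]
  have : IsFiniteMeasure (volume.restrict (cube L z)) :=
    ⟨by simpa using (volume_cube_ne_top L z).lt_top⟩
  have hi : Integrable (fun x => ∫ y in cube L z, κ (y - x)) (volume.restrict (cube L z)) := by
    have hb : Integrable (fun p : Space d × Space d => κ (p.2 - p.1))
        ((volume.restrict (cube L z)).prod (volume.restrict (cube L z))) :=
      Integrable.of_bound (C := 1)
        (hZ.kernel_continuous.comp (by fun_prop)).aestronglyMeasurable
        (ae_of_all _ fun p => by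
          rw [Real.norm_eq_abs, abs_of_nonneg (hκ0 _)]; exact hZ.kernel_le_one _)
    exact hb.integral_prod_left
  have hle : ∀ x, ∫ y in U, κ (y - x) ≤ (∫ y, κ y) - ∫ y in cube L z, κ (y - x) := fun x => by
    have h1 : Integrable fun y => κ (y - x) := hκ.comp_sub_right x
    rw [← integral_sub_right_eq_self κ x, ← integral_add_compl (measurableSet_cube L z) h1,
      add_sub_cancel_left]
    exact setIntegral_mono_set h1.integrableOn (ae_of_all _ fun y => hκ0 _)
      (Disjoint.subset_compl_left hU).eventuallyLE
  have h := integral_mono_of_nonneg (μ := volume.restrict (cube L z))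
    (ae_of_all _ fun x => integral_nonneg fun y => hκ0 (y - x)) ((integrable_const _).sub hi)
    (ae_of_all _ hle)
  refine h.trans (le_of_eq ?_)
  simp only [Pi.sub_apply]
  rw [integral_sub (integrable_const _) hi, integral_cube_eq z hκ]
  simp [volume_real_cube hL]

lemma IsMixingField.integrableOn_bdd (hZ : IsMixingField P Z κ) {φ : ℝ → ℝ} (hφ : Measurable φ)
    {M : ℝ} (hM : ∀ z, |φ z| ≤ M) {A : Set (Space d)} (hA : volume A ≠ ∞) (ω : Ω) :
    IntegrableOn (fun x => φ (Z x ω)) A := by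
  have : IsFiniteMeasure (volume.restrict A) := ⟨by simpa using hA.lt_top⟩
  exact Integrable.of_bound (C := M)
    (hφ.comp (hZ.measurable.comp measurable_prodMk_right)).aestronglyMeasurable
    (ae_of_all _ fun x => hM _)

section Cubes

variable [IsProbabilityMeasure P] {φ : ℝ → ℝ} {M : ℝ}

lemma memLp_comp_of_bdd {Y : Ω → ℝ} (hY : Measurable Y) (hφ : Measurable φ) (hM : ∀ z, |φ z| ≤ M)
    (p : ℝ≥0∞) : MemLp (fun ω => φ (Y ω)) p P :=
  MemLp.of_bound (hφ.comp hY).aestronglyMeasurable M (ae_of_all _ fun _ => hM _)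

lemma IsMixingField.integrable_covFn_of_bdd (hZ : IsMixingField P Z κ) (hφ : Measurable φ)
    (hM : ∀ z, |φ z| ≤ M) : Integrable (covFn P Z φ) := by
  refine hZ.integrable_covFn hφ one_pos (Integrable.of_bound (C := M ^ ((2 : ℝ) + 1))
    ((hφ.comp (hZ.measurable_apply 0)).abs.pow_const _).aestronglyMeasurable
    (ae_of_all _ fun ω => ?_))
  rw [Real.norm_eq_abs, abs_of_nonneg (by positivity)]
  exact Real.rpow_le_rpow (abs_nonneg _) (hM _) (by norm_num)

lemma norm_charInt_le (τ : ℝ) (A : Set (Space d)) : ‖charInt P Z φ τ A‖ ≤ 1 := by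
  refine (norm_integral_le_of_norm_le_const (C := 1) (ae_of_all _ fun ω => ?_)).trans (by simp)
  rw [Complex.norm_exp_I_mul_ofReal]

lemma IsMixingField.integral_setIntegral (hZ : IsMixingField P Z κ) (hφ : Measurable φ)
    (hM : ∀ z, |φ z| ≤ M) (h0 : ∫ ω, φ (Z 0 ω) ∂P = 0) {A : Set (Space d)} (hA : volume A ≠ ∞) :
    ∫ ω, (∫ x in A, φ (Z x ω)) ∂P = 0 := by
  have : IsFiniteMeasure (volume.restrict A) := ⟨by simpa using hA.lt_top⟩
  have hi : Integrable (fun q : Ω × Space d => φ (Z q.2 q.1)) (P.prod (volume.restrict A)) :=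
    Integrable.of_bound (C := M)
      (hφ.comp (hZ.measurable.comp measurable_swap)).aestronglyMeasurable
      (ae_of_all _ fun q => hM _)
  rw [integral_integral_swap hi]
  simp only [hZ.integral_comp hφ, h0, integral_zero]

lemma IsMixingField.norm_charInt_cube_sub_le (hZ : IsMixingField P Z κ) (hφ : Measurable φ)
    (hM : ∀ z, |φ z| ≤ M) (h0 : ∫ ω, φ (Z 0 ω) ∂P = 0) {L : ℝ} (hL : 0 ≤ L) (z : Fin d → ℤ)
    {τ : ℝ} (hτ : |τ| * (M * L ^ d) ≤ 1) :
    ‖charInt P Z φ τ (cube L z)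
        - (Real.exp (-(τ ^ 2 * cubeEnergy (covFn P Z φ) L / 2)) : ℂ)‖
      ≤ 2 * (|τ| * (M * L ^ d)) ^ 3 := by
  have hA := volume_cube_ne_top L z
  have h := norm_integral_exp_sub_le (P := P) (X := fun ω => ∫ x in cube L z, φ (Z x ω))
    (hZ.stronglyMeasurable_integral hφ _).measurable (B := M * L ^ d) (fun ω => ?_)
    (hZ.integral_setIntegral hφ hM h0 hA) hτ
  · rwa [hZ.integral_sq_setIntegral hφ (memLp_comp_of_bdd (hZ.measurable_apply 0) hφ hM 2) h0 hA,
      integral_cube_eq z (hZ.integrable_covFn_of_bdd hφ hM)] at h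
  · have := norm_setIntegral_le_of_norm_le_const (μ := volume) (f := fun x => φ (Z x ω)) (C := M)
      hA.lt_top (fun x _ => hM _)
    rwa [volume_real_cube hL] at this

lemma volume_biUnion_cube_ne_top (L : ℝ) (T : Finset (Fin d → ℤ)) :
    volume (⋃ z ∈ T, cube L z) ≠ ∞ :=
  ((measure_biUnion_lt_top T.finite_toSet fun z _ => (volume_cube_ne_top L z).lt_top)).ne

/-- The characteristic function of the integral over finitely many cubes is close to the Gaussian
one. -/
lemma IsMixingField.norm_charInt_cubes_sub_le (hZ : IsMixingField P Z κ) (hφ : Continuous φ)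
    (hM : ∀ z, |φ z| ≤ M) (h0 : ∫ ω, φ (Z 0 ω) ∂P = 0) {L : ℝ} (hL : 0 < L)
    {τ : ℝ} (hτ : |τ| * (M * L ^ d) ≤ 1) (T : Finset (Fin d → ℤ)) :
    ‖charInt P Z φ τ (⋃ z ∈ T, cube L z)
        - (Real.exp (-(T.card * (τ ^ 2 * cubeEnergy (covFn P Z φ) L / 2))) : ℂ)‖
      ≤ T.card * (4 * τ ^ 2 * M ^ 2 * (L ^ d * (∫ x, κ x) - cubeEnergy κ L)
        + 2 * (|τ| * (M * L ^ d)) ^ 3) := by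
  classical
  set s : ℝ := τ ^ 2 * cubeEnergy (covFn P Z φ) L / 2 with hs
  have hs0 : 0 ≤ s := by
    rw [hs, ← integral_cube_eq 0 (hZ.integrable_covFn_of_bdd hφ.measurable hM),
      ← hZ.integral_sq_setIntegral hφ.measurable
        (memLp_comp_of_bdd (hZ.measurable_apply 0) hφ.measurable hM 2) h0 (volume_cube_ne_top L 0)]
    have : 0 ≤ ∫ ω, (∫ x in cube L 0, φ (Z x ω)) ^ 2 ∂P := integral_nonneg fun ω => sq_nonneg _
    positivity
  induction T using Finset.induction_on with
  | empty => simp [charInt]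
  | insert z T hzT ih =>
    set U : Set (Space d) := ⋃ z ∈ T, cube L z with hU
    have hdisj : Disjoint (cube L z) U := by
      rw [hU, Set.disjoint_iUnion₂_right]
      exact fun z' hz' => disjoint_cube hL fun h => hzT (h ▸ hz')
    have hUm : MeasurableSet U := Finset.measurableSet_biUnion _ fun z _ => measurableSet_cube L z
    have hUt : volume U ≠ ∞ := volume_biUnion_cube_ne_top L T
    have hQt := volume_cube_ne_top L z
    have hsplit : charInt P Z φ τ (⋃ w ∈ insert z T, cube L w)
        = ∫ ω, Complex.exp (Complex.I * ((τ * ∫ x in cube L z, φ (Z x ω) : ℝ) : ℂ)) *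
          Complex.exp (Complex.I * ((τ * ∫ x in U, φ (Z x ω) : ℝ) : ℂ)) ∂P := by
      rw [Finset.set_biUnion_insert]
      refine integral_congr_ae (ae_of_all _ fun ω => ?_)
      simp only
      rw [← Complex.exp_add, ← hU, setIntegral_union hdisj hUm
        (hZ.integrableOn_bdd hφ.measurable hM hQt ω) (hZ.integrableOn_bdd hφ.measurable hM hUt ω)]
      congr 1
      push_cast
      ring
    have h1 := hZ.norm_cov_exp_le hφ hM hQt hUt τ
    rw [← hsplit] at h1
    change ‖_ - charInt P Z φ τ (cube L z) * charInt P Z φ τ U‖ ≤ _ at h1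
    have h2 := hZ.norm_charInt_cube_sub_le hφ.measurable hM h0 hL.le z hτ
    rw [← hs] at h2
    have h3 : 4 * τ ^ 2 * M ^ 2 * ∫ x in cube L z, ∫ y in U, κ (x - y)
        ≤ 4 * τ ^ 2 * M ^ 2 * (L ^ d * (∫ x, κ x) - cubeEnergy κ L) :=
      mul_le_mul_of_nonneg_left (hZ.integral_cube_compl_le hL.le z hdisj) (by positivity)
    set a := charInt P Z φ τ (cube L z)
    set b := charInt P Z φ τ U
    have hb : ‖b‖ ≤ 1 := norm_charInt_le τ U
    have he : ‖(Real.exp (-s) : ℂ)‖ ≤ 1 := by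
      rw [Complex.norm_real, Real.norm_eq_abs, abs_of_pos (Real.exp_pos _)]
      exact Real.exp_le_one_iff.2 (by linarith)
    have e : (Real.exp (-((insert z T).card * s)) : ℂ)
        = (Real.exp (-s) : ℂ) * (Real.exp (-(T.card * s)) : ℂ) := by
      rw [Finset.card_insert_of_notMem hzT, ← Complex.ofReal_mul, ← Real.exp_add]
      congr 2; push_cast; ring
    have h4 : ‖a * b - (Real.exp (-((insert z T).card * s)) : ℂ)‖
        ≤ ‖a - (Real.exp (-s) : ℂ)‖ + ‖b - (Real.exp (-(T.card * s)) : ℂ)‖ := by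
      rw [e, show ∀ p q : ℂ, a * b - p * q = (a - p) * b + p * (b - q) from fun p q => by ring]
      refine (norm_add_le _ _).trans ?_
      rw [norm_mul, norm_mul]
      gcongr
      · exact mul_le_of_le_one_right (norm_nonneg _) hb
      · exact mul_le_of_le_one_left (norm_nonneg _) he
    have h5 := norm_sub_le_norm_sub_add_norm_sub (charInt P Z φ τ (⋃ w ∈ insert z T, cube L w))
      (a * b) (Real.exp (-((insert z T).card * s)) : ℂ)
    have e2 : (((insert z T).card : ℕ) : ℝ) = T.card + 1 := by
      rw [Finset.card_insert_of_notMem hzT]; push_cast; ring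
    rw [e2] at h5 h4 ⊢
    refine h5.trans ?_
    linarith

end Cubes

end Mixing

section Mixing

variable {Ω : Type*} [MeasurableSpace Ω] {d : ℕ} {P : Measure Ω} {Z : Space d → Ω → ℝ}
  {κ : Space d → ℝ} [IsProbabilityMeasure P] {φ : ℝ → ℝ} {M : ℝ} {V : ℕ → Set (Space d)}

lemma IsMixingField.norm_charInt_sub_le (hZ : IsMixingField P Z κ) (hφ : Measurable φ)
    (hM : ∀ z, |φ z| ≤ M) (h0 : ∫ ω, φ (Z 0 ω) ∂P = 0) {U A : Set (Space d)}
    (hU : MeasurableSet U) (hUA : U ⊆ A) (hA : volume A ≠ ∞) (τ : ℝ) :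
    ‖charInt P Z φ τ A - charInt P Z φ τ U‖
      ≤ |τ| * √(volume.real (A \ U) * ∫ x, |covFn P Z φ x|) := by
  have hUt : volume U ≠ ∞ := measure_ne_top_of_subset hUA hA
  have hDt : volume (A \ U) ≠ ∞ := measure_ne_top_of_subset Set.sdiff_subset hA
  have hφ2 := memLp_comp_of_bdd (P := P) (hZ.measurable_apply 0) hφ hM 2
  have e : ∀ ω, (∫ x in A, φ (Z x ω)) - ∫ x in U, φ (Z x ω) = ∫ x in A \ U, φ (Z x ω) :=
    fun ω => (setIntegral_sdiff hU (hZ.integrableOn_bdd hφ hM hA ω) hUA).symm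
  have h := norm_integral_exp_sub_le_sqrt (P := P)
    (hZ.stronglyMeasurable_integral hφ A).measurable
    (hZ.stronglyMeasurable_integral hφ U).measurable
    (by simpa only [e] using hZ.memLp_setIntegral hφ hφ2 hDt) τ
  simp only [e] at h
  refine h.trans ?_
  gcongr
  exact hZ.integral_sq_setIntegral_le hφ hφ2 h0 hDt (hZ.integrable_covFn_of_bdd hφ hM)

lemma volume_real_biUnion_cube {L : ℝ} (hL : 0 < L) (T : Finset (Fin d → ℤ)) :
    volume.real (⋃ z ∈ T, cube L z) = T.card * L ^ d := by
  rw [measureReal_biUnion_finset (fun z _ z' _ h => disjoint_cube hL h)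
    (fun z _ => measurableSet_cube L z) fun z _ => volume_cube_ne_top L z]
  simp [volume_real_cube hL.le]

/-- For a fixed cube size, the characteristic functions along a Van Hove sequence are eventually
bounded by a sequence converging to an error which vanishes as the cube size grows. -/
lemma IsMixingField.exists_bound_charInt (hZ : IsMixingField P Z κ) (hφ : Continuous φ)
    (hM : ∀ z, |φ z| ≤ M) (h0 : ∫ ω, φ (Z 0 ω) ∂P = 0) (hV : IsVanHove V) (t : ℝ) {L : ℝ}
    (hL : 0 < L) :
    ∃ b : ℕ → ℝ, (∀ᶠ n in atTop, ‖charInt P Z φ (t / √(volume (V n)).toReal) (V n)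
        - (Real.exp (-(t ^ 2 * (∫ x, covFn P Z φ x) / 2)) : ℂ)‖ ≤ b n) ∧
      Tendsto b atTop (𝓝 (4 * t ^ 2 * M ^ 2 * ((∫ x, κ x) - cubeEnergy κ L / L ^ d)
        + |Real.exp (-(t ^ 2 * (cubeEnergy (covFn P Z φ) L / L ^ d) / 2))
          - Real.exp (-(t ^ 2 * (∫ x, covFn P Z φ x) / 2))|)) := by
  obtain ⟨hbdd, hmeas, -, -, htop, hfr⟩ := hV
  choose T hTV hTvol using fun n => exists_tiling hL (hbdd n)
  set r : ℝ := √(d * L ^ 2) + 1 with hr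
  set ρ : ℕ → ℝ := fun n => (volume {x | Metric.infDist x (frontier (V n)) ≤ r}).toReal
    / (volume (V n)).toReal with hρdef
  have hρ : Tendsto ρ atTop (𝓝 0) := hfr r (by positivity)
  set s : ℕ → ℝ := fun n => √(volume (V n)).toReal with hsdef
  have hs : Tendsto s atTop atTop := Real.tendsto_sqrt_atTop.comp htop
  set p : ℕ → ℝ := fun n => (T n).card * L ^ d / (volume (V n)).toReal with hpdef
  have hM0 : 0 ≤ M := (abs_nonneg _).trans (hM 0)
  have hVt : ∀ n, volume (V n) ≠ ∞ := fun n => (hbdd n).measure_lt_top.ne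
  have hUm : ∀ n, MeasurableSet (⋃ z ∈ T n, cube L z) := fun n =>
    Finset.measurableSet_biUnion _ fun z _ => measurableSet_cube L z
  have hsum : ∀ n, (volume (V n)).toReal - (T n).card * L ^ d
      = volume.real (V n \ ⋃ z ∈ T n, cube L z) := fun n => by
    rw [measureReal_sdiff (hTV n) (hUm n) (hVt n),
      volume_real_biUnion_cube hL, measureReal_def]
  have hpos : ∀ᶠ n in atTop, 0 < (volume (V n)).toReal := htop.eventually_gt_atTop 0
  have hp : Tendsto p atTop (𝓝 1) := by
    refine tendsto_of_tendsto_of_tendsto_of_le_of_le' (g := fun n => 1 - ρ n) (h := fun _ => 1)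
      (by simpa using hρ.const_sub 1) tendsto_const_nhds ?_ ?_
    · filter_upwards [hpos] with n hn
      have h1 := hsum n
      have h2 := hTvol n
      rw [← h1] at h2
      simp only [hρdef, hpdef]
      rw [sub_le_iff_le_add, ← add_div, le_div_iff₀ hn]
      linarith
    · filter_upwards [hpos] with n hn
      have h1 := hsum n
      have h2 : 0 ≤ volume.real (V n \ ⋃ z ∈ T n, cube L z) := measureReal_nonneg
      simp only [hpdef]
      rw [div_le_one hn]
      linarith
  set S := ∫ x, |covFn P Z φ x|
  have hS0 : 0 ≤ S := integral_nonneg fun x => abs_nonneg _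
  set w := cubeEnergy (covFn P Z φ) L / L ^ d with hw
  set e := (∫ x, κ x) - cubeEnergy κ L / L ^ d with he
  set g := Real.exp (-(t ^ 2 * (∫ x, covFn P Z φ x) / 2))
  have hLd : L ^ d ≠ 0 := (pow_pos hL d).ne'
  refine ⟨fun n => |t| * √(ρ n * S) + p n * (4 * t ^ 2 * M ^ 2 * e
      + 2 * (|t| * M) ^ 3 * (L ^ d) ^ 2 * (s n)⁻¹)
      + |Real.exp (-(p n * (t ^ 2 * w / 2))) - g|, ?_, ?_⟩
  · have hsmall : Tendsto (fun n => |t| * (M * L ^ d) * (s n)⁻¹) atTop (𝓝 0) := by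
      simpa using hs.inv_tendsto_atTop.const_mul (|t| * (M * L ^ d))
    filter_upwards [hpos, hsmall.eventually_le_const one_pos] with n hn hn1
    have hsn : 0 < s n := Real.sqrt_pos.2 hn
    have hs2 : s n ^ 2 = (volume (V n)).toReal := Real.sq_sqrt hn.le
    have hτa : |t / s n| = |t| / s n := by rw [abs_div, abs_of_pos hsn]
    have hτ : |t / s n| * (M * L ^ d) ≤ 1 := by
      rw [hτa]
      refine le_trans (le_of_eq ?_) hn1
      ring
    have h1 := hZ.norm_charInt_sub_le hφ.measurable hM h0 (hUm n) (hTV n) (hVt n) (t / s n)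
    have h2 := hZ.norm_charInt_cubes_sub_le hφ hM h0 hL hτ (T n)
    have h1' : |t / s n| * √(volume.real (V n \ ⋃ z ∈ T n, cube L z) * S)
        ≤ |t| * √(ρ n * S) := by
      have : √(volume.real (V n \ ⋃ z ∈ T n, cube L z) * S) ≤ s n * √(ρ n * S) := by
        rw [← Real.sqrt_sq hsn.le, ← Real.sqrt_mul (sq_nonneg _)]
        apply Real.sqrt_le_sqrt
        rw [← mul_assoc, hs2]
        gcongr
        simp only [hρdef]
        rw [mul_div_cancel₀ _ hn.ne']
        exact hTvol n
      rw [hτa]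
      calc |t| / s n * √(volume.real (V n \ ⋃ z ∈ T n, cube L z) * S)
          ≤ |t| / s n * (s n * √(ρ n * S)) := by gcongr
        _ = _ := by field_simp
    have h2' : (T n).card * (4 * (t / s n) ^ 2 * M ^ 2 * (L ^ d * (∫ x, κ x) - cubeEnergy κ L)
        + 2 * (|t / s n| * (M * L ^ d)) ^ 3)
        = p n * (4 * t ^ 2 * M ^ 2 * e + 2 * (|t| * M) ^ 3 * (L ^ d) ^ 2 * (s n)⁻¹) := by
      rw [hτa]
      simp only [hpdef, he, ← hs2]
      field_simp
    have h3 : (T n).card * ((t / s n) ^ 2 * cubeEnergy (covFn P Z φ) L / 2)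
        = p n * (t ^ 2 * w / 2) := by
      simp only [hpdef, hw, ← hs2]
      field_simp
    rw [h2', h3] at h2
    have h4 := norm_sub_le_norm_sub_add_norm_sub (charInt P Z φ (t / s n) (V n))
      (charInt P Z φ (t / s n) (⋃ z ∈ T n, cube L z)) (g : ℂ)
    have h5 := norm_sub_le_norm_sub_add_norm_sub
      (charInt P Z φ (t / s n) (⋃ z ∈ T n, cube L z))
      (Real.exp (-(p n * (t ^ 2 * w / 2))) : ℂ) (g : ℂ)
    rw [← Complex.ofReal_sub, Complex.norm_real, Real.norm_eq_abs] at h5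
    linarith
  · have hlim : Tendsto (fun n => |t| * √(ρ n * S) + p n * (4 * t ^ 2 * M ^ 2 * e
        + 2 * (|t| * M) ^ 3 * (L ^ d) ^ 2 * (s n)⁻¹)
        + |Real.exp (-(p n * (t ^ 2 * w / 2))) - g|) atTop
        (𝓝 (|t| * √(0 * S) + 1 * (4 * t ^ 2 * M ^ 2 * e + 2 * (|t| * M) ^ 3 * (L ^ d) ^ 2 * 0)
        + |Real.exp (-(1 * (t ^ 2 * w / 2))) - g|)) := by
      refine ((((Real.continuous_sqrt.tendsto _).comp (hρ.mul_const S)).const_mul _).add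
        (hp.mul ((hs.inv_tendsto_atTop.const_mul _).const_add _))).add ?_
      exact (((Real.continuous_exp.tendsto _).comp (hp.mul_const _).neg).sub_const g).abs
    simpa using hlim

/-- The central limit theorem for bounded continuous functions, in terms of characteristic
functions. -/
lemma IsMixingField.tendsto_charInt_of_bdd (hZ : IsMixingField P Z κ) (hφ : Continuous φ)
    (hM : ∀ z, |φ z| ≤ M) (h0 : ∫ ω, φ (Z 0 ω) ∂P = 0) (hV : IsVanHove V) (t : ℝ) :
    Tendsto (fun n => charInt P Z φ (t / √(volume (V n)).toReal) (V n)) atTop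
      (𝓝 (Real.exp (-(t ^ 2 * (∫ x, covFn P Z φ x) / 2)) : ℂ)) := by
  set g := Real.exp (-(t ^ 2 * (∫ x, covFn P Z φ x) / 2)) with hg
  have hC := hZ.integrable_covFn_of_bdd hφ.measurable hM
  have h1 : Tendsto (fun L => 4 * t ^ 2 * M ^ 2 * ((∫ x, κ x) - cubeEnergy κ L / L ^ d)
      + |Real.exp (-(t ^ 2 * (cubeEnergy (covFn P Z φ) L / L ^ d) / 2)) - g|) atTop
      (𝓝 (4 * t ^ 2 * M ^ 2 * ((∫ x, κ x) - ∫ x, κ x)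
        + |Real.exp (-(t ^ 2 * (∫ x, covFn P Z φ x) / 2)) - g|)) :=
    (((tendsto_cubeEnergy_div hZ.integrable_kernel).const_sub _).const_mul _).add
      ((((Real.continuous_exp.tendsto _).comp
        (((tendsto_cubeEnergy_div hC).const_mul _).div_const _).neg).sub_const g).abs)
  rw [← hg] at h1
  simp only [sub_self, mul_zero, abs_zero, add_zero] at h1
  rw [tendsto_iff_norm_sub_tendsto_zero, Metric.tendsto_nhds]
  intro ε hε
  obtain ⟨L, hLε, hL⟩ := ((h1.eventually_lt_const hε).and (eventually_gt_atTop 0)).exists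
  obtain ⟨b, hb, hbt⟩ := hZ.exists_bound_charInt hφ hM h0 hV t hL
  filter_upwards [hb, hbt.eventually_lt_const hLε] with n hn hn'
  rw [Real.dist_eq, sub_zero, abs_of_nonneg (norm_nonneg _)]
  exact hn.trans_lt hn'

end Mixing

section Mixing

variable {Ω : Type*} [MeasurableSpace Ω] {d : ℕ} {P : Measure Ω} {Z : Space d → Ω → ℝ}
  {κ : Space d → ℝ} [IsProbabilityMeasure P] {G : ℝ → ℝ} {V : ℕ → Set (Space d)}

lemma IsMixingField.ae_integrableOn (hZ : IsMixingField P Z κ) (hG : Measurable G)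
    (hG1 : Integrable (fun ω => G (Z 0 ω)) P) {A : Set (Space d)} (hA : volume A ≠ ∞) :
    ∀ᵐ ω ∂P, IntegrableOn (fun x => G (Z x ω)) A := by
  have : IsFiniteMeasure (volume.restrict A) := ⟨by simpa using hA.lt_top⟩
  have hm : Measurable fun q : Ω × Space d => G (Z q.2 q.1) :=
    hG.comp (hZ.measurable.comp measurable_swap)
  have hi : Integrable (fun q : Ω × Space d => G (Z q.2 q.1)) (P.prod (volume.restrict A)) := by
    rw [integrable_prod_iff' hm.aestronglyMeasurable]
    refine ⟨ae_of_all _ fun x => ?_, ?_⟩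
    · exact memLp_one_iff_integrable.1
        (hZ.memLp_comp hG (memLp_one_iff_integrable.2 hG1) x)
    · have h := hZ.integral_comp (φ := fun z => ‖G z‖) hG.norm
      simp only [h]
      exact integrable_const _
  exact hi.prod_right_ae

lemma IsMixingField.norm_charInt_sub_charInt_le (hZ : IsMixingField P Z κ) (hG : Measurable G)
    (hG2 : MemLp (fun ω => G (Z 0 ω)) 2 P) (hG0 : ∫ ω, G (Z 0 ω) ∂P = 0) {φ : ℝ → ℝ} {M : ℝ}
    (hφ : Measurable φ) (hM : ∀ z, |φ z| ≤ M) (hφ0 : ∫ ω, φ (Z 0 ω) ∂P = 0)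
    (hC : Integrable (covFn P Z fun z => G z - φ z)) {A : Set (Space d)} (hA : volume A ≠ ∞)
    (τ : ℝ) :
    ‖charInt P Z G τ A - charInt P Z φ τ A‖
      ≤ |τ| * √(volume.real A * ∫ x, |covFn P Z (fun z => G z - φ z) x|) := by
  have hφ2 := memLp_comp_of_bdd (P := P) (hZ.measurable_apply 0) hφ hM 2
  have hD2 : MemLp (fun ω => G (Z 0 ω) - φ (Z 0 ω)) 2 P := hG2.sub hφ2
  have hGφ : Measurable fun z => G z - φ z := hG.sub hφ
  have hD0 : ∫ ω, (G (Z 0 ω) - φ (Z 0 ω)) ∂P = 0 := by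
    rw [integral_sub (hG2.integrable one_le_two) (hφ2.integrable one_le_two), hG0, hφ0, sub_zero]
  have e : ∀ᵐ ω ∂P, ∫ x in A, (G (Z x ω) - φ (Z x ω))
      = (∫ x in A, G (Z x ω)) - ∫ x in A, φ (Z x ω) := by
    filter_upwards [hZ.ae_integrableOn hG (hG2.integrable one_le_two) hA] with ω hω
    exact integral_sub hω (hZ.integrableOn_bdd hφ hM hA ω)
  have hmem : MemLp (fun ω => ∫ x in A, (G (Z x ω) - φ (Z x ω))) 2 P :=
    hZ.memLp_setIntegral hGφ hD2 hA
  refine (norm_integral_exp_sub_le_sqrt (hZ.stronglyMeasurable_integral hG A).measurable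
    (hZ.stronglyMeasurable_integral hφ A).measurable ((memLp_congr_ae e).1 hmem) τ).trans ?_
  gcongr
  have h := hZ.integral_sq_setIntegral_le hGφ hD2 hD0 hA hC
  rwa [integral_congr_ae (e.mono fun ω hω => congrArg (· ^ 2) hω)] at h

lemma IsMixingField.tendsto_charInt (hZ : IsMixingField P Z κ) (hG : Measurable G) {δ : ℝ}
    (hδ : 0 < δ) (hmom : Integrable (fun ω => |G (Z 0 ω)| ^ ((2 : ℝ) + δ)) P)
    (h0 : ∫ ω, G (Z 0 ω) ∂P = 0) (hV : IsVanHove V) (t : ℝ) :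
    Tendsto (fun n => charInt P Z G (t / √(volume (V n)).toReal) (V n)) atTop
      (𝓝 (Real.exp (-(t ^ 2 * (∫ x, covFn P Z G x) / 2)) : ℂ)) := by
  obtain ⟨g, hgi, hg1, hg2⟩ := hZ.exists_seq_approx hG hδ hmom
  have hm := hZ.measurable_apply 0
  have hG2 : MemLp (fun ω => G (Z 0 ω)) 2 P := memLp_two_of_rpow hδ (hG.comp hm) hmom
  have hgm : ∀ m, Measurable (g m) := fun m => (g m).continuous.measurable
  have hgn : ∀ m z, |g m z| ≤ ‖g m‖ := fun m z => (g m).norm_coe_le_norm z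
  have hgL : ∀ m, MemLp (fun ω => g m (Z 0 ω)) 2 P := fun m =>
    memLp_comp_of_bdd hm (hgm m) (hgn m) 2
  set c : ℕ → ℝ := fun m => ∫ ω, g m (Z 0 ω) ∂P with hc
  have hφc : ∀ m, Continuous fun z => g m z - c m := fun m => (g m).continuous.sub continuous_const
  have hφM : ∀ m z, |g m z - c m| ≤ ‖g m‖ + |c m| := fun m z =>
    (abs_sub _ _).trans (by gcongr; exact hgn m z)
  have hφ0 : ∀ m, ∫ ω, (g m (Z 0 ω) - c m) ∂P = 0 := fun m => by
    rw [integral_sub ((hgL m).integrable one_le_two) (integrable_const _)]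
    simp [hc]
  have hcov : ∀ m, covFn P Z (fun z => g m z - c m) = covFn P Z (g m) := fun m =>
    hZ.covFn_sub_const (hgm m) (hgL m) (c m)
  have hcovD : ∀ m, covFn P Z (fun z => G z - (g m z - c m)) = covFn P Z fun z => G z - g m z :=
    fun m => by
      rw [← hZ.covFn_sub_const (G := fun z => G z - g m z) (hG.sub (hgm m)) (hG2.sub (hgL m))
        (-c m)]
      congr 1
      funext z
      ring
  set a : ℕ → ℝ := fun m => ∫ x, |covFn P Z (fun z => G z - g m z) x| with ha
  set E : ℝ → ℝ := fun s => Real.exp (-(t ^ 2 * s / 2)) with hE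
  have hEc : Continuous E := by fun_prop
  have hlim : Tendsto (fun m => |t| * √(a m) + |E (∫ x, covFn P Z (g m) x)
      - E (∫ x, covFn P Z G x)|) atTop (𝓝 0) := by
    have h1 := ((Real.continuous_sqrt.tendsto _).comp hg1).const_mul |t|
    have h2 := (((hEc.tendsto _).comp hg2).sub_const (E (∫ x, covFn P Z G x))).abs
    simpa using! h1.add h2
  rw [tendsto_iff_norm_sub_tendsto_zero, Metric.tendsto_nhds]
  intro ε hε
  obtain ⟨m, hmε⟩ := (hlim.eventually_lt_const (half_pos hε)).exists
  have hbd := hZ.tendsto_charInt_of_bdd (hφc m) (hφM m) (hφ0 m) hV t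
  rw [hcov m, tendsto_iff_norm_sub_tendsto_zero] at hbd
  filter_upwards [hbd.eventually_lt_const (half_pos hε),
    hV.2.2.2.2.1.eventually_gt_atTop 0] with n hn hpos
  rw [Real.dist_eq, sub_zero, abs_of_nonneg (norm_nonneg _)]
  have h1 := hZ.norm_charInt_sub_charInt_le hG hG2 h0 (hφc m).measurable (hφM m) (hφ0 m)
    (by rw [hcovD m]; exact hgi m) (hV.1 n).measure_lt_top.ne (t / √(volume (V n)).toReal)
  rw [hcovD m] at h1
  have hs : 0 < √(volume (V n)).toReal := Real.sqrt_pos.2 hpos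
  have h2 : |t / √(volume (V n)).toReal| * √(volume.real (V n) * a m) = |t| * √(a m) := by
    rw [measureReal_def, Real.sqrt_mul hpos.le, abs_div, abs_of_pos hs]
    field_simp
  rw [h2] at h1
  set χ := charInt P Z (fun z => g m z - c m) (t / √(volume (V n)).toReal) (V n)
  have h3 := norm_sub_le_norm_sub_add_norm_sub
    (charInt P Z G (t / √(volume (V n)).toReal) (V n)) χ (E (∫ x, covFn P Z G x) : ℂ)
  have h4 := norm_sub_le_norm_sub_add_norm_sub χ (E (∫ x, covFn P Z (g m) x) : ℂ)
    (E (∫ x, covFn P Z G x) : ℂ)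
  rw [← Complex.ofReal_sub (E _) (E _), Complex.norm_real, Real.norm_eq_abs] at h4
  change ‖χ - (E (∫ x, covFn P Z (g m) x) : ℂ)‖ < ε / 2 at hn
  change ‖_ - (E (∫ x, covFn P Z G x) : ℂ)‖ < ε
  linarith

/-- The central limit theorem for mixing fields. -/
lemma IsMixingField.tendsto_integral (hZ : IsMixingField P Z κ) (hG : Measurable G) {δ : ℝ}
    (hδ : 0 < δ) (hmom : Integrable (fun ω => |G (Z 0 ω)| ^ ((2 : ℝ) + δ)) P)
    (h0 : ∫ ω, G (Z 0 ω) ∂P = 0) (hV : IsVanHove V) (hσ : 0 ≤ ∫ x, covFn P Z G x)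
    (f : BoundedContinuousFunction ℝ ℝ) :
    Tendsto (fun n => ∫ ω, f ((∫ x in V n, G (Z x ω)) / √(volume (V n)).toReal) ∂P) atTop
      (𝓝 (∫ x, f x ∂gaussianReal 0 (∫ x, covFn P Z G x).toNNReal)) := by
  have hm : ∀ n, Measurable fun ω => (∫ x in V n, G (Z x ω)) / √(volume (V n)).toReal := fun n =>
    (hZ.stronglyMeasurable_integral hG (V n)).measurable.div_const _
  let μ : ℕ → ProbabilityMeasure ℝ := fun n =>
    ⟨P.map fun ω => (∫ x in V n, G (Z x ω)) / √(volume (V n)).toReal,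
      Measure.isProbabilityMeasure_map (hm n).aemeasurable⟩
  let ν : ProbabilityMeasure ℝ := ⟨gaussianReal 0 (∫ x, covFn P Z G x).toNNReal, inferInstance⟩
  have h : Tendsto μ atTop (𝓝 ν) := by
    rw [ProbabilityMeasure.tendsto_iff_tendsto_charFun]
    intro t
    have hν : charFun (ν : Measure ℝ) t
        = (Real.exp (-(t ^ 2 * (∫ x, covFn P Z G x) / 2)) : ℂ) := by
      change charFun (gaussianReal _ _) t = _
      rw [charFun_gaussianReal, Complex.ofReal_exp]
      congr 1
      simp [hσ]
      ring
    have hμ : ∀ n, charFun (μ n : Measure ℝ) t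
        = charInt P Z G (t / √(volume (V n)).toReal) (V n) := fun n => by
      change charFun (P.map _) t = _
      rw [charFun_apply_real, integral_map (hm n).aemeasurable (by fun_prop)]
      refine integral_congr_ae (ae_of_all _ fun ω => ?_)
      simp only
      congr 1
      push_cast
      ring
    simp only [hμ, hν]
    exact hZ.tendsto_charInt hG hδ hmom h0 hV t
  have h' := ProbabilityMeasure.tendsto_iff_forall_integral_tendsto.1 h f
  refine h'.congr fun n => ?_
  change ∫ x, f x ∂(P.map _) = _
  exact integral_map (hm n).aemeasurable f.continuous.aestronglyMeasurable

end Mixing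

lemma integrable_exp_neg_mul_norm_rpow {E : Type*} [NormedAddCommGroup E] [NormedSpace ℝ E]
    [FiniteDimensional ℝ E] [MeasurableSpace E] [BorelSpace E] (μ : Measure E)
    [μ.IsAddHaarMeasure] {c α : ℝ} (hc : 0 < c) (hα : 0 < α) :
    Integrable (fun x : E => Real.exp (-(c * ‖x‖ ^ α))) μ := by
  set r : ℝ := Module.finrank ℝ E + 1 with hr
  have hr0 : 0 < r := by positivity
  have hlim : Tendsto (fun s : ℝ => (1 + s) ^ r * Real.exp (-(c * s ^ α))) atTop (𝓝 0) := by
    have h1 := (tendsto_rpow_mul_exp_neg_mul_atTop_nhds_zero (r / α) c hc).comp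
      (tendsto_rpow_atTop hα)
    have h2 := h1.const_mul (2 ^ r)
    rw [mul_zero] at h2
    refine squeeze_zero' ?_ ?_ h2
    · filter_upwards [eventually_ge_atTop 0] with s hs
      positivity
    · filter_upwards [eventually_ge_atTop 1] with s hs
      have hs0 : 0 ≤ s := by linarith
      have : (1 + s) ^ r ≤ 2 ^ r * s ^ r := by
        rw [← Real.mul_rpow zero_le_two hs0]
        exact Real.rpow_le_rpow (by linarith) (by linarith) hr0.le
      simp only [Function.comp]
      rw [← Real.rpow_mul hs0, mul_div_cancel₀ _ hα.ne', ← mul_assoc, neg_mul]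
      gcongr
  obtain ⟨N, hN⟩ := eventually_atTop.1 (hlim.eventually_le_const one_pos)
  have hN' : ∀ s, 0 ≤ s → Real.exp (-(c * s ^ α)) ≤ max 1 ((1 + |N|) ^ r) * (1 + s) ^ (-r) := by
    intro s hs
    have hp : 0 < (1 + s) ^ r := Real.rpow_pos_of_pos (by linarith) r
    rw [Real.rpow_neg (by linarith), ← div_eq_mul_inv, le_div_iff₀ hp, mul_comm]
    rcases le_total N s with h | h
    · exact (hN s h).trans (le_max_left _ _)
    · refine le_trans ?_ (le_max_right _ _)
      calc (1 + s) ^ r * Real.exp (-(c * s ^ α)) ≤ (1 + s) ^ r :=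
            mul_le_of_le_one_right hp.le (Real.exp_le_one_iff.2 (by
              have : 0 ≤ c * s ^ α := by positivity
              linarith))
        _ ≤ _ := Real.rpow_le_rpow (by linarith) (by linarith [le_abs_self N]) hr0.le
  refine ((integrable_one_add_norm (μ := μ) (r := r) (by rw [hr]; linarith)).const_mul
    (max 1 ((1 + |N|) ^ r))).mono' ?_ (ae_of_all _ fun x => ?_)
  · exact (by fun_prop : Measurable fun x : E => Real.exp (-(c * ‖x‖ ^ α))).aestronglyMeasurable
  · rw [Real.norm_eq_abs, abs_of_pos (Real.exp_pos _)]
    exact hN' _ (norm_nonneg _)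

lemma map_pair_of_stationary {Ω : Type*} [MeasurableSpace Ω] {P : Measure Ω} {d : ℕ}
    {Z : Space d → Ω → ℝ} (hZ : ∀ x, Measurable (Z x))
    (hstat : ∀ (x₀ : Space d) (n : ℕ) (x : Fin n → Space d),
      Measure.map (fun ω i => Z (x i + x₀) ω) P = Measure.map (fun ω i => Z (x i) ω) P)
    (x y : Space d) :
    P.map (fun ω => (Z x ω, Z y ω)) = P.map (fun ω => (Z 0 ω, Z (y - x) ω)) := by
  have hm : Measurable fun v : Fin 2 → ℝ => (v 0, v 1) := by fun_prop
  have hp : ∀ u : Fin 2 → Space d, P.map (fun ω => (Z (u 0) ω, Z (u 1) ω))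
      = (P.map fun ω i => Z (u i) ω).map fun v => (v 0, v 1) := fun u => by
    rw [Measure.map_map hm (measurable_pi_iff.2 fun i => hZ (u i))]
    rfl
  have h1 := hp fun i => ![0, y - x] i + x
  rw [hstat x 2 ![0, y - x], ← hp ![0, y - x]] at h1
  simpa using h1

end BrownResnick

/-- **CLT for functions of the Brown–Resnick random field with a power variogram.**
Let `Z` be a strictly stationary, sample-continuous, jointly measurable version of the
Brown–Resnick random field associated with the variogram `γ(x) = η‖x‖^α`, `η > 0`,
`α ∈ (0,2]`, and let `F` be Borel measurable with a `(2+δ)`-moment and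
`σ² = ∫ Cov(F(Z(0)), F(Z(x))) dx > 0`. Then `X = F(Z(·))` satisfies the CLT. -/
theorem clt_brownResnick
    {d : ℕ} (hd : 0 < d) {Ω : Type*} [MeasurableSpace Ω]
    (P : Measure Ω) [IsProbabilityMeasure P]
    (η α : ℝ) (hη : 0 < η) (hα : 0 < α ∧ α ≤ 2)
    (W : EuclideanSpace ℝ (Fin d) → Ω → ℝ)
    (hWmeas : ∀ x, Measurable (W x))
    -- centred Gaussian random field: every finite linear combination is centred Gaussian
    (hgauss : ∀ (n : ℕ) (x : Fin n → EuclideanSpace ℝ (Fin d)) (c : Fin n → ℝ),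
      ∃ v : ℝ≥0, Measure.map (fun ω => ∑ i, c i * W (x i) ω) P = gaussianReal 0 v)
    -- stationary increments
    (hinc : ∀ (x₀ : EuclideanSpace ℝ (Fin d)) (n : ℕ)
      (x : Fin n → EuclideanSpace ℝ (Fin d)),
      Measure.map (fun ω i => W (x i + x₀) ω - W x₀ ω) P
        = Measure.map (fun ω i => W (x i) ω - W 0 ω) P)
    -- W(0) = 0 almost surely
    (hW0 : ∀ᵐ ω ∂P, W 0 ω = 0)
    -- power variogram: Var(W(x)) = η‖x‖^α
    (hvar : ∀ x : EuclideanSpace ℝ (Fin d), ∫ ω, (W x ω) ^ 2 ∂P = η * ‖x‖ ^ α)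
    -- the spectral field of the Brown–Resnick field
    (Y : EuclideanSpace ℝ (Fin d) → Ω → ℝ)
    (hY : ∀ x ω, Y x ω = Real.exp (W x ω - η * ‖x‖ ^ α / 2))
    (Z : EuclideanSpace ℝ (Fin d) → Ω → ℝ)
    -- joint measurability
    (hjm : Measurable fun p : EuclideanSpace ℝ (Fin d) × Ω => Z p.1 p.2)
    -- sample continuity
    (hcont : ∀ᵐ ω ∂P, Continuous fun x => Z x ω)
    -- strict stationarity
    (hstat : ∀ (x₀ : EuclideanSpace ℝ (Fin d)) (n : ℕ)
      (x : Fin n → EuclideanSpace ℝ (Fin d)),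
      Measure.map (fun ω i => Z (x i + x₀) ω) P = Measure.map (fun ω i => Z (x i) ω) P)
    -- the finite-dimensional distributions are those of the Brown–Resnick field
    (hfdd : ∀ (n : ℕ) (x : Fin n → EuclideanSpace ℝ (Fin d)) (z : Fin n → ℝ),
      (∀ i, 0 < z i) →
      P {ω | ∀ i, Z (x i) ω ≤ z i}
        = ENNReal.ofReal (Real.exp (-(∫ ω, ⨆ i, Y (x i) ω / z i ∂P))))
    (δ : ℝ) (hδ : 0 < δ)
    (F : ℝ → ℝ) (hF : Measurable F)
    -- moment condition
    (hmom : Integrable (fun ω => |F (Z 0 ω)| ^ ((2 : ℝ) + δ)) P)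
    -- positive asymptotic variance
    (σ2 : ℝ)
    (hσ2def : σ2 = ∫ x, cov P (fun ω => F (Z 0 ω)) (fun ω => F (Z x ω)) ∂volume)
    (hσ2pos : 0 < σ2) :
    Integrable
      (fun x => |cov P (fun ω => F (Z 0 ω)) (fun ω => F (Z x ω))|) volume ∧
    ∀ V : ℕ → Set (EuclideanSpace ℝ (Fin d)), IsVanHove V →
      TendstoInDistribution P
        (fun n ω =>
          (∫ x in V n, (F (Z x ω) - ∫ ω', F (Z x ω') ∂P) ∂volume)
            / Real.sqrt (volume (V n)).toReal)
        (gaussianReal 0 (Real.toNNReal σ2)) := by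
  have hZm : ∀ x, Measurable (Z x) := fun x => hjm.comp measurable_prodMk_left
  have hκc : Continuous fun x : BrownResnick.Space d => Real.exp (-(η * ‖x‖ ^ α / 8)) := by
    have : Continuous fun x : BrownResnick.Space d => ‖x‖ ^ α :=
      continuous_norm.rpow_const fun _ => Or.inr hα.1.le
    fun_prop
  have hZ : BrownResnick.IsMixingField P Z fun x => Real.exp (-(η * ‖x‖ ^ α / 8)) :=
    { measurable := hjm
      continuous := hcont
      map_pair := BrownResnick.map_pair_of_stationary hZm hstat
      kernel_pos := fun x => Real.exp_pos _
      kernel_le_one := fun x => Real.exp_le_one_iff.2 (by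
        have : 0 ≤ η * ‖x‖ ^ α / 8 := by positivity
        linarith)
      kernel_neg := fun x => by rw [norm_neg]
      kernel_continuous := hκc
      kernel_integrable := fun θ hθ => by
        refine (BrownResnick.integrable_exp_neg_mul_norm_rpow volume (c := η / 8 * θ) (α := α)
          (by positivity) hα.1).congr (ae_of_all _ fun x => ?_)
        simp only
        rw [← Real.exp_mul]
        congr 1
        ring
      norm_cov_le := fun x _ _ hf hg _ hfC hgC _ _ hc hc' hfc hgc =>
        BrownResnick.norm_cov_field_le hWmeas hgauss hinc hW0 hvar hY hZm hfdd x hf hg hfC hgC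
          hc hc' hfc hgc }
  refine ⟨(hZ.integrable_covFn hF hδ hmom).abs, fun V hV f => ?_⟩
  set m := ∫ ω, F (Z 0 ω) ∂P with hm
  have hF2 : MemLp (fun ω => F (Z 0 ω)) 2 P :=
    BrownResnick.memLp_two_of_rpow hδ (hF.comp (hZm 0)) hmom
  have hcov : BrownResnick.covFn P Z (fun z => F z - m) = BrownResnick.covFn P Z F :=
    hZ.covFn_sub_const hF hF2 m
  have hσ : ∫ x, BrownResnick.covFn P Z (fun z => F z - m) x = σ2 := by
    rw [hcov, hσ2def]; rfl
  have hG : Measurable fun z => F z - m := hF.sub_const m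
  have hGmom : Integrable (fun ω => |F (Z 0 ω) - m| ^ ((2 : ℝ) + δ)) P := by
    refine ((hmom.add (integrable_const (|-m| ^ ((2 : ℝ) + δ)))).const_mul
      (2 ^ ((2 : ℝ) + δ))).mono' ((hG.comp (hZm 0)).abs.pow_const _).aestronglyMeasurable
      (ae_of_all _ fun ω => ?_)
    rw [Real.norm_eq_abs, abs_of_nonneg (by positivity), sub_eq_add_neg]
    exact BrownResnick.abs_add_rpow_le (by positivity) _ _
  have h0 : ∫ ω, (F (Z 0 ω) - m) ∂P = 0 := by
    rw [integral_sub (hF2.integrable one_le_two) (integrable_const _)]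
    simp [hm]
  have h := hZ.tendsto_integral hG hδ hGmom h0 hV (hσ ▸ hσ2pos.le) f
  rw [hσ] at h
  simpa only [hZ.integral_comp hF] using h

end
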